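/- Let u be a smooth solution to the special Lagrangian equation ∑_{i=1}^n arctan λᵢ(x) = c on all of ℝⁿ. Suppose that 3 + (1−ε)λᵢ(x)² + 2λᵢ(x)λⱼ(x) ≥ 0 for all indices i, j, all x ∈ ℝⁿ, and some fixed ε > 0, and that the gradient satisfies |∇u(x)| ≤ δ|x| for all sufficiently large |x|, where δ < 1/√(n−1) is a fixed constant. Then u is a quadratic polynomial. -/

import Mathlib

noncomputable section

/-- The Hessian matrix `D²u(x)`, with entries `∂ᵢ∂ⱼ u (x)`. -/
def Hess {n : ℕ} (u : EuclideanSpace ℝ (Fin n) → ℝ) (x : EuclideanSpace ℝ (Fin n)) :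
    Matrix (Fin n) (Fin n) ℝ :=
  Matrix.of fun i j =>
    iteratedFDeriv ℝ 2 u x ![EuclideanSpace.single i 1, EuclideanSpace.single j 1]

/-- The induced metric `g = I + D²u · D²u` on the gradient graph `(x, ∇u(x))`. -/
def gMat {n : ℕ} (u : EuclideanSpace ℝ (Fin n) → ℝ) (x : EuclideanSpace ℝ (Fin n)) :
    Matrix (Fin n) (Fin n) ℝ :=
  1 + Hess u x * Hess u x

/-- The Laplace–Beltrami operator `Δ_g v = ∑ g^{ij} ∂ᵢ∂ⱼ v` of the induced metric. -/
def lapg {n : ℕ} (u v : EuclideanSpace ℝ (Fin n) → ℝ) (x : EuclideanSpace ℝ (Fin n)) : ℝ :=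
  ∑ i, ∑ j, (gMat u x)⁻¹ i j *
    iteratedFDeriv ℝ 2 v x ![EuclideanSpace.single i 1, EuclideanSpace.single j 1]

/-- The squared metric gradient norm `|∇_g v|²_g = ∑ g^{ij} ∂ᵢv ∂ⱼv`. -/
def gradSq {n : ℕ} (u v : EuclideanSpace ℝ (Fin n) → ℝ) (x : EuclideanSpace ℝ (Fin n)) : ℝ :=
  ∑ i, ∑ j, (gMat u x)⁻¹ i j * fderiv ℝ v x (EuclideanSpace.single i 1) *
    fderiv ℝ v x (EuclideanSpace.single j 1)

/-- The volume element `V = √(det g)`. -/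
def Vol {n : ℕ} (u : EuclideanSpace ℝ (Fin n) → ℝ) (x : EuclideanSpace ℝ (Fin n)) : ℝ :=
  Real.sqrt ((gMat u x).det)

end

abbrev EE (n : ℕ) := EuclideanSpace ℝ (Fin n)

/-- partial derivative -/
noncomputable def pd {n : ℕ} (i : Fin n) (f : EE n → ℝ) (x : EE n) : ℝ :=
  fderiv ℝ f x (EuclideanSpace.single i 1)

section pdcalc
variable {n : ℕ}

lemma pd_contDiff {i : Fin n} {f : EE n → ℝ} {m k : WithTop ℕ∞} (hf : ContDiff ℝ k f) (h : m + 1 ≤ k) :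
    ContDiff ℝ m (pd i f) :=
  (hf.fderiv_right h).clm_apply contDiff_const

lemma pd_smooth {i : Fin n} {f : EE n → ℝ} (hf : ContDiff ℝ (⊤ : ℕ∞) f) :
    ContDiff ℝ (⊤ : ℕ∞) (pd i f) := pd_contDiff hf (by simp)

lemma pd_const (i : Fin n) (c : ℝ) (x : EE n) : pd i (fun _ => c) x = 0 := by
  simp [pd]

lemma pd_add {i : Fin n} {f g : EE n → ℝ} {x : EE n} (hf : DifferentiableAt ℝ f x)
    (hg : DifferentiableAt ℝ g x) : pd i (fun y => f y + g y) x = pd i f x + pd i g x := by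
  simp [pd, fderiv_fun_add hf hg]

lemma pd_sub {i : Fin n} {f g : EE n → ℝ} {x : EE n} (hf : DifferentiableAt ℝ f x)
    (hg : DifferentiableAt ℝ g x) : pd i (fun y => f y - g y) x = pd i f x - pd i g x := by
  simp [pd, fderiv_fun_sub hf hg]

lemma pd_mul {i : Fin n} {f g : EE n → ℝ} {x : EE n} (hf : DifferentiableAt ℝ f x)
    (hg : DifferentiableAt ℝ g x) :
    pd i (fun y => f y * g y) x = pd i f x * g x + f x * pd i g x := by
  simp [pd, fderiv_fun_mul hf hg]; ring

lemma pd_const_mul {i : Fin n} {f : EE n → ℝ} {x : EE n} (c : ℝ) (hf : DifferentiableAt ℝ f x) :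
    pd i (fun y => c * f y) x = c * pd i f x := by
  rw [pd_mul (by fun_prop) hf, pd_const]; ring

lemma pd_sum {ι : Type*} {s : Finset ι} {i : Fin n} {f : ι → EE n → ℝ} {x : EE n}
    (hf : ∀ a ∈ s, DifferentiableAt ℝ (f a) x) :
    pd i (fun y => ∑ a ∈ s, f a y) x = ∑ a ∈ s, pd i (f a) x := by
  simp [pd, fderiv_fun_sum hf]

lemma pd_comp {i : Fin n} {f : EE n → ℝ} {x : EE n} {h : ℝ → ℝ} {h' : ℝ}
    (hh : HasDerivAt h h' (f x)) (hf : DifferentiableAt ℝ f x) :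
    pd i (fun y => h (f y)) x = h' * pd i f x := by
  have := (hh.comp_hasFDerivAt x hf.hasFDerivAt).fderiv
  simp only [pd]
  rw [show (fun y => h (f y)) = h ∘ f from rfl, this]; simp

lemma pd_coord (i j : Fin n) (x : EE n) : pd i (fun y => y j) x = if i = j then 1 else 0 := by
  have : HasFDerivAt (fun y : EE n => y j) (EuclideanSpace.proj j : EE n →L[ℝ] ℝ) x :=
    (EuclideanSpace.proj j : EE n →L[ℝ] ℝ).hasFDerivAt
  simp [pd, this.fderiv, Pi.single_apply, eq_comm]

lemma fderiv_eq_sum_pd {f : EE n → ℝ} (x v : EE n) :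
    fderiv ℝ f x v = ∑ i, v i * pd i f x := by
  conv_lhs => rw [← (EuclideanSpace.basisFun (Fin n) ℝ).sum_repr v]
  simp [pd]

lemma pd_pd_eq {f : EE n → ℝ} (hf : ContDiff ℝ 2 f) (i j : Fin n) (x : EE n) :
    pd i (pd j f) x = iteratedFDeriv ℝ 2 f x ![EuclideanSpace.single i 1, EuclideanSpace.single j 1] := by
  rw [iteratedFDeriv_two_apply]
  have h1 : DifferentiableAt ℝ (fderiv ℝ f) x :=
    ((hf.fderiv_right (m := 1) (by norm_num)).differentiable (by norm_num)) x
  simp only [pd, Matrix.cons_val_zero, Matrix.cons_val_one]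
  have : fderiv ℝ (fun x => (fderiv ℝ f x) (EuclideanSpace.single j 1)) x =
    (fderiv ℝ (fderiv ℝ f) x).flip (EuclideanSpace.single j 1) := by
    rw [fderiv_clm_apply h1 (by fun_prop)]; simp
  change fderiv ℝ (fun x => (fderiv ℝ f x) (EuclideanSpace.single j 1)) x _ = _
  rw [this]; rfl

lemma pd_comm {f : EE n → ℝ} (hf : ContDiff ℝ 2 f) (i j : Fin n) (x : EE n) :
    pd i (pd j f) x = pd j (pd i f) x := by
  rw [pd_pd_eq hf, pd_pd_eq hf, iteratedFDeriv_two_apply, iteratedFDeriv_two_apply]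
  have := (hf.contDiffAt (x := x)).isSymmSndFDerivAt (by simp)
  exact this _ _

lemma pd_comm_fun {f : EE n → ℝ} (hf : ContDiff ℝ 2 f) (i j : Fin n) :
    pd i (pd j f) = pd j (pd i f) := funext fun x => pd_comm hf i j x

end pdcalc


section detderiv
open Matrix

lemma hasDerivAt_det {n : ℕ} {M : ℝ → Matrix (Fin n) (Fin n) ℂ} {M' : Matrix (Fin n) (Fin n) ℂ}
    {t : ℝ} (h : ∀ i j, HasDerivAt (fun s => M s i j) (M' i j) t) :
    HasDerivAt (fun s => (M s).det) (trace (adjugate (M t) * M')) t := by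
  have key : trace (adjugate (M t) * M') =
      ∑ σ : Equiv.Perm (Fin n), (Equiv.Perm.sign σ : ℤ) •
        ∑ i, (∏ j ∈ Finset.univ.erase i, M t (σ j) j) • M' (σ i) i := by
    have h1 : trace (adjugate (M t) * M') = ∑ i, ((M t).updateCol i (fun k => M' k i)).det := by
      simp only [trace, diag_apply, mul_apply]
      refine Finset.sum_congr rfl fun i _ => ?_
      rw [← cramer_apply, cramer_eq_adjugate_mulVec]
      rfl
    rw [h1]
    simp only [det_apply]
    rw [Finset.sum_comm]
    refine Finset.sum_congr rfl fun σ _ => ?_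
    rw [Finset.smul_sum]
    refine Finset.sum_congr rfl fun i _ => ?_
    rw [← Finset.mul_prod_erase _ _ (Finset.mem_univ i)]
    rw [Units.smul_def]
    congr 1
    rw [mul_comm, smul_eq_mul]
    congr 1
    · refine Finset.prod_congr rfl fun j hj => ?_
      rw [updateCol_ne (Finset.ne_of_mem_erase hj)]
    · simp
  rw [key]
  simp only [det_apply]
  refine HasDerivAt.fun_sum fun σ _ => ?_
  rw [show (fun s => Equiv.Perm.sign σ • ∏ i, M s (σ i) i) =
    fun s => (Equiv.Perm.sign σ : ℤ) • ∏ i, M s (σ i) i from rfl]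
  simp only [zsmul_eq_mul]
  exact (HasDerivAt.fun_finsetProd (u := Finset.univ) (f := fun i s => M s (σ i) i)
    (f' := fun i => M' (σ i) i) (fun i _ => h (σ i) i)).const_mul _

lemma exists_spec {n : ℕ} {A : Matrix (Fin n) (Fin n) ℝ} (hA : A.IsHermitian) :
    ∃ Q : Matrix (Fin n) (Fin n) ℝ, Q * Qᵀ = 1 ∧ Qᵀ * Q = 1 ∧
      A = Q * diagonal hA.eigenvalues * Qᵀ := by
  refine ⟨hA.eigenvectorUnitary, ?_, ?_, ?_⟩
  · exact Unitary.coe_mul_star_self hA.eigenvectorUnitary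
  · exact Unitary.coe_star_mul_self hA.eigenvectorUnitary
  · have := hA.spectral_theorem
    conv_lhs => rw [this]
    simp [Unitary.conjStarAlgAut_apply]
    rfl

end detderiv

section geom
open Matrix
variable {n : ℕ} {u : EE n → ℝ}

lemma two_le_top : (2 : WithTop ℕ∞) ≤ ((⊤ : ℕ∞) : WithTop ℕ∞) := by
  exact WithTop.coe_le_coe.2 (le_top : (2:ℕ∞) ≤ ⊤)

lemma one_le_top' : (1 : WithTop ℕ∞) ≤ ((⊤ : ℕ∞) : WithTop ℕ∞) := by
  exact WithTop.coe_le_coe.2 (le_top : (1:ℕ∞) ≤ ⊤)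

lemma smooth_diff {f : EE n → ℝ} (hf : ContDiff ℝ (⊤ : ℕ∞) f) : Differentiable ℝ f :=
  hf.differentiable (by simp)

lemma Hess_apply (hu : ContDiff ℝ (⊤ : ℕ∞) u) (x : EE n) (i j : Fin n) :
    Hess u x i j = pd i (pd j u) x := (pd_pd_eq (hu.of_le two_le_top) i j x).symm

lemma Hess_smooth (hu : ContDiff ℝ (⊤ : ℕ∞) u) (i j : Fin n) :
    ContDiff ℝ (⊤ : ℕ∞) (fun x => Hess u x i j) := by
  simp only [Hess_apply hu]; exact pd_smooth (pd_smooth hu)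

lemma Hess_symm (hu : ContDiff ℝ (⊤ : ℕ∞) u) (x : EE n) : (Hess u x)ᵀ = Hess u x := by
  ext i j
  simp only [transpose_apply, Hess_apply hu]
  exact pd_comm (hu.of_le two_le_top) _ _ _

/-- third derivatives, as matrices -/
noncomputable def T3 (u : EE n → ℝ) (k : Fin n) (x : EE n) : Matrix (Fin n) (Fin n) ℝ :=
  Matrix.of fun i j => pd k (pd i (pd j u)) x

lemma T3_smooth (hu : ContDiff ℝ (⊤ : ℕ∞) u) (k i j : Fin n) :
    ContDiff ℝ (⊤ : ℕ∞) (fun x => T3 u k x i j) := pd_smooth (pd_smooth (pd_smooth hu))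

lemma T3_eq (hu : ContDiff ℝ (⊤ : ℕ∞) u) (k i j : Fin n) (x : EE n) :
    T3 u k x i j = pd k (fun y => Hess u y i j) x := by
  simp only [Hess_apply hu]; rfl

lemma T3_swap12 (hu : ContDiff ℝ (⊤ : ℕ∞) u) (k i j : Fin n) (x : EE n) :
    T3 u k x i j = T3 u i x k j := pd_comm ((pd_smooth hu).of_le two_le_top) _ _ _

lemma T3_swap23 (hu : ContDiff ℝ (⊤ : ℕ∞) u) (k i j : Fin n) (x : EE n) :
    T3 u k x i j = T3 u k x j i := by
  simp only [T3, of_apply]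
  rw [pd_comm_fun (hu.of_le two_le_top)]

lemma smooth_det {M : EE n → Matrix (Fin n) (Fin n) ℝ}
    (h : ∀ i j, ContDiff ℝ (⊤ : ℕ∞) (fun x => M x i j)) :
    ContDiff ℝ (⊤ : ℕ∞) (fun x => (M x).det) := by
  simp only [det_apply]
  refine ContDiff.sum fun σ _ => ?_
  exact (contDiff_prod fun i _ => h _ _).const_smul (Equiv.Perm.sign σ : ℤ)

lemma gMat_smooth (hu : ContDiff ℝ (⊤ : ℕ∞) u) (i j : Fin n) :
    ContDiff ℝ (⊤ : ℕ∞) (fun x => gMat u x i j) := by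
  simp only [gMat, Matrix.add_apply, Matrix.mul_apply]
  exact contDiff_const.add (ContDiff.sum fun k _ => (Hess_smooth hu _ _).mul (Hess_smooth hu _ _))

/-- spectral data of the Hessian at a point -/
structure Spec (u : EE n → ℝ) (x : EE n) (Q : Matrix (Fin n) (Fin n) ℝ) (l : Fin n → ℝ) : Prop where
  h1 : Q * Qᵀ = 1
  h2 : Qᵀ * Q = 1
  h3 : Hess u x = Q * diagonal l * Qᵀ

lemma qcj_mul {Q : Matrix (Fin n) (Fin n) ℝ} (h2 : Qᵀ * Q = 1) (a b : Fin n → ℝ) :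
    (Q * diagonal a * Qᵀ) * (Q * diagonal b * Qᵀ) = Q * diagonal (fun i => a i * b i) * Qᵀ := by
  calc _ = Q * diagonal a * (Qᵀ * Q) * diagonal b * Qᵀ := by simp only [Matrix.mul_assoc]
    _ = _ := by rw [h2, Matrix.mul_one, Matrix.mul_assoc Q, diagonal_mul_diagonal]

lemma qcj_one {Q : Matrix (Fin n) (Fin n) ℝ} (h1 : Q * Qᵀ = 1) :
    Q * diagonal (fun _ => (1:ℝ)) * Qᵀ = 1 := by
  rw [diagonal_one, Matrix.mul_one, h1]

lemma qcj_add {Q : Matrix (Fin n) (Fin n) ℝ} (a b : Fin n → ℝ) :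
    (Q * diagonal a * Qᵀ) + (Q * diagonal b * Qᵀ) = Q * diagonal (fun i => a i + b i) * Qᵀ := by
  rw [← diagonal_add, Matrix.mul_add, Matrix.add_mul]

lemma qcj_det {Q : Matrix (Fin n) (Fin n) ℝ} (h1 : Q * Qᵀ = 1) (a : Fin n → ℝ) :
    (Q * diagonal a * Qᵀ).det = ∏ i, a i := by
  rw [det_mul, det_mul, mul_right_comm, ← det_mul, h1, det_one, one_mul, det_diagonal]

namespace Spec
variable {x : EE n} {Q : Matrix (Fin n) (Fin n) ℝ} {l : Fin n → ℝ}

lemma g_eq (S : Spec u x Q l) : gMat u x = Q * diagonal (fun i => 1 + l i ^ 2) * Qᵀ := by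
  rw [gMat, S.h3, qcj_mul S.h2, ← qcj_one S.h1, qcj_add]
  simp only [sq]

lemma det_eq (S : Spec u x Q l) : (gMat u x).det = ∏ i, (1 + l i ^ 2) := by
  rw [S.g_eq, qcj_det S.h1]

lemma inv_eq (S : Spec u x Q l) : (gMat u x)⁻¹ = Q * diagonal (fun i => (1 + l i ^ 2)⁻¹) * Qᵀ := by
  apply Matrix.inv_eq_right_inv
  rw [S.g_eq, qcj_mul S.h2, ← qcj_one S.h1]
  congr; ext i; exact mul_inv_cancel₀ (by positivity)

lemma det_pos (S : Spec u x Q l) : 0 < (gMat u x).det := by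
  rw [S.det_eq]; exact Finset.prod_pos fun i _ => by positivity

end Spec

lemma exists_Spec (hsym : ∀ x, (Hess u x).IsHermitian) (x : EE n) :
    ∃ Q, Spec u x Q (hsym x).eigenvalues := by
  obtain ⟨Q, a, b, c⟩ := exists_spec (hsym x)
  exact ⟨Q, a, b, c⟩

lemma Hess_herm (hu : ContDiff ℝ (⊤ : ℕ∞) u) (x : EE n) : (Hess u x).IsHermitian := by
  rw [IsHermitian, conjTranspose_eq_transpose_of_trivial, Hess_symm hu]

lemma exists_Spec' (hu : ContDiff ℝ (⊤ : ℕ∞) u) (x : EE n) :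
    ∃ Q l, Spec u x Q l := by
  obtain ⟨Q, a⟩ := exists_Spec (Hess_herm hu) x
  exact ⟨Q, _, a⟩

lemma g_det_pos (hu : ContDiff ℝ (⊤ : ℕ∞) u) (x : EE n) : 0 < (gMat u x).det := by
  obtain ⟨Q, l, S⟩ := exists_Spec' hu x; exact S.det_pos

lemma Vol_pos (hu : ContDiff ℝ (⊤ : ℕ∞) u) (x : EE n) : 0 < Vol u x :=
  Real.sqrt_pos.2 (g_det_pos hu x)

lemma Vol_smooth (hu : ContDiff ℝ (⊤ : ℕ∞) u) : ContDiff ℝ (⊤ : ℕ∞) (Vol u) :=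
  (smooth_det (gMat_smooth hu)).sqrt fun x => (g_det_pos hu x).ne'

noncomputable def gi (u : EE n → ℝ) (x : EE n) : Matrix (Fin n) (Fin n) ℝ := (gMat u x)⁻¹

lemma gi_smooth (hu : ContDiff ℝ (⊤ : ℕ∞) u) (i j : Fin n) :
    ContDiff ℝ (⊤ : ℕ∞) (fun x => gi u x i j) := by
  have : ∀ x, gi u x i j = ((gMat u x).det)⁻¹ * ((gMat u x).updateRow j (Pi.single i 1)).det := by
    intro x
    rw [gi, inv_def, Ring.inverse_eq_inv', Matrix.smul_apply, adjugate_apply, smul_eq_mul]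
  simp only [this]
  refine (ContDiff.inv (smooth_det (gMat_smooth hu)) fun x => (g_det_pos hu x).ne').mul ?_
  refine smooth_det fun a b => ?_
  by_cases h : a = j
  · subst h; simp only [updateRow_self]; exact contDiff_const
  · simp only [updateRow_ne h]; exact gMat_smooth hu _ _

lemma gi_mul (hu : ContDiff ℝ (⊤ : ℕ∞) u) (x : EE n) : gMat u x * gi u x = 1 :=
  mul_nonsing_inv _ (g_det_pos hu x).ne'.isUnit
lemma mul_gi (hu : ContDiff ℝ (⊤ : ℕ∞) u) (x : EE n) : gi u x * gMat u x = 1 :=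
  nonsing_inv_mul _ (g_det_pos hu x).ne'.isUnit

lemma gi_symm (hu : ContDiff ℝ (⊤ : ℕ∞) u) (x : EE n) : (gi u x)ᵀ = gi u x := by
  rw [gi, transpose_nonsing_inv, gMat, transpose_add, transpose_mul, Hess_symm hu, transpose_one]

lemma gi_comm (hu : ContDiff ℝ (⊤ : ℕ∞) u) (x : EE n) : gi u x * Hess u x = Hess u x * gi u x := by
  have h : gMat u x * Hess u x = Hess u x * gMat u x := by
    simp [gMat, Matrix.add_mul, Matrix.mul_add, Matrix.mul_assoc]
  calc gi u x * Hess u x = gi u x * (Hess u x * gMat u x) * gi u x := by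
        rw [Matrix.mul_assoc, Matrix.mul_assoc (Hess u x), gi_mul hu, Matrix.mul_one]
    _ = (gi u x * gMat u x) * Hess u x * gi u x := by rw [← h]; simp only [Matrix.mul_assoc]
    _ = _ := by rw [mul_gi hu, Matrix.one_mul]

end geom

section eqns
open Matrix
variable {n : ℕ} {u : EE n → ℝ}

lemma hasDerivAt_line {f : EE n → ℝ} (hf : Differentiable ℝ f) (x : EE n) (k : Fin n) :
    HasDerivAt (fun t : ℝ => f (x + t • EuclideanSpace.single k (1:ℝ))) (pd k f x) 0 := by
  have h1 : HasDerivAt (fun t : ℝ => x + t • (EuclideanSpace.single k (1:ℝ) : EE n))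
      (EuclideanSpace.single k (1:ℝ)) 0 := by
    simpa using ((hasDerivAt_id (0:ℝ)).smul_const (EuclideanSpace.single k (1:ℝ) : EE n)).const_add x
  have h2 : HasFDerivAt f (fderiv ℝ f x) (x + (0:ℝ) • EuclideanSpace.single k (1:ℝ)) := by
    simpa using (hf x).hasFDerivAt
  exact h2.comp_hasDerivAt (0:ℝ) h1

/-- real to complex matrices -/
noncomputable abbrev cm : Matrix (Fin n) (Fin n) ℝ →+* Matrix (Fin n) (Fin n) ℂ :=
  Complex.ofRealHom.mapMatrix

lemma cm_trace (A : Matrix (Fin n) (Fin n) ℝ) : trace (cm A) = ((trace A : ℝ) : ℂ) := by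
  simp [trace]

lemma complex_det {c : ℝ}
    (hsym : ∀ x, (Hess u x).IsHermitian)
    (hsol : ∀ x, ∑ i, Real.arctan ((hsym x).eigenvalues i) = c) (x : EE n) :
    (1 + Complex.I • cm (Hess u x)).det = (Vol u x : ℂ) * Complex.exp (c * Complex.I) := by
  obtain ⟨Q, S⟩ := exists_Spec hsym x
  set l := (hsym x).eigenvalues with hl
  have hQ : cm Q * cm Qᵀ = 1 := by rw [← map_mul, S.h1, map_one]
  have hd : cm (diagonal l) = diagonal (fun i => (l i : ℂ)) := by
    ext i j; by_cases h : i = j <;> simp [h]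
  have e1 : (1 + Complex.I • cm (Hess u x)) =
      cm Q * diagonal (fun i => 1 + Complex.I * (l i : ℂ)) * cm Qᵀ := by
    have : diagonal (fun i => 1 + Complex.I * (l i : ℂ)) =
      1 + Complex.I • diagonal (fun i => (l i : ℂ)) := by
      ext i j; by_cases h : i = j <;> simp [h]
    rw [this, S.h3, map_mul, map_mul, hd, Matrix.mul_add, Matrix.add_mul, Matrix.mul_one, hQ,
      Matrix.mul_smul, Matrix.smul_mul]
  have e2 : (1 + Complex.I • cm (Hess u x)).det = ∏ i, (1 + Complex.I * (l i : ℂ)) := by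
    rw [e1, det_mul, det_mul, mul_right_comm, ← det_mul, hQ, det_one, one_mul, det_diagonal]
  have e3 : ∀ i, 1 + Complex.I * (l i : ℂ) =
      (Real.sqrt (1 + l i ^ 2) : ℂ) * Complex.exp (Real.arctan (l i) * Complex.I) := by
    intro i
    rw [Complex.exp_mul_I, ← Complex.ofReal_cos, ← Complex.ofReal_sin, Real.cos_arctan, Real.sin_arctan]
    have : (Real.sqrt (1 + l i ^ 2) : ℂ) ≠ 0 := by
      exact_mod_cast (Real.sqrt_pos.2 (by positivity)).ne'
    push_cast
    field_simp
  rw [e2, Finset.prod_congr rfl (fun i _ => e3 i), Finset.prod_mul_distrib, ← Complex.exp_sum,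
    ← Finset.sum_mul]
  congr 2
  · rw [Vol, S.det_eq, Real.sqrt_prod _ (fun i _ => by positivity)]; push_cast; rfl
  · rw [← hsol x]; push_cast; rfl

/-- The linearized equation and the gradient of the volume element. -/
lemma first_order (hu : ContDiff ℝ (⊤ : ℕ∞) u) {c : ℝ}
    (hsym : ∀ x, (Hess u x).IsHermitian)
    (hsol : ∀ x, ∑ i, Real.arctan ((hsym x).eigenvalues i) = c) (x : EE n) (k : Fin n) :
    trace (gi u x * T3 u k x) = 0 ∧
      pd k (Vol u) x = Vol u x * trace (Hess u x * gi u x * T3 u k x) := by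
  set e : EE n := EuclideanSpace.single k (1:ℝ) with he
  have hD := fun t : ℝ => complex_det hsym hsol (x + t • e)
  have h1 : HasDerivAt (fun t : ℝ => (1 + Complex.I • cm (Hess u (x + t • e))).det)
      (trace (adjugate (1 + Complex.I • cm (Hess u x)) * (Complex.I • cm (T3 u k x)))) 0 := by
    have := hasDerivAt_det (M := fun t : ℝ => (1 + Complex.I • cm (Hess u (x + t • e))))
      (M' := Complex.I • cm (T3 u k x)) (t := 0) ?_
    · simpa using this
    · intro i j
      have h := hasDerivAt_line (smooth_diff (Hess_smooth hu i j)) x k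
      rw [← T3_eq hu] at h
      have h' := ((h.ofReal_comp).const_mul Complex.I).const_add ((1 : Matrix (Fin n) (Fin n) ℂ) i j)
      simpa using h'
  have h2 : HasDerivAt (fun t : ℝ => (1 + Complex.I • cm (Hess u (x + t • e))).det)
      ((pd k (Vol u) x : ℂ) * Complex.exp (c * Complex.I)) 0 := by
    simp only [hD]
    exact ((hasDerivAt_line (smooth_diff (Vol_smooth hu)) x k).ofReal_comp).mul_const _
  have h3 := h1.unique h2
  have hMN : (1 + Complex.I • cm (Hess u x)) * ((1 - Complex.I • cm (Hess u x)) * cm (gi u x)) = 1 := by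
    rw [← Matrix.mul_assoc]
    have : (1 + Complex.I • cm (Hess u x)) * (1 - Complex.I • cm (Hess u x)) = cm (gMat u x) := by
      rw [gMat, map_add, map_mul, map_one]
      have hI : ∀ B : Matrix (Fin n) (Fin n) ℂ, Complex.I • Complex.I • B = -B := fun B => by
        rw [smul_smul, Complex.I_mul_I]; simp
      simp only [Matrix.mul_sub, Matrix.add_mul, Matrix.mul_one, Matrix.one_mul, Matrix.mul_smul,
        Matrix.smul_mul, smul_add, hI]
      abel
    rw [this, ← map_mul, gi_mul hu, map_one]
  have hadj : adjugate (1 + Complex.I • cm (Hess u x)) =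
      (1 + Complex.I • cm (Hess u x)).det • ((1 - Complex.I • cm (Hess u x)) * cm (gi u x)) := by
    calc _ = adjugate (1 + Complex.I • cm (Hess u x)) * ((1 + Complex.I • cm (Hess u x)) *
          ((1 - Complex.I • cm (Hess u x)) * cm (gi u x))) := by rw [hMN, Matrix.mul_one]
      _ = _ := by rw [← Matrix.mul_assoc, adjugate_mul, Matrix.smul_mul, Matrix.one_mul]
  have h4 : trace (adjugate (1 + Complex.I • cm (Hess u x)) * (Complex.I • cm (T3 u k x))) =
      (Vol u x : ℂ) * Complex.exp (c * Complex.I) *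
      (Complex.I * (trace (gi u x * T3 u k x) : ℝ) + (trace (Hess u x * gi u x * T3 u k x) : ℝ)) := by
    rw [hadj]
    have := hD 0
    simp only [zero_smul, add_zero] at this
    rw [this]
    have e1 : ((1 - Complex.I • cm (Hess u x)) * cm (gi u x)) * (Complex.I • cm (T3 u k x)) =
       Complex.I • cm (gi u x * T3 u k x) + cm (Hess u x * gi u x * T3 u k x) := by
      rw [map_mul, map_mul, map_mul]
      have hI : ∀ B : Matrix (Fin n) (Fin n) ℂ, Complex.I • Complex.I • B = -B := fun B => by
        rw [smul_smul, Complex.I_mul_I]; simp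
      simp only [Matrix.sub_mul, Matrix.one_mul, Matrix.mul_smul,
        Matrix.smul_mul, smul_sub, hI]
      abel
    rw [Matrix.smul_mul, e1, trace_smul, trace_add, trace_smul, cm_trace, cm_trace]
    simp
  rw [h4, mul_right_comm] at h3
  have h5 := mul_right_cancel₀ (Complex.exp_ne_zero _) h3
  have hV := Vol_pos hu x
  constructor
  · have := congrArg Complex.im h5
    simp at this
    rcases this with h | h
    · exact absurd h hV.ne'
    · exact h
  · have := congrArg Complex.re h5
    simp at this
    exact this.symm

end eqns

section jac
open Matrix
variable {n : ℕ} {u : EE n → ℝ}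

/-- derivative of a matrix valued function -/
noncomputable def dM (k : Fin n) (M : EE n → Matrix (Fin n) (Fin n) ℝ) (x : EE n) :
    Matrix (Fin n) (Fin n) ℝ := Matrix.of fun i j => pd k (fun y => M y i j) x

def SmM (M : EE n → Matrix (Fin n) (Fin n) ℝ) : Prop := ∀ i j, ContDiff ℝ (⊤ : ℕ∞) (fun x => M x i j)

lemma SmM.mul {M N : EE n → Matrix (Fin n) (Fin n) ℝ} (hM : SmM M) (hN : SmM N) :
    SmM (fun x => M x * N x) := fun i j => by
  simp only [Matrix.mul_apply]
  exact ContDiff.sum fun k _ => (hM _ _).mul (hN _ _)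

lemma SmM.trace {M : EE n → Matrix (Fin n) (Fin n) ℝ} (hM : SmM M) :
    ContDiff ℝ (⊤ : ℕ∞) (fun x => trace (M x)) := by
  simp only [Matrix.trace, diag_apply]
  exact ContDiff.sum fun k _ => hM _ _

lemma dM_mul {M N : EE n → Matrix (Fin n) (Fin n) ℝ} (hM : SmM M) (hN : SmM N) (k : Fin n) (x : EE n) :
    dM k (fun x => M x * N x) x = dM k M x * N x + M x * dM k N x := by
  ext i j
  simp only [dM, of_apply, Matrix.mul_apply, Matrix.add_apply]
  rw [pd_sum fun a _ => (smooth_diff ((hM _ _).mul (hN _ _))) x, ← Finset.sum_add_distrib]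
  exact Finset.sum_congr rfl fun a _ => pd_mul (smooth_diff (hM _ _) x) (smooth_diff (hN _ _) x)

lemma pd_trace {M : EE n → Matrix (Fin n) (Fin n) ℝ} (hM : SmM M) (k : Fin n) (x : EE n) :
    pd k (fun x => trace (M x)) x = trace (dM k M x) := by
  simp only [trace, diag_apply, dM, of_apply]
  exact pd_sum fun a _ => smooth_diff (hM _ _) x

/-- The special Lagrangian equation, in differentiated form. -/
structure Eqn (u : EE n → ℝ) : Prop where
  hu : ContDiff ℝ (⊤ : ℕ∞) u
  e1 : ∀ x k, trace (gi u x * T3 u k x) = 0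
  e2 : ∀ x k, pd k (Vol u) x = Vol u x * trace (Hess u x * gi u x * T3 u k x)

/-- Laplace-Beltrami -/
noncomputable def Lg (u f : EE n → ℝ) (x : EE n) : ℝ := ∑ i, ∑ j, gi u x i j * pd i (pd j f) x
/-- carre du champ -/
noncomputable def Gam (u f h : EE n → ℝ) (x : EE n) : ℝ := ∑ i, ∑ j, gi u x i j * pd i f x * pd j h x
/-- log of the volume element -/
noncomputable def bb (u : EE n → ℝ) (x : EE n) : ℝ := Real.log (Vol u x)

lemma dM_Hess (hu : ContDiff ℝ (⊤ : ℕ∞) u) (k : Fin n) (x : EE n) : dM k (Hess u) x = T3 u k x := by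
  ext i j; exact (T3_eq hu k i j x).symm

lemma dM_const (k : Fin n) (A : Matrix (Fin n) (Fin n) ℝ) (x : EE n) : dM k (fun _ => A) x = 0 := by
  ext i j; exact pd_const _ _ _

lemma dM_gMat (hu : ContDiff ℝ (⊤ : ℕ∞) u) (k : Fin n) (x : EE n) :
    dM k (gMat u) x = T3 u k x * Hess u x + Hess u x * T3 u k x := by
  have h : dM k (gMat u) x = dM k (fun x => Hess u x * Hess u x) x := by
    ext i j
    simp only [dM, of_apply, gMat, Matrix.add_apply]
    have := pd_add (i := k) (f := fun _ => (1 : Matrix (Fin n) (Fin n) ℝ) i j)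
      (g := fun y => (Hess u y * Hess u y) i j) (x := x) (by fun_prop)
      (smooth_diff ((SmM.mul (M := Hess u) (Hess_smooth hu) (Hess_smooth hu)) i j) x)
    rw [this, pd_const, zero_add]
  rw [h, dM_mul (Hess_smooth hu) (Hess_smooth hu), dM_Hess hu]

lemma dM_gi (hu : ContDiff ℝ (⊤ : ℕ∞) u) (k : Fin n) (x : EE n) :
    dM k (gi u) x = - (gi u x * (T3 u k x * Hess u x + Hess u x * T3 u k x) * gi u x) := by
  have h1 := dM_mul (gMat_smooth hu) (gi_smooth hu) k x
  simp only [gi_mul hu] at h1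
  rw [dM_const, dM_gMat hu] at h1
  have h2 : gMat u x * dM k (gi u) x = - ((T3 u k x * Hess u x + Hess u x * T3 u k x) * gi u x) :=
    (neg_eq_of_add_eq_zero_right h1.symm).symm
  calc dM k (gi u) x = gi u x * (gMat u x * dM k (gi u) x) := by
        rw [← Matrix.mul_assoc, mul_gi hu, Matrix.one_mul]
    _ = _ := by rw [h2, Matrix.mul_neg, Matrix.mul_assoc]

lemma Eqn.div (h : Eqn u) (j : Fin n) (x : EE n) :
    ∑ i, pd i (fun y => Vol u y * gi u y i j) x = 0 := by
  have hu := h.hu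
  have e : ∀ i, pd i (fun y => Vol u y * gi u y i j) x =
      Vol u x * (trace (Hess u x * gi u x * T3 u i x) * gi u x i j + dM i (gi u) x i j) := by
    intro i
    rw [pd_mul (smooth_diff (Vol_smooth hu) x) (smooth_diff (gi_smooth hu i j) x), h.e2]
    simp only [dM, of_apply]; ring
  simp only [e]
  rw [← Finset.mul_sum]
  convert mul_zero _
  simp only [dM_gi hu]
  set H := Hess u x
  set G := gi u x
  have c : ∀ i, (-(G * (T3 u i x * H + H * T3 u i x) * G)) i j =
      - (G * T3 u i x * (H * G)) i j - (G * H * T3 u i x * G) i j := by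
    intro i
    rw [Matrix.neg_apply, Matrix.mul_add, Matrix.add_mul, Matrix.add_apply]
    simp only [Matrix.mul_assoc]; ring
  simp only [c]
  rw [Finset.sum_add_distrib, Finset.sum_sub_distrib, Finset.sum_neg_distrib]
  have z1 : ∑ i, (G * T3 u i x * (H * G)) i j = 0 := by
    have : ∀ i, (G * T3 u i x * (H * G)) i j = ∑ c, ∑ a, G i a * T3 u c x a i * (H * G) c j := by
      intro i
      rw [Matrix.mul_apply]
      refine Finset.sum_congr rfl fun c _ => ?_
      rw [Matrix.mul_apply, Finset.sum_mul]
      refine Finset.sum_congr rfl fun a _ => ?_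
      rw [T3_swap23 hu i a c, T3_swap12 hu i c a, T3_swap23 hu c i a]
    simp only [this]
    rw [Finset.sum_comm]
    refine Finset.sum_eq_zero fun c _ => ?_
    have := h.e1 x c
    simp only [trace, diag_apply, Matrix.mul_apply] at this
    simp only [← Finset.sum_mul]
    rw [this, zero_mul]
  have z2 : ∑ i, (G * H * T3 u i x * G) i j = ∑ i, trace (H * G * T3 u i x) * G i j := by
    have : ∀ i, (G * H * T3 u i x * G) i j = ∑ b, (∑ c, (G * H) i c * T3 u b x c i) * G b j := by
      intro i
      rw [Matrix.mul_apply]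
      refine Finset.sum_congr rfl fun c _ => ?_
      rw [Matrix.mul_apply]
      congr 1
      refine Finset.sum_congr rfl fun a _ => ?_
      rw [T3_swap23 hu i a c, T3_swap12 hu i c a, T3_swap23 hu c i a]
    simp only [this]
    rw [Finset.sum_comm]
    refine Finset.sum_congr rfl fun b _ => ?_
    rw [← Finset.sum_mul, ← gi_comm hu]
    congr 1
  rw [z1, z2]; ring

lemma bb_smooth (hu : ContDiff ℝ (⊤ : ℕ∞) u) : ContDiff ℝ (⊤ : ℕ∞) (bb u) :=
  (Vol_smooth hu).log fun x => (Vol_pos hu x).ne'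

lemma Eqn.pd_bb (h : Eqn u) (k : Fin n) (x : EE n) :
    pd k (bb u) x = trace (Hess u x * gi u x * T3 u k x) := by
  have := pd_comp (i := k) (Real.hasDerivAt_log (Vol_pos h.hu x).ne') (smooth_diff (Vol_smooth h.hu) x)
  rw [show bb u = fun y => Real.log (Vol u y) from rfl, this, h.e2]
  field_simp [(Vol_pos h.hu x).ne']

lemma Eqn.e1' (h : Eqn u) (l k : Fin n) (x : EE n) :
    trace (gi u x * dM l (T3 u k) x) =
      trace (gi u x * (T3 u l x * Hess u x + Hess u x * T3 u l x) * gi u x * T3 u k x) := by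
  have hu := h.hu
  have h1 := pd_trace (SmM.mul (M := gi u) (N := T3 u k) (gi_smooth hu) (T3_smooth hu k)) l x
  simp only [h.e1] at h1
  rw [pd_const, dM_mul (gi_smooth hu) (T3_smooth hu k), dM_gi hu, trace_add, Matrix.neg_mul, trace_neg] at h1
  linarith

lemma dT3_symm (hu : ContDiff ℝ (⊤ : ℕ∞) u) (l k i j : Fin n) (x : EE n) :
    dM l (T3 u k) x i j = dM i (T3 u j) x l k := by
  change pd l (pd k (pd i (pd j u))) x = pd i (pd j (pd l (pd k u))) x
  have s := fun {f : EE n → ℝ} (hf : ContDiff ℝ (⊤ : ℕ∞) f) => pd_comm_fun (hf.of_le two_le_top)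
  rw [s (pd_smooth hu) k i, s (pd_smooth (pd_smooth hu)) l i, s hu k j, s (pd_smooth hu) l j]

lemma dT3_swap (hu : ContDiff ℝ (⊤ : ℕ∞) u) (l k i j : Fin n) (x : EE n) :
    dM l (T3 u k) x i j = dM l (T3 u k) x j i := by
  change pd l (pd k (pd i (pd j u))) x = pd l (pd k (pd j (pd i u))) x
  rw [pd_comm_fun (hu.of_le two_le_top) i j]

lemma Eqn.Lg_bb_raw (h : Eqn u) (x : EE n) :
    Lg u (bb u) x = ∑ l, ∑ k, gi u x l k * (trace (T3 u l x * gi u x * T3 u k x)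
      - trace (Hess u x * gi u x * (T3 u l x * Hess u x + Hess u x * T3 u l x) * gi u x * T3 u k x))
      + ∑ i, ∑ j, (Hess u x * gi u x) i j *
        trace (gi u x * (T3 u j x * Hess u x + Hess u x * T3 u j x) * gi u x * T3 u i x) := by
  have hu := h.hu
  have e : ∀ l k, pd l (pd k (bb u)) x = trace (T3 u l x * gi u x * T3 u k x)
      - trace (Hess u x * gi u x * (T3 u l x * Hess u x + Hess u x * T3 u l x) * gi u x * T3 u k x)
      + trace (Hess u x * gi u x * dM l (T3 u k) x) := by
    intro l k
    rw [show pd k (bb u) = fun y => trace (Hess u y * gi u y * T3 u k y) from funext (h.pd_bb k)]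
    have hHg := SmM.mul (M := Hess u) (N := gi u) (Hess_smooth hu) (gi_smooth hu)
    rw [pd_trace (SmM.mul hHg (T3_smooth hu k)),
      dM_mul hHg (T3_smooth hu k), dM_mul (Hess_smooth hu) (gi_smooth hu), dM_Hess hu, dM_gi hu,
      trace_add, Matrix.add_mul, trace_add, Matrix.mul_neg, Matrix.neg_mul, trace_neg]
    simp only [Matrix.mul_assoc]; ring
  have t3 : ∑ l, ∑ k, gi u x l k * trace (Hess u x * gi u x * dM l (T3 u k) x) =
      ∑ i, ∑ j, (Hess u x * gi u x) i j * trace (gi u x * dM j (T3 u i) x) := by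
    have a1 : ∀ l k, gi u x l k * trace (Hess u x * gi u x * dM l (T3 u k) x) =
        ∑ i, ∑ j, gi u x l k * ((Hess u x * gi u x) i j * dM j (T3 u i) x k l) := by
      intro l k
      rw [trace, Finset.mul_sum]
      refine Finset.sum_congr rfl fun i _ => ?_
      rw [diag_apply, Matrix.mul_apply, Finset.mul_sum]
      refine Finset.sum_congr rfl fun j _ => ?_
      rw [dT3_symm hu l k j i, dT3_swap hu j i l k]
    have a2 : ∀ i j, (Hess u x * gi u x) i j * trace (gi u x * dM j (T3 u i) x) =
        ∑ l, ∑ k, gi u x l k * ((Hess u x * gi u x) i j * dM j (T3 u i) x k l) := by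
      intro i j
      rw [trace, Finset.mul_sum]
      refine Finset.sum_congr rfl fun l _ => ?_
      rw [diag_apply, Matrix.mul_apply (M := gi u x), Finset.mul_sum]
      refine Finset.sum_congr rfl fun k _ => ?_
      ring
    simp only [a1, a2]
    have r : ∀ F : Fin n → Fin n → Fin n → Fin n → ℝ, ∑ l, ∑ k, ∑ i, ∑ j, F l k i j =
      ∑ i, ∑ j, ∑ l, ∑ k, F l k i j := by
      intro F
      calc ∑ l, ∑ k, ∑ i, ∑ j, F l k i j = ∑ l, ∑ i, ∑ k, ∑ j, F l k i j :=
            Finset.sum_congr rfl fun l _ => Finset.sum_comm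
        _ = ∑ l, ∑ i, ∑ j, ∑ k, F l k i j :=
            Finset.sum_congr rfl fun l _ => Finset.sum_congr rfl fun k _ => Finset.sum_comm
        _ = ∑ i, ∑ l, ∑ j, ∑ k, F l k i j := Finset.sum_comm
        _ = _ := Finset.sum_congr rfl fun l _ => Finset.sum_comm
    exact r _
  rw [Finset.sum_congr rfl fun i _ => Finset.sum_congr rfl fun j _ =>
    congrArg ((Hess u x * gi u x) i j * ·) (h.e1' j i x).symm]
  rw [← t3, ← Finset.sum_add_distrib, Lg]
  refine Finset.sum_congr rfl fun l _ => ?_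
  rw [← Finset.sum_add_distrib]
  refine Finset.sum_congr rfl fun k _ => ?_
  rw [e, mul_add]

end jac

section frame
open Matrix
variable {n : ℕ} {u : EE n → ℝ}

/-- rotated slice -/
noncomputable def rotW (Q : Matrix (Fin n) (Fin n) ℝ) (T : Fin n → Matrix (Fin n) (Fin n) ℝ) (a : Fin n) :
    Matrix (Fin n) (Fin n) ℝ := ∑ k, Q k a • T k

/-- rotated tensor -/
noncomputable def rotS (Q : Matrix (Fin n) (Fin n) ℝ) (T : Fin n → Matrix (Fin n) (Fin n) ℝ) (a : Fin n) :
    Matrix (Fin n) (Fin n) ℝ := Qᵀ * rotW Q T a * Q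

lemma qcj_apply (Q : Matrix (Fin n) (Fin n) ℝ) (α : Fin n → ℝ) (l k : Fin n) :
    (Q * diagonal α * Qᵀ) l k = ∑ a, α a * (Q l a * Q k a) := by
  rw [Matrix.mul_apply]
  refine Finset.sum_congr rfl fun a _ => ?_
  rw [mul_diagonal, transpose_apply]; ring

lemma bil_frame (Q : Matrix (Fin n) (Fin n) ℝ) (α v w : Fin n → ℝ) :
    ∑ l, ∑ k, (Q * diagonal α * Qᵀ) l k * (v l * w k) =
      ∑ a, α a * ((∑ l, Q l a * v l) * (∑ k, Q k a * w k)) := by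
  simp only [qcj_apply, Finset.sum_mul]
  rw [Finset.sum_congr rfl fun l _ => Finset.sum_comm, Finset.sum_comm]
  refine Finset.sum_congr rfl fun a _ => ?_
  simp only [Finset.mul_sum]
  refine Finset.sum_congr rfl fun l _ => Finset.sum_congr rfl fun k _ => ?_
  ring

lemma contrW (Q : Matrix (Fin n) (Fin n) ℝ) (T : Fin n → Matrix (Fin n) (Fin n) ℝ)
    (α : Fin n → ℝ) (B C : Matrix (Fin n) (Fin n) ℝ) :
    ∑ l, ∑ k, (Q * diagonal α * Qᵀ) l k * trace (B * T l * C * T k) =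
      ∑ a, α a * trace (B * rotW Q T a * C * rotW Q T a) := by
  have e : ∀ a, trace (B * rotW Q T a * C * rotW Q T a) =
      ∑ l, ∑ k, Q l a * Q k a * trace (B * T l * C * T k) := by
    intro a
    simp only [rotW, Matrix.mul_sum, Matrix.sum_mul, trace_sum, Matrix.mul_smul, Matrix.smul_mul,
      trace_smul, smul_eq_mul]
    rw [Finset.sum_comm]
    refine Finset.sum_congr rfl fun l _ => ?_
    rw [Finset.mul_sum]
    refine Finset.sum_congr rfl fun k _ => ?_
    ring
  simp only [e, qcj_apply, Finset.sum_mul]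
  rw [Finset.sum_congr rfl fun l _ => Finset.sum_comm, Finset.sum_comm]
  refine Finset.sum_congr rfl fun a _ => ?_
  simp only [Finset.mul_sum]
  refine Finset.sum_congr rfl fun l _ => Finset.sum_congr rfl fun k _ => ?_
  ring

lemma trW (Q W : Matrix (Fin n) (Fin n) ℝ) (β γ : Fin n → ℝ) :
    trace ((Q * diagonal β * Qᵀ) * W * (Q * diagonal γ * Qᵀ) * W) =
      ∑ b, ∑ c, β b * γ c * ((Qᵀ * W * Q) b c * (Qᵀ * W * Q) c b) := by
  have : trace ((Q * diagonal β * Qᵀ) * W * (Q * diagonal γ * Qᵀ) * W) =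
      trace (diagonal β * (Qᵀ * W * Q) * (diagonal γ * (Qᵀ * W * Q))) := by
    rw [show (Q * diagonal β * Qᵀ) * W * (Q * diagonal γ * Qᵀ) * W =
      Q * (diagonal β * Qᵀ * W * Q * diagonal γ * Qᵀ * W) by simp only [Matrix.mul_assoc]]
    rw [trace_mul_comm]
    simp only [Matrix.mul_assoc]
  rw [this, trace]
  refine Finset.sum_congr rfl fun b _ => ?_
  rw [diag_apply, Matrix.mul_apply]
  refine Finset.sum_congr rfl fun c _ => ?_
  rw [diagonal_mul, diagonal_mul]; ring

lemma trW1 (Q W : Matrix (Fin n) (Fin n) ℝ) (β : Fin n → ℝ) :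
    trace ((Q * diagonal β * Qᵀ) * W) = ∑ b, β b * (Qᵀ * W * Q) b b := by
  rw [Matrix.mul_assoc, Matrix.mul_assoc, trace_mul_comm]
  rw [trace]
  refine Finset.sum_congr rfl fun b _ => ?_
  rw [diag_apply, Matrix.mul_assoc, Matrix.mul_assoc, diagonal_mul]

lemma contr (Q : Matrix (Fin n) (Fin n) ℝ) (T : Fin n → Matrix (Fin n) (Fin n) ℝ)
    (α β γ : Fin n → ℝ) :
    ∑ l, ∑ k, (Q * diagonal α * Qᵀ) l k *
        trace ((Q * diagonal β * Qᵀ) * T l * (Q * diagonal γ * Qᵀ) * T k) =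
      ∑ a, ∑ b, ∑ c, α a * β b * γ c * (rotS Q T a b c * rotS Q T a c b) := by
  rw [contrW]
  refine Finset.sum_congr rfl fun a _ => ?_
  rw [trW, Finset.mul_sum]
  refine Finset.sum_congr rfl fun b _ => ?_
  rw [Finset.mul_sum]
  refine Finset.sum_congr rfl fun c _ => ?_
  rw [rotS]; ring

lemma rotS_apply (Q : Matrix (Fin n) (Fin n) ℝ) (T : Fin n → Matrix (Fin n) (Fin n) ℝ) (a b c : Fin n) :
    rotS Q T a b c = ∑ k, ∑ i, ∑ j, Q k a * Q i b * Q j c * T k i j := by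
  simp only [rotS, rotW, Matrix.mul_sum, Matrix.sum_mul, Matrix.sum_apply, Matrix.mul_smul,
    Matrix.smul_mul, Matrix.smul_apply, smul_eq_mul]
  refine Finset.sum_congr rfl fun k _ => ?_
  rw [Matrix.mul_apply, Finset.mul_sum]
  simp only [Matrix.mul_apply (M := Qᵀ), Finset.sum_mul, Finset.mul_sum, transpose_apply]
  rw [Finset.sum_comm]
  refine Finset.sum_congr rfl fun i _ => Finset.sum_congr rfl fun j _ => ?_
  ring

lemma rotS_swap12 (Q : Matrix (Fin n) (Fin n) ℝ) (T : Fin n → Matrix (Fin n) (Fin n) ℝ)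
    (h : ∀ k i j, T k i j = T i k j) (a b c : Fin n) : rotS Q T a b c = rotS Q T b a c := by
  rw [rotS_apply, rotS_apply, Finset.sum_comm]
  refine Finset.sum_congr rfl fun k _ => Finset.sum_congr rfl fun i _ =>
    Finset.sum_congr rfl fun j _ => ?_
  rw [h k i j]; ring

lemma rotS_swap23 (Q : Matrix (Fin n) (Fin n) ℝ) (T : Fin n → Matrix (Fin n) (Fin n) ℝ)
    (h : ∀ k i j, T k i j = T k j i) (a b c : Fin n) : rotS Q T a b c = rotS Q T a c b := by
  rw [rotS_apply, rotS_apply]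
  refine Finset.sum_congr rfl fun k _ => ?_
  rw [Finset.sum_comm]
  refine Finset.sum_congr rfl fun i _ =>
    Finset.sum_congr rfl fun j _ => ?_
  rw [h k i j]; ring

lemma sum_perm_avg (F : Fin n → Fin n → Fin n → ℝ) :
    (∑ a, ∑ b, ∑ c, F a b c = ∑ a, ∑ b, ∑ c, F b a c) ∧
    (∑ a, ∑ b, ∑ c, F a b c = ∑ a, ∑ b, ∑ c, F a c b) ∧
    (∑ a, ∑ b, ∑ c, F a b c = ∑ a, ∑ b, ∑ c, F c a b) := by
  have h2 : ∀ F : Fin n → Fin n → Fin n → ℝ, ∑ a, ∑ b, ∑ c, F a b c = ∑ a, ∑ b, ∑ c, F a c b :=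
    fun F => Finset.sum_congr rfl fun a _ => Finset.sum_comm
  have h1 : ∀ F : Fin n → Fin n → Fin n → ℝ, ∑ a, ∑ b, ∑ c, F a b c = ∑ a, ∑ b, ∑ c, F b a c :=
    fun F => Finset.sum_comm
  refine ⟨h1 F, h2 F, ?_⟩
  rw [h1 F, h2 (fun a b c => F b a c)]

/-- Jacobi identity in a diagonalizing frame. -/
lemma Eqn.jacobi (h : Eqn u) {x : EE n} {Q : Matrix (Fin n) (Fin n) ℝ} {l : Fin n → ℝ}
    (S : Spec u x Q l) :
    Lg u (bb u) x = ∑ a, ∑ b, ∑ c, (1 + (l a * l b + l b * l c + l c * l a) / 3) *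
      ((1 + l a ^ 2)⁻¹ * (1 + l b ^ 2)⁻¹ * (1 + l c ^ 2)⁻¹) * rotS Q (fun k => T3 u k x) a b c ^ 2 := by
  have hu := h.hu
  set T : Fin n → Matrix (Fin n) (Fin n) ℝ := fun k => T3 u k x with hT
  have s12 := rotS_swap12 Q T (fun k i j => T3_swap12 hu k i j x)
  have s23 := rotS_swap23 Q T (fun k i j => T3_swap23 hu k i j x)
  set γ : Fin n → ℝ := fun i => (1 + l i ^ 2)⁻¹ with hγ
  have hG : gi u x = Q * diagonal γ * Qᵀ := S.inv_eq
  have hH := S.h3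
  have hHG : Hess u x * gi u x = Q * diagonal (fun i => l i * γ i) * Qᵀ := by
    rw [hH, hG, qcj_mul S.h2]
  have hGH : gi u x * Hess u x = Q * diagonal (fun i => l i * γ i) * Qᵀ := by
    rw [gi_comm hu, hHG]
  have hHGH : Hess u x * gi u x * Hess u x = Q * diagonal (fun i => l i * γ i * l i) * Qᵀ := by
    rw [hHG, hH, qcj_mul S.h2]
  have h1 := qcj_one S.h1
  rw [h.Lg_bb_raw]
  have t1 : ∑ l, ∑ k, gi u x l k * trace (T l * gi u x * T k) =
      ∑ a, ∑ b, ∑ c, γ a * 1 * γ c * (rotS Q T a b c * rotS Q T a c b) := by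
    rw [← contr Q T γ (fun _ => 1) γ, h1, ← hG]; simp only [Matrix.one_mul]
  have t2 : ∑ l, ∑ k, gi u x l k * trace (Hess u x * gi u x * (T l) * (Hess u x * gi u x) * T k) =
      ∑ a, ∑ b, ∑ c, γ a * (l b * γ b) * (l c * γ c) * (rotS Q T a b c * rotS Q T a c b) := by
    rw [← contr Q T γ (fun i => l i * γ i) (fun i => l i * γ i), ← hHG, ← hG]
  have t3 : ∑ l, ∑ k, gi u x l k * trace (Hess u x * gi u x * Hess u x * (T l) * (gi u x) * T k) =
      ∑ a, ∑ b, ∑ c, γ a * (l b * γ b * l b) * (γ c) * (rotS Q T a b c * rotS Q T a c b) := by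
    rw [← contr Q T γ (fun i => l i * γ i * l i) γ, ← hHGH, ← hG]
  have t4 : ∑ i, ∑ j, (Hess u x * gi u x) i j * trace (gi u x * (T j) * (Hess u x * gi u x) * T i) =
      ∑ a, ∑ b, ∑ c, (l a * γ a) * γ b * (l c * γ c) * (rotS Q T a b c * rotS Q T a c b) := by
    rw [← contr Q T (fun i => l i * γ i) γ (fun i => l i * γ i), ← hHG, ← hG, Finset.sum_comm]
    refine Finset.sum_congr rfl fun i _ => Finset.sum_congr rfl fun j _ => ?_
    congr 1
    rw [hHG, qcj_apply, qcj_apply]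
    exact Finset.sum_congr rfl fun a _ => by ring
  have t5 : ∑ i, ∑ j, (Hess u x * gi u x) i j * trace (gi u x * Hess u x * (T j) * gi u x * T i) =
      ∑ a, ∑ b, ∑ c, (l a * γ a) * (l b * γ b) * γ c * (rotS Q T a b c * rotS Q T a c b) := by
    rw [← contr Q T (fun i => l i * γ i) (fun i => l i * γ i) γ, gi_comm hu, ← hHG, ← hG, Finset.sum_comm]
    refine Finset.sum_congr rfl fun i _ => Finset.sum_congr rfl fun j _ => ?_
    congr 1
    rw [hHG, qcj_apply, qcj_apply]
    exact Finset.sum_congr rfl fun a _ => by ring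
  have tot : (∑ l, ∑ k, gi u x l k * (trace (T l * gi u x * T k)
      - trace (Hess u x * gi u x * (T l * Hess u x + Hess u x * T l) * gi u x * T k))
      + ∑ i, ∑ j, (Hess u x * gi u x) i j *
        trace (gi u x * (T j * Hess u x + Hess u x * T j) * gi u x * T i)) =
      (∑ l, ∑ k, gi u x l k * trace (T l * gi u x * T k)) -
      (∑ l, ∑ k, gi u x l k * trace (Hess u x * gi u x * (T l) * (Hess u x * gi u x) * T k)) -
      (∑ l, ∑ k, gi u x l k * trace (Hess u x * gi u x * Hess u x * (T l) * (gi u x) * T k)) +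
      (∑ i, ∑ j, (Hess u x * gi u x) i j * trace (gi u x * (T j) * (Hess u x * gi u x) * T i)) +
      ∑ i, ∑ j, (Hess u x * gi u x) i j * trace (gi u x * Hess u x * (T j) * gi u x * T i) := by
    simp only [← Finset.sum_add_distrib, ← Finset.sum_sub_distrib]
    refine Finset.sum_congr rfl fun i _ => Finset.sum_congr rfl fun j _ => ?_
    simp only [Matrix.mul_add, Matrix.add_mul, trace_add, Matrix.mul_assoc]
    ring
  rw [tot, t1, t2, t3, t4, t5]
  simp only [← Finset.sum_add_distrib, ← Finset.sum_sub_distrib]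
  set R : Fin n → Fin n → Fin n → ℝ := fun a b c => (γ a * γ b * γ c) * rotS Q T a b c ^ 2 with hR
  have r12 : ∀ a b c, R a b c = R b a c := fun a b c => by simp only [hR, s12 a b c]; ring
  have r23 : ∀ a b c, R a b c = R a c b := fun a b c => by simp only [hR, s23 a b c]; ring
  set F : Fin n → Fin n → Fin n → ℝ := fun a b c =>
    ((1 + l b ^ 2) - l b * l c - l b ^ 2 + l a * l c + l a * l b) * R a b c with hF
  have hγ1 : ∀ a, γ a * (1 + l a ^ 2) = 1 := fun a => inv_mul_cancel₀ (by positivity)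
  have eF : ∑ a, ∑ b, ∑ c, (γ a * 1 * γ c * (rotS Q T a b c * rotS Q T a c b) -
      γ a * (l b * γ b) * (l c * γ c) * (rotS Q T a b c * rotS Q T a c b) -
      γ a * (l b * γ b * l b) * γ c * (rotS Q T a b c * rotS Q T a c b) +
      l a * γ a * γ b * (l c * γ c) * (rotS Q T a b c * rotS Q T a c b) +
      l a * γ a * (l b * γ b) * γ c * (rotS Q T a b c * rotS Q T a c b)) = ∑ a, ∑ b, ∑ c, F a b c := by
    refine Finset.sum_congr rfl fun a _ => Finset.sum_congr rfl fun b _ =>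
      Finset.sum_congr rfl fun c _ => ?_
    simp only [hF, hR, ← s23 a b c]
    linear_combination (-γ a * γ c * rotS Q T a b c ^ 2) * hγ1 b
  rw [eF]
  obtain ⟨p1, p2, p3⟩ := sum_perm_avg F
  have : ∑ a, ∑ b, ∑ c, F a b c = ∑ a, ∑ b, ∑ c, (F a b c + F b a c + F c a b) / 3 := by
    have : ∑ a, ∑ b, ∑ c, (F a b c + F b a c + F c a b) / 3 =
      ((∑ a, ∑ b, ∑ c, F a b c) + (∑ a, ∑ b, ∑ c, F b a c) + (∑ a, ∑ b, ∑ c, F c a b)) / 3 := by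
      simp only [← Finset.sum_add_distrib, Finset.sum_div]
    rw [this, ← p1, ← p3]; ring
  rw [this]
  refine Finset.sum_congr rfl fun a _ => Finset.sum_congr rfl fun b _ =>
      Finset.sum_congr rfl fun c _ => ?_
  simp only [hF]
  rw [show R c a b = R a b c by rw [r12 c a b, r23 a c b], ← r12 a b c]
  simp only [hR, hγ]
  ring

lemma Eqn.gam_bb (h : Eqn u) {x : EE n} {Q : Matrix (Fin n) (Fin n) ℝ} {l : Fin n → ℝ}
    (S : Spec u x Q l) :
    Gam u (bb u) (bb u) x = ∑ a, (1 + l a ^ 2)⁻¹ *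
      (∑ b, l b * (1 + l b ^ 2)⁻¹ * rotS Q (fun k => T3 u k x) a b b) ^ 2 := by
  have hu := h.hu
  have hG : gi u x = Q * diagonal (fun i => (1 + l i ^ 2)⁻¹) * Qᵀ := S.inv_eq
  have hHG : Hess u x * gi u x = Q * diagonal (fun i => l i * (1 + l i ^ 2)⁻¹) * Qᵀ := by
    rw [S.h3, hG, qcj_mul S.h2]
  have e : ∀ a, ∑ k, Q k a * pd k (bb u) x =
      ∑ b, l b * (1 + l b ^ 2)⁻¹ * rotS Q (fun k => T3 u k x) a b b := by
    intro a
    simp only [rotS, ← trW1, ← hHG, h.pd_bb]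
    simp only [rotW, Matrix.mul_sum, trace_sum, Matrix.mul_smul, trace_smul, smul_eq_mul]
  have := bil_frame Q (fun i => (1 + l i ^ 2)⁻¹) (fun k => pd k (bb u) x) (fun k => pd k (bb u) x)
  rw [← hG] at this
  simp only [Gam, mul_assoc] at this ⊢
  simp only [this, e, sq, mul_assoc]

lemma normT (Q : Matrix (Fin n) (Fin n) ℝ) (T : Fin n → Matrix (Fin n) (Fin n) ℝ) (h1 : Q * Qᵀ = 1)
    (hT : ∀ k i j, T k i j = T k j i) :
    ∑ k, ∑ i, ∑ j, T k i j ^ 2 = ∑ a, ∑ b, ∑ c, rotS Q T a b c ^ 2 := by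
  have s23 := rotS_swap23 Q T hT
  have := contr Q T (fun _ => 1) (fun _ => 1) (fun _ => 1)
  rw [qcj_one h1] at this
  simp only [one_mul, Matrix.one_mul, Matrix.mul_one, ← s23] at this
  simp only [sq]
  rw [← this]
  refine Finset.sum_congr rfl fun k _ => ?_
  symm
  rw [Finset.sum_eq_single k]
  · simp only [Matrix.one_apply_eq, one_mul, trace, diag_apply, Matrix.mul_apply]
    refine Finset.sum_congr rfl fun i _ => Finset.sum_congr rfl fun j _ => ?_
    rw [← hT k i j]
  · intro b _ hb; rw [Matrix.one_apply_ne hb.symm, zero_mul]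
  · simp

end frame

lemma tri_core {a p q s : ℝ} (ha : 0 ≤ a) (hp : 0 ≤ p) (hpq : p ≤ q)
    (h1 : 2 * a * p ≤ s + a ^ 2) (h3 : 2 * a * q ≤ s + a ^ 2)
    (h4 : 2 * a * q ≤ s + q ^ 2) : a * (p + q) - p * q ≤ s := by
  have hq : 0 ≤ q := hp.trans hpq
  rcases le_total a p with h | h
  · nlinarith [mul_le_mul h (h.trans hpq) ha hp]
  rcases le_total a q with h' | h'
  · rcases ha.eq_or_lt with h0 | h0
    · subst h0; have : p = 0 := le_antisymm h hp
      subst this; nlinarith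
    have has : a ^ 2 ≤ s := by nlinarith
    have : 2 * a * (a * (p + q) - p * q) ≤ 2 * a * s := by
      have := mul_le_mul_of_nonneg_right h3 (sub_nonneg.2 h)
      nlinarith [mul_nonneg (sub_nonneg.2 has) (add_nonneg ha hp), mul_nonneg (sub_nonneg.2 has) hp, mul_nonneg (sub_nonneg.2 has) (sub_nonneg.2 h)]
    exact le_of_mul_le_mul_left this (by positivity)
  · rcases hq.eq_or_lt with h0 | h0
    · subst h0; have : p = 0 := le_antisymm hpq hp
      subst this; nlinarith
    have has : q ^ 2 ≤ s := by nlinarith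
    have : 2 * q * (a * (p + q) - p * q) ≤ 2 * q * s := by
      have := mul_le_mul_of_nonneg_right h4 (add_nonneg hp hq)
      nlinarith [mul_nonneg (sub_nonneg.2 has) (sub_nonneg.2 hpq)]
    exact le_of_mul_le_mul_left this (by positivity)

lemma tri_core' {a p q s : ℝ} (ha : 0 ≤ a) (hp : 0 ≤ p) (hq : 0 ≤ q)
    (h1 : 2 * a * p ≤ s + a ^ 2) (h2 : 2 * a * p ≤ s + p ^ 2) (h3 : 2 * a * q ≤ s + a ^ 2)
    (h4 : 2 * a * q ≤ s + q ^ 2) : a * (p + q) - p * q ≤ s := by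
  rcases le_total p q with h | h
  · exact tri_core ha hp h h1 h3 h4
  · have := tri_core ha hq h h3 h1 h2
    linarith

lemma triple {a b c s : ℝ} (hs : 0 ≤ s) (hab : -s ≤ a ^ 2 + 2 * a * b) (hba : -s ≤ b ^ 2 + 2 * b * a)
    (hac : -s ≤ a ^ 2 + 2 * a * c) (hca : -s ≤ c ^ 2 + 2 * c * a)
    (hbc : -s ≤ b ^ 2 + 2 * b * c) (hcb : -s ≤ c ^ 2 + 2 * c * b) : -s ≤ a * b + b * c + c * a := by
  rcases le_total 0 a with ha | ha <;> rcases le_total 0 b with hb | hb <;>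
    rcases le_total 0 c with hc | hc
  · nlinarith [mul_nonneg ha hb, mul_nonneg hb hc, mul_nonneg hc ha]
  · have := tri_core' (a := -c) (p := a) (q := b) (s := s) (by linarith) ha hb (by linarith)
      (by linarith) (by linarith) (by linarith)
    linarith
  · have := tri_core' (a := -b) (p := a) (q := c) (s := s) (by linarith) ha hc (by linarith)
      (by linarith) (by linarith) (by linarith)
    linarith
  · have := tri_core' (a := a) (p := -b) (q := -c) (s := s) (by linarith) (by linarith) (by linarith) (by linarith)
      (by linarith) (by linarith) (by linarith)
    linarith
  · have := tri_core' (a := -a) (p := b) (q := c) (s := s) (by linarith) hb hc (by linarith)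
      (by linarith) (by linarith) (by linarith)
    linarith
  · have := tri_core' (a := b) (p := -a) (q := -c) (s := s) (by linarith) (by linarith) (by linarith) (by linarith)
      (by linarith) (by linarith) (by linarith)
    linarith
  · have := tri_core' (a := c) (p := -a) (q := -b) (s := s) (by linarith) (by linarith) (by linarith) (by linarith)
      (by linarith) (by linarith) (by linarith)
    linarith
  · nlinarith [mul_nonneg_of_nonpos_of_nonpos ha hb, mul_nonneg_of_nonpos_of_nonpos hb hc, mul_nonneg_of_nonpos_of_nonpos hc ha]

section jac
variable {n : ℕ} {u : EE n → ℝ}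

/-- The convexity-type condition in a frame. -/
def CondAt (ε : ℝ) (u : EE n → ℝ) : Prop := ∀ x, ∃ Q l, Spec u x Q l ∧
  ∀ i j, 0 ≤ 3 + (1 - ε) * l i ^ 2 + 2 * l i * l j

lemma jac_ineq1 (h : Eqn u) {ε : ℝ} (hε : 0 < ε) (hn : 0 < n) (hc : CondAt ε u) (x : EE n) :
    ε / (3 * n) * Gam u (bb u) (bb u) x ≤ Lg u (bb u) x := by
  obtain ⟨Q, l, S, hl⟩ := hc x
  rw [h.jacobi S, h.gam_bb S]
  set R := rotS Q (fun k => T3 u k x)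
  set γ : Fin n → ℝ := fun i => (1 + l i ^ 2)⁻¹ with hγ
  have hγ0 : ∀ i, 0 < γ i := fun i => by simp only [hγ]; positivity
  have hn' : (0:ℝ) < n := by exact_mod_cast hn
  have hl' : ∀ i j, -3 ≤ l i ^ 2 + 2 * l i * l j := fun i j => by
    nlinarith [hl i j, mul_nonneg hε.le (sq_nonneg (l i))]
  have hP : ∀ a b c, 0 ≤ 1 + (l a * l b + l b * l c + l c * l a) / 3 := fun a b c => by
    have := triple (s := 3) (by norm_num) (hl' a b) (hl' b a) (hl' a c) (hl' c a) (hl' b c) (hl' c b)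
    linarith
  rw [Finset.mul_sum]
  refine Finset.sum_le_sum fun a _ => ?_
  have cs : (∑ b, l b * γ b * R a b b) ^ 2 ≤ n * ∑ b, (l b * γ b * R a b b) ^ 2 := by
    have := sq_sum_le_card_mul_sum_sq (s := (Finset.univ : Finset (Fin n))) (f := fun b => l b * γ b * R a b b)
    simpa using this
  calc ε / (3 * n) * (γ a * (∑ b, l b * γ b * R a b b) ^ 2)
      ≤ ε / (3 * n) * (γ a * (n * ∑ b, (l b * γ b * R a b b) ^ 2)) := by
        have := hγ0 a
        gcongr
    _ = ∑ b, ε / 3 * γ a * (l b * γ b * R a b b) ^ 2 := by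
        rw [Finset.mul_sum, Finset.mul_sum, Finset.mul_sum]
        refine Finset.sum_congr rfl fun b _ => ?_
        field_simp
    _ ≤ _ := by
        refine Finset.sum_le_sum fun b _ => ?_
        refine le_trans ?_ (Finset.single_le_sum (f := fun c => (1 + (l a * l b + l b * l c + l c * l a) / 3) *
          (γ a * γ b * γ c) * R a b c ^ 2) (fun c _ => ?_) (Finset.mem_univ b))
        · have e : ε / 3 * l b ^ 2 ≤ 1 + (l a * l b + l b * l b + l b * l a) / 3 := by
            nlinarith [hl b a]
          have := mul_le_mul_of_nonneg_right e (show 0 ≤ γ a * γ b * γ b * R a b b ^ 2 by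
            have := hγ0 a; have := hγ0 b; positivity)
          calc _ = _ := ?_
            _ ≤ _ := this
            _ = _ := ?_
          · ring
          · ring
        · have := hγ0 a; have := hγ0 b; have := hγ0 c
          have := hP a b c
          positivity

lemma jac_ineq2 (h : Eqn u) {ε Λ : ℝ} (hε : 0 < ε) (hΛ : 0 < Λ) (hc : CondAt ε u)
    (hb : ∀ x Q l, Spec u x Q l → ∀ i, l i ^ 2 ≤ Λ) (x : EE n) :
    min 1 (ε / Λ) / 3 * (1 / (1 + Λ)) ^ 3 * ∑ k, ∑ i, ∑ j, T3 u k x i j ^ 2 ≤ Lg u (bb u) x := by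
  obtain ⟨Q, l, S, hl⟩ := hc x
  have hΛ' := hb x Q l S
  rw [h.jacobi S, normT Q (fun k => T3 u k x) S.h1 (fun k i j => T3_swap23 h.hu k i j x)]
  set R := rotS Q (fun k => T3 u k x)
  set m := min 1 (ε / Λ) with hm
  have m0 : 0 < m := lt_min one_pos (by positivity)
  have m1 : m ≤ 1 := min_le_left _ _
  have m2 : m ≤ ε / Λ := min_le_right _ _
  have m3 : m * Λ ≤ ε := by rwa [le_div_iff₀ hΛ] at m2
  have hl' : ∀ i j, -(3 - m) ≤ l i ^ 2 + 2 * l i * l j := fun i j => by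
    rcases le_total (1 / Λ) (l i ^ 2) with h1 | h1
    · have : ε / Λ ≤ ε * l i ^ 2 := by
        have := mul_le_mul_of_nonneg_left h1 hε.le
        rwa [mul_one_div] at this
      nlinarith [hl i j]
    · have h2 : (l i * l j) ^ 2 ≤ 1 := by
        rw [mul_pow]
        calc l i ^ 2 * l j ^ 2 ≤ 1 / Λ * Λ := by gcongr; exact hΛ' j
          _ = 1 := by field_simp
      have := abs_le.1 (abs_le_of_sq_le_sq (a := l i * l j) (b := 1) (by simpa using h2) zero_le_one)
      nlinarith [this.1, sq_nonneg (l i)]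
  have hP : ∀ a b c, m / 3 ≤ 1 + (l a * l b + l b * l c + l c * l a) / 3 := fun a b c => by
    have := triple (s := 3 - m) (by linarith) (hl' a b) (hl' b a) (hl' a c) (hl' c a) (hl' b c) (hl' c b)
    linarith
  have hγ : ∀ i, 1 / (1 + Λ) ≤ (1 + l i ^ 2)⁻¹ := fun i => by
    rw [one_div]; gcongr; exact hΛ' i
  simp only [Finset.mul_sum]
  refine Finset.sum_le_sum fun a _ => Finset.sum_le_sum fun b _ => Finset.sum_le_sum fun c _ => ?_
  have e : (1 / (1 + Λ)) ^ 3 = 1 / (1 + Λ) * (1 / (1 + Λ)) * (1 / (1 + Λ)) := by ring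
  rw [e]
  have hΛ0 : (0:ℝ) ≤ 1 / (1 + Λ) := by positivity
  have := (hP a b c)
  gcongr
  · linarith
  · exact hγ a
  · exact hγ b
  · exact hγ c

end jac

section calcs
open Matrix
variable {n : ℕ} {u : EE n → ℝ}

lemma C2.diff {f : EE n → ℝ} (hf : ContDiff ℝ 2 f) : Differentiable ℝ f := hf.differentiable (by norm_num)
lemma C2.pd1 {f : EE n → ℝ} (hf : ContDiff ℝ 2 f) (i : Fin n) : ContDiff ℝ 1 (pd i f) :=
  pd_contDiff hf (by norm_num)
lemma C2.pdd {f : EE n → ℝ} (hf : ContDiff ℝ 2 f) (i : Fin n) : Differentiable ℝ (pd i f) :=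
  (C2.pd1 hf i).differentiable (by norm_num)
lemma C1.pdc {f : EE n → ℝ} (hf : ContDiff ℝ 1 f) (i : Fin n) : Continuous (pd i f) :=
  (pd_contDiff (m := 0) hf (by norm_num)).continuous
lemma C2.pdpdc {f : EE n → ℝ} (hf : ContDiff ℝ 2 f) (i j : Fin n) : Continuous (pd i (pd j f)) :=
  C1.pdc (C2.pd1 hf j) i

lemma gi_symm' (hu : ContDiff ℝ (⊤ : ℕ∞) u) (x : EE n) (i j : Fin n) : gi u x i j = gi u x j i := by
  conv_lhs => rw [← gi_symm hu x, transpose_apply]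

lemma Gam_symm (hu : ContDiff ℝ (⊤ : ℕ∞) u) (f g : EE n → ℝ) (x : EE n) : Gam u f g x = Gam u g f x := by
  unfold Gam
  rw [Finset.sum_comm]
  refine Finset.sum_congr rfl fun i _ => Finset.sum_congr rfl fun j _ => ?_
  rw [gi_symm' hu]; ring

lemma Lg_add {f g : EE n → ℝ} (hf : ContDiff ℝ 2 f) (hg : ContDiff ℝ 2 g) (x : EE n) :
    Lg u (fun y => f y + g y) x = Lg u f x + Lg u g x := by
  unfold Lg
  simp only [← Finset.sum_add_distrib]
  refine Finset.sum_congr rfl fun i _ => Finset.sum_congr rfl fun j _ => ?_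
  rw [show pd j (fun y => f y + g y) = fun y => pd j f y + pd j g y from
    funext fun y => pd_add (C2.diff hf y) (C2.diff hg y), pd_add (C2.pdd hf j x) (C2.pdd hg j x)]
  ring

lemma Lg_const_mul {f : EE n → ℝ} (c : ℝ) (hf : ContDiff ℝ 2 f) (x : EE n) :
    Lg u (fun y => c * f y) x = c * Lg u f x := by
  unfold Lg
  simp only [Finset.mul_sum]
  refine Finset.sum_congr rfl fun i _ => Finset.sum_congr rfl fun j _ => ?_
  rw [show pd j (fun y => c * f y) = fun y => c * pd j f y from
    funext fun y => pd_const_mul c (C2.diff hf y), pd_const_mul c (C2.pdd hf j x)]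
  ring

lemma Lg_const (c : ℝ) (x : EE n) : Lg u (fun _ => c) x = 0 := by
  unfold Lg
  refine Finset.sum_eq_zero fun i _ => Finset.sum_eq_zero fun j _ => ?_
  rw [show pd j (fun _ : EE n => c) = fun _ => 0 from funext fun y => pd_const j c y, pd_const]; ring

lemma Lg_mul (hu : ContDiff ℝ (⊤ : ℕ∞) u) {f g : EE n → ℝ} (hf : ContDiff ℝ 2 f) (hg : ContDiff ℝ 2 g) (x : EE n) :
    Lg u (fun y => f y * g y) x = f x * Lg u g x + g x * Lg u f x + 2 * Gam u f g x := by
  have e : Lg u (fun y => f y * g y) x = f x * Lg u g x + g x * Lg u f x + Gam u f g x + Gam u g f x := by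
    unfold Lg Gam
    simp only [Finset.mul_sum, ← Finset.sum_add_distrib]
    refine Finset.sum_congr rfl fun i _ => Finset.sum_congr rfl fun j _ => ?_
    rw [show pd j (fun y => f y * g y) = fun y => pd j f y * g y + f y * pd j g y from
      funext fun y => pd_mul (C2.diff hf y) (C2.diff hg y),
      pd_add ((C2.pdd hf j x).fun_mul (C2.diff hg x)) ((C2.diff hf x).fun_mul (C2.pdd hg j x)),
      pd_mul (C2.pdd hf j x) (C2.diff hg x), pd_mul (C2.diff hf x) (C2.pdd hg j x)]
    ring
  rw [e, Gam_symm hu g f]; ring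

lemma Lg_comp {f : EE n → ℝ} (hf : ContDiff ℝ 2 f) {h h' h'' : ℝ → ℝ}
    (d1 : ∀ y, HasDerivAt h (h' (f y)) (f y)) (d2 : ∀ y, HasDerivAt h' (h'' (f y)) (f y)) (x : EE n) :
    Lg u (fun y => h (f y)) x = h' (f x) * Lg u f x + h'' (f x) * Gam u f f x := by
  unfold Lg Gam
  simp only [Finset.mul_sum, ← Finset.sum_add_distrib]
  refine Finset.sum_congr rfl fun i _ => Finset.sum_congr rfl fun j _ => ?_
  have hd : DifferentiableAt ℝ (fun y => h' (f y)) x :=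
    (d2 x).differentiableAt.comp x (C2.diff hf x)
  rw [show pd j (fun y => h (f y)) = fun y => h' (f y) * pd j f y from
    funext fun y => pd_comp (d1 y) (C2.diff hf y), pd_mul hd (C2.pdd hf j x),
    pd_comp (d2 x) (C2.diff hf x)]
  ring

lemma Gam_comp {f g : EE n → ℝ} {x : EE n} {h : ℝ → ℝ} {h' : ℝ} (hf : DifferentiableAt ℝ f x)
    (d1 : HasDerivAt h h' (f x)) : Gam u (fun y => h (f y)) g x = h' * Gam u f g x := by
  unfold Gam
  simp only [Finset.mul_sum]
  refine Finset.sum_congr rfl fun i _ => Finset.sum_congr rfl fun j _ => ?_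
  rw [pd_comp d1 hf]; ring

/-- directional derivative in frame direction -/
lemma Gam_frame {x : EE n} {Q : Matrix (Fin n) (Fin n) ℝ} {l : Fin n → ℝ} (S : Spec u x Q l) (f g : EE n → ℝ) :
    Gam u f g x = ∑ a, (1 + l a ^ 2)⁻¹ * ((∑ i, Q i a * pd i f x) * (∑ i, Q i a * pd i g x)) := by
  have hG : gi u x = Q * diagonal (fun i => (1 + l i ^ 2)⁻¹) * Qᵀ := S.inv_eq
  rw [← bil_frame, ← hG]
  simp only [Gam, mul_assoc]

lemma Gam_nonneg (hu : ContDiff ℝ (⊤ : ℕ∞) u) (f : EE n → ℝ) (x : EE n) : 0 ≤ Gam u f f x := by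
  obtain ⟨Q, l, S⟩ := exists_Spec' hu x
  rw [Gam_frame S]
  exact Finset.sum_nonneg fun a _ => mul_nonneg (by positivity) (mul_self_nonneg _)

lemma Gam_cs (hu : ContDiff ℝ (⊤ : ℕ∞) u) (f g : EE n → ℝ) (x : EE n) {t : ℝ} (ht : 0 < t) :
    2 * |Gam u f g x| ≤ t * Gam u f f x + t⁻¹ * Gam u g g x := by
  obtain ⟨Q, l, S⟩ := exists_Spec' hu x
  simp only [Gam_frame S]
  have hc : ∀ A B : ℝ, 2 * |A * B| ≤ t * (A * A) + t⁻¹ * (B * B) := by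
    intro A B
    rw [abs_mul]
    have h1 : t * t⁻¹ = 1 := mul_inv_cancel₀ ht.ne'
    have h2 := mul_nonneg (inv_pos.2 ht).le (sq_nonneg (t * |A| - |B|))
    have : t⁻¹ * (t * |A| - |B|) ^ 2 = t * (A * A) + t⁻¹ * (B * B) - 2 * (|A| * |B|) := by
      rw [← abs_mul_abs_self A, ← abs_mul_abs_self B]
      field_simp; ring
    linarith
  calc _ ≤ 2 * ∑ a, |(1 + l a ^ 2)⁻¹ * ((∑ i, Q i a * pd i f x) * (∑ i, Q i a * pd i g x))| := by
        gcongr; exact Finset.abs_sum_le_sum_abs _ _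
    _ ≤ _ := by
        simp only [Finset.mul_sum (s := (Finset.univ : Finset (Fin n))) (f := fun a => |(1 + l a ^ 2)⁻¹ * ((∑ i, Q i a * pd i f x) * (∑ i, Q i a * pd i g x))|)]
        rw [Finset.mul_sum (a := t), Finset.mul_sum (a := t⁻¹), ← Finset.sum_add_distrib]
        refine Finset.sum_le_sum fun a _ => ?_
        have hp : 0 < (1 + l a ^ 2)⁻¹ := by positivity
        rw [abs_mul, abs_of_pos hp]
        have := mul_le_mul_of_nonneg_left (hc (∑ i, Q i a * pd i f x) (∑ i, Q i a * pd i g x)) hp.le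
        linarith

lemma hasDerivAt_lineV {f : EE n → ℝ} (hf : Differentiable ℝ f) (x v : EE n) (t : ℝ) :
    HasDerivAt (fun t : ℝ => f (x + t • v)) (∑ i, v i * pd i f (x + t • v)) t := by
  have h1 : HasDerivAt (fun t : ℝ => x + t • v) v t := by
    simpa using ((hasDerivAt_id t).smul_const v).const_add x
  have := (hf (x + t • v)).hasFDerivAt.comp_hasDerivAt t h1
  rwa [fderiv_eq_sum_pd] at this

lemma deriv2_line {f : EE n → ℝ} (hf : ContDiff ℝ 2 f) (x v : EE n) :
    deriv (deriv (fun t : ℝ => f (x + t • v))) 0 = ∑ i, ∑ j, v i * v j * pd j (pd i f) x := by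
  rw [show deriv (fun t : ℝ => f (x + t • v)) = fun t => ∑ i, v i * pd i f (x + t • v) from
    funext fun t => (hasDerivAt_lineV (C2.diff hf) x v t).deriv]
  have : HasDerivAt (fun t : ℝ => ∑ i, v i * pd i f (x + t • v))
      (∑ i, v i * ∑ j, v j * pd j (pd i f) (x + (0:ℝ) • v)) 0 :=
    HasDerivAt.fun_sum fun i _ => (hasDerivAt_lineV (C2.pdd hf i) x v 0).const_mul _
  rw [this.deriv]
  simp only [zero_smul, add_zero, Finset.mul_sum, mul_assoc]

lemma localMax_second {f : EE n → ℝ} (hf : ContDiff ℝ 2 f) {x : EE n} (hx : IsLocalMax f x) (v : EE n) :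
    ∑ i, ∑ j, v i * v j * pd j (pd i f) x ≤ 0 := by
  rw [← deriv2_line hf x v]
  by_contra hcon
  push Not at hcon
  set F := fun t : ℝ => f (x + t • v) with hF
  have hcl : ContinuousAt (fun t : ℝ => x + t • v) 0 := by fun_prop
  have hmax : IsLocalMax F 0 := by
    have : IsLocalMax f ((fun t : ℝ => x + t • v) 0) := by simpa using hx
    exact IsLocalMax.comp_continuous (g := fun t : ℝ => x + t • v) this hcl
  have hFc : ContinuousAt F 0 := by
    have : Continuous F := hf.continuous.comp (by fun_prop)
    exact this.continuousAt
  have hmin := isLocalMin_of_deriv_deriv_pos hcon hmax.deriv_eq_zero hFc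
  have hconst : F =ᶠ[nhds 0] fun _ => F 0 := by
    filter_upwards [hmax, hmin] with t h1 h2
    exact le_antisymm h1 h2
  have h1 := hconst.deriv.deriv_eq
  simp at h1
  rw [h1] at hcon
  exact lt_irrefl _ hcon

lemma localMax_Lg (hu : ContDiff ℝ (⊤ : ℕ∞) u) {f : EE n → ℝ} (hf : ContDiff ℝ 2 f) {x : EE n} (hx : IsLocalMax f x) :
    Lg u f x ≤ 0 ∧ ∀ i, pd i f x = 0 := by
  constructor
  · obtain ⟨Q, l, S⟩ := exists_Spec' hu x
    have hG : gi u x = Q * diagonal (fun i => (1 + l i ^ 2)⁻¹) * Qᵀ := S.inv_eq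
    unfold Lg
    rw [hG]
    simp only [qcj_apply, Finset.sum_mul]
    rw [Finset.sum_congr rfl fun l _ => Finset.sum_comm, Finset.sum_comm]
    refine Finset.sum_nonpos fun a _ => ?_
    have := localMax_second hf hx (WithLp.toLp 2 fun i => Q i a)
    have hp : 0 < (1 + l a ^ 2)⁻¹ := by positivity
    have h2 := mul_nonpos_of_nonneg_of_nonpos hp.le this
    refine le_of_eq_of_le ?_ h2
    simp only [Finset.mul_sum]
    refine Finset.sum_congr rfl fun i _ => Finset.sum_congr rfl fun j _ => ?_
    rw [pd_comm hf]; ring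
  · intro i; simp [pd, hx.fderiv_eq_zero]

/-- quadratic test functions -/
noncomputable def qf (u : EE n → ℝ) (α β : ℝ) (q c : Fin n → ℝ) (x : EE n) : ℝ :=
  ∑ k, (α * (x k - q k) ^ 2 + β * (pd k u x - c k) ^ 2)

lemma coord_smooth (k : Fin n) : ContDiff ℝ (⊤ : ℕ∞) (fun x : EE n => x k) :=
  (EuclideanSpace.proj k : EE n →L[ℝ] ℝ).contDiff

lemma qf_smooth (hu : ContDiff ℝ (⊤ : ℕ∞) u) (α β : ℝ) (q c : Fin n → ℝ) :
    ContDiff ℝ (⊤ : ℕ∞) (qf u α β q c) := by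
  unfold qf
  refine ContDiff.sum fun k _ => ?_
  exact (contDiff_const.mul (((coord_smooth k).sub contDiff_const).pow 2)).add
    (contDiff_const.mul (((pd_smooth hu).sub contDiff_const).pow 2))

lemma pd_qf (hu : ContDiff ℝ (⊤ : ℕ∞) u) (α β : ℝ) (q c : Fin n → ℝ) (i : Fin n) (x : EE n) :
    pd i (qf u α β q c) x = 2 * α * (x i - q i) + 2 * β * ∑ k, Hess u x i k * (pd k u x - c k) := by
  have hc : ∀ k, DifferentiableAt ℝ (fun y : EE n => y k - q k) x := fun k =>
    (smooth_diff ((coord_smooth k).sub contDiff_const)) x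
  have hd : ∀ k, DifferentiableAt ℝ (fun y : EE n => pd k u y - c k) x := fun k =>
    (smooth_diff ((pd_smooth hu).sub contDiff_const)) x
  unfold qf
  rw [pd_sum (fun k _ => (((hc k).fun_pow 2).const_mul α).fun_add (((hd k).fun_pow 2).const_mul β))]
  have : ∀ k, pd i (fun y => α * (y k - q k) ^ 2 + β * (pd k u y - c k) ^ 2) x =
      2 * α * (x k - q k) * (if i = k then 1 else 0) + 2 * β * (Hess u x i k * (pd k u x - c k)) := by
    intro k
    rw [pd_add (((hc k).fun_pow 2).const_mul α) (((hd k).fun_pow 2).const_mul β), pd_const_mul _ ((hc k).fun_pow 2),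
      pd_const_mul _ ((hd k).fun_pow 2)]
    simp only [sq]
    rw [pd_mul (hc k) (hc k), pd_mul (hd k) (hd k), pd_sub (smooth_diff (coord_smooth k) x) (by fun_prop),
      pd_sub (smooth_diff (pd_smooth hu) x) (by fun_prop), pd_const, pd_const, pd_coord, Hess_apply hu]
    ring
  simp only [this, Finset.sum_add_distrib, ← Finset.mul_sum]
  simp

lemma Eqn.Lg_qf (h : Eqn u) (α β : ℝ) (q c : Fin n → ℝ) (x : EE n) :
    Lg u (qf u α β q c) x = 2 * α * trace (gi u x) + 2 * β * trace (gi u x * (Hess u x * Hess u x)) := by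
  have hu := h.hu
  have e : ∀ i j, pd i (pd j (qf u α β q c)) x = 2 * α * (if i = j then 1 else 0) +
      2 * β * ∑ k, (Hess u x j k * Hess u x k i + T3 u k x j i * (pd k u x - c k)) := by
    intro i j
    have hc : DifferentiableAt ℝ (fun y : EE n => y j - q j) x :=
      (smooth_diff ((coord_smooth j).sub contDiff_const)) x
    have hd : ∀ k, DifferentiableAt ℝ (fun y : EE n => pd k u y - c k) x := fun k =>
      (smooth_diff ((pd_smooth hu).sub contDiff_const)) x
    have hH : ∀ k, DifferentiableAt ℝ (fun y : EE n => Hess u y j k) x := fun k =>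
      (smooth_diff (Hess_smooth hu j k)) x
    have hs : DifferentiableAt ℝ (fun y : EE n => ∑ k, Hess u y j k * (pd k u y - c k)) x :=
      DifferentiableAt.fun_sum fun k _ => (hH k).fun_mul (hd k)
    rw [show pd j (qf u α β q c) = fun y => 2 * α * (y j - q j) + 2 * β * ∑ k, Hess u y j k * (pd k u y - c k)
      from funext fun y => pd_qf hu α β q c j y]
    rw [pd_add (hc.const_mul _) (hs.const_mul _), pd_const_mul _ hc, pd_const_mul _ hs,
      pd_sum fun k _ => (hH k).fun_mul (hd k), pd_sub (smooth_diff (coord_smooth j) x) (by fun_prop), pd_const, pd_coord]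
    congr 1
    · ring
    congr 1
    refine Finset.sum_congr rfl fun k _ => ?_
    rw [pd_mul (hH k) (hd k), pd_sub (smooth_diff (pd_smooth hu) x) (by fun_prop), pd_const]
    have t1 : pd i (fun y => Hess u y j k) x = T3 u k x j i := by
      rw [← T3_eq hu i j k x, T3_swap23 hu, T3_swap12 hu, T3_swap23 hu]
    rw [t1, show pd i (pd k u) x = Hess u x k i by rw [← Hess_symm hu x, transpose_apply, Hess_apply hu]]
    ring
  unfold Lg
  simp only [e]
  have e1 : ∀ k, ∑ i, ∑ j, gi u x i j * T3 u k x j i = 0 := by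
    intro k
    have := h.e1 x k
    simpa only [trace, diag_apply, Matrix.mul_apply] using this
  have e2 : trace (gi u x * (Hess u x * Hess u x)) = ∑ i, ∑ j, gi u x i j * ∑ k, Hess u x j k * Hess u x k i := by
    simp only [trace, diag_apply, Matrix.mul_apply]
  have e3 : ∑ i, ∑ j, gi u x i j * ∑ k, T3 u k x j i * (pd k u x - c k) = 0 := by
    simp only [Finset.mul_sum]
    rw [Finset.sum_congr rfl fun i _ => Finset.sum_comm, Finset.sum_comm]
    refine Finset.sum_eq_zero fun k _ => ?_
    calc _ = (∑ i, ∑ j, gi u x i j * T3 u k x j i) * (pd k u x - c k) := by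
          simp only [Finset.sum_mul, mul_assoc]
      _ = 0 := by rw [e1, zero_mul]
  simp only [mul_add, Finset.sum_add_distrib]
  have e4 : ∑ i, ∑ j, gi u x i j * (2 * α * if i = j then 1 else 0) = 2 * α * trace (gi u x) := by
    simp [trace, Finset.mul_sum, mul_comm]
  have e5 : ∀ F : Fin n → Fin n → ℝ, ∑ i, ∑ j, gi u x i j * (2 * β * F i j) = 2 * β * ∑ i, ∑ j, gi u x i j * F i j := by
    intro F; simp only [Finset.mul_sum]
    exact Finset.sum_congr rfl fun i _ => Finset.sum_congr rfl fun j _ => by ring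
  rw [e4, e5 (fun i j => ∑ k, Hess u x j k * Hess u x k i), e5 (fun i j => ∑ k, T3 u k x j i * (pd k u x - c k)), e3, e2]
  ring

end calcs

section step1
open Matrix
variable {n : ℕ} {u : EE n → ℝ}

lemma tr_frame (Q : Matrix (Fin n) (Fin n) ℝ) (h2 : Qᵀ * Q = 1) (α : Fin n → ℝ) :
    trace (Q * diagonal α * Qᵀ) = ∑ a, α a := by
  rw [trace_mul_comm, ← Matrix.mul_assoc, h2, Matrix.one_mul, trace_diagonal]

lemma Spec.tr_gi {x : EE n} {Q : Matrix (Fin n) (Fin n) ℝ} {l : Fin n → ℝ} (S : Spec u x Q l) :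
    trace (gi u x) = ∑ a, (1 + l a ^ 2)⁻¹ := by
  rw [show gi u x = _ from S.inv_eq, tr_frame Q S.h2]

lemma Spec.tr_giHH {x : EE n} {Q : Matrix (Fin n) (Fin n) ℝ} {l : Fin n → ℝ} (S : Spec u x Q l) :
    trace (gi u x * (Hess u x * Hess u x)) = ∑ a, l a ^ 2 * (1 + l a ^ 2)⁻¹ := by
  rw [show gi u x = _ from S.inv_eq, S.h3, qcj_mul S.h2, qcj_mul S.h2, tr_frame Q S.h2]
  exact Finset.sum_congr rfl fun a _ => by ring

lemma gradient_apply (u : EE n → ℝ) (x : EE n) (k : Fin n) : gradient u x k = pd k u x := by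
  have : inner ℝ (gradient u x) (EuclideanSpace.single k (1:ℝ)) = pd k u x := by
    rw [gradient, InnerProductSpace.toDual_symm_apply]; rfl
  rw [← this, EuclideanSpace.inner_single_right]; simp

lemma norm_gradient_sq (u : EE n → ℝ) (x : EE n) : ‖gradient u x‖ ^ 2 = ∑ k, pd k u x ^ 2 := by
  rw [EuclideanSpace.real_norm_sq_eq]
  exact Finset.sum_congr rfl fun k _ => by rw [gradient_apply]

lemma Spec.Vol_sq {x : EE n} {Q : Matrix (Fin n) (Fin n) ℝ} {l : Fin n → ℝ} (S : Spec u x Q l) :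
    Vol u x ^ 2 = ∏ i, (1 + l i ^ 2) := by
  rw [Vol, Real.sq_sqrt S.det_pos.le, S.det_eq]

lemma exp_bb (hu : ContDiff ℝ (⊤ : ℕ∞) u) (x : EE n) : Real.exp (bb u x) = Vol u x :=
  Real.exp_log (Vol_pos hu x)

lemma max_point (h : Eqn u) {m : ℝ} (hm : 0 < m)
    (hJ : ∀ x, m * Gam u (bb u) (bb u) x ≤ Lg u (bb u) x) {φ : EE n → ℝ} (hφ : ContDiff ℝ 2 φ) {x : EE n}
    (hx : IsLocalMax (fun y => φ y * Real.exp (m * bb u y)) x) (hpos : 0 < φ x) : Lg u φ x ≤ 0 := by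
  have hu := h.hu
  have hb : ContDiff ℝ 2 (bb u) := (bb_smooth hu).of_le two_le_top
  set E := fun y => Real.exp (m * bb u y) with hE
  have hEs : ContDiff ℝ 2 E := (contDiff_const.mul hb).exp
  obtain ⟨h1, h2⟩ := localMax_Lg hu (hφ.mul hEs) hx
  have hd : ∀ t : ℝ, HasDerivAt (fun t => Real.exp (m * t)) (m * Real.exp (m * t)) t := fun t => by
    have := ((hasDerivAt_id t).const_mul m).exp
    simpa [mul_comm] using this
  have hd2 : ∀ t : ℝ, HasDerivAt (fun t => m * Real.exp (m * t)) (m * (m * Real.exp (m * t))) t :=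
    fun t => (hd t).const_mul m
  have hLE : Lg u E x = m * E x * Lg u (bb u) x + m * (m * E x) * Gam u (bb u) (bb u) x :=
    Lg_comp (h := fun t => Real.exp (m * t)) (h' := fun t => m * Real.exp (m * t))
      (h'' := fun t => m * (m * Real.exp (m * t))) hb (fun y => hd _) (fun y => hd2 _) x
  have hE0 : 0 < E x := Real.exp_pos _
  have hpE : ∀ i, pd i E x = m * E x * pd i (bb u) x := fun i => pd_comp (hd _) (C2.diff hb x)
  have hpφ : ∀ i, pd i φ x = -(m * φ x) * pd i (bb u) x := by
    intro i
    have := h2 i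
    rw [pd_mul (C2.diff hφ x) (C2.diff hEs x), hpE] at this
    have h3 : E x * (pd i φ x + (m * φ x) * pd i (bb u) x) = 0 := by linarith
    rcases mul_eq_zero.1 h3 with h4 | h4
    · exact absurd h4 hE0.ne'
    · linarith
  have hG : Gam u φ E x = -(m * φ x) * (m * E x) * Gam u (bb u) (bb u) x := by
    unfold Gam
    simp only [hpφ, hpE, Finset.mul_sum]
    exact Finset.sum_congr rfl fun i _ => Finset.sum_congr rfl fun j _ => by ring
  rw [Lg_mul hu hφ hEs, hLE, hG] at h1
  have h3 : E x * (Lg u φ x + φ x * m * (Lg u (bb u) x - m * Gam u (bb u) (bb u) x)) ≤ 0 := by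
    linarith
  have h4 := nonpos_of_mul_nonpos_right h3 hE0
  have h5 := mul_nonneg (mul_nonneg hpos.le hm.le) (sub_nonneg.2 (hJ x))
  linarith

lemma bb_bound_of {x : EE n} (hu : ContDiff ℝ (⊤ : ℕ∞) u) {σ : ℝ} (hσ : σ < 1)
    {Q : Matrix (Fin n) (Fin n) ℝ} {l : Fin n → ℝ} (S : Spec u x Q l)
    (hs : ∑ a, l a ^ 2 * (1 + l a ^ 2)⁻¹ ≤ σ) : bb u x ≤ Real.log (((1 - σ)⁻¹) ^ n) := by
  have hV := Vol_pos hu x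
  refine Real.log_le_log hV ?_
  have h1 : ∀ i, 1 + l i ^ 2 ≤ (1 - σ)⁻¹ := by
    intro i
    have h2 : l i ^ 2 * (1 + l i ^ 2)⁻¹ ≤ σ :=
      (Finset.single_le_sum (f := fun a => l a ^ 2 * (1 + l a ^ 2)⁻¹) (fun a _ => by positivity)
        (Finset.mem_univ i)).trans hs
    have hp : (0:ℝ) < 1 + l i ^ 2 := by positivity
    rw [← div_eq_mul_inv, div_le_iff₀ hp] at h2
    rw [inv_eq_one_div, le_div_iff₀ (by linarith)]
    linarith
  have h3 : (1:ℝ) ≤ ((1 - σ)⁻¹) ^ n := by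
    have h0 : 0 ≤ σ := le_trans (Finset.sum_nonneg fun a _ => by positivity) hs
    refine one_le_pow₀ ?_
    rw [one_le_inv₀ (by linarith)]; linarith
  have h4 : Vol u x ^ 2 ≤ ((1 - σ)⁻¹) ^ n := by
    rw [S.Vol_sq]
    calc ∏ i, (1 + l i ^ 2) ≤ ∏ i : Fin n, (1 - σ)⁻¹ :=
          Finset.prod_le_prod (fun i _ => by positivity) fun i _ => h1 i
      _ = _ := by simp
  nlinarith

lemma hess_step (h : Eqn u) {m : ℝ} (hm : 0 < m)
    (hJ : ∀ x, m * Gam u (bb u) (bb u) x ≤ Lg u (bb u) x) {K δ R0 : ℝ} (hK : (n:ℝ) - 1 < K) (hn : 1 ≤ n)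
    (hKδ : K * δ ^ 2 < 1)
    (hg : ∀ x : EE n, R0 ≤ ‖x‖ → ∑ k, pd k u x ^ 2 ≤ δ ^ 2 * ‖x‖ ^ 2) :
    ∃ B, ∀ x, bb u x ≤ B := by
  have hu := h.hu
  have hn' : (1:ℝ) ≤ n := by exact_mod_cast hn
  have hK0 : 0 < K := by linarith
  set τ := 1 - K * δ ^ 2 with hτ
  have hτ0 : 0 < τ := by linarith
  have hWc : Continuous fun x : EE n => ∑ k, pd k u x ^ 2 := by
    have : ∀ k, Continuous (pd k u) := fun k => (pd_smooth hu).continuous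
    fun_prop
  obtain ⟨C0, hC0⟩ : ∃ C0 : ℝ, ∀ x : EE n, ‖x‖ ≤ R0 → ∑ k, pd k u x ^ 2 ≤ C0 := by
    obtain ⟨C, hC⟩ := (isCompact_closedBall (0 : EE n) R0).bddAbove_image hWc.continuousOn
    exact ⟨C, fun x hx => hC ⟨x, by simpa using hx, rfl⟩⟩
  set C1 := max C0 0
  set σ := (n:ℝ) / (K + 1) with hσ
  have hσ1 : σ < 1 := by rw [hσ, div_lt_one (by linarith)]; linarith
  set B0 := Real.log (((1 - σ)⁻¹) ^ n) with hB0
  set Z := 2 * (τ + K * C1) * Real.exp (m * B0) / τ with hZ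
  have hC1 : 0 ≤ C1 := le_max_right _ _
  have hZ0 : 0 < Z := by positivity
  refine ⟨Real.log Z / m, fun x => ?_⟩
  rw [le_div_iff₀ hm, mul_comm, Real.le_log_iff_exp_le hZ0]
  -- choose R
  set R := max (max R0 1) (‖x‖ * (2 / τ + 1)) with hR
  have hR1 : 1 ≤ R := (le_max_right _ _).trans (le_max_left _ _)
  have hR0 : R0 ≤ R := (le_max_left _ _).trans (le_max_left _ _)
  have hRx : ‖x‖ * (2 / τ + 1) ≤ R := le_max_right _ _
  have hRp : 0 < R := by linarith
  set φ : EE n → ℝ := fun y => τ + (1 / R ^ 2) * qf u (-1) K 0 0 y with hφ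
  have hφ2 : ContDiff ℝ 2 φ := contDiff_const.add (contDiff_const.mul ((qf_smooth hu _ _ _ _).of_le two_le_top))
  have hqf : ∀ y, qf u (-1) K 0 0 y = K * (∑ k, pd k u y ^ 2) - ‖y‖ ^ 2 := by
    intro y
    rw [EuclideanSpace.real_norm_sq_eq, Finset.mul_sum, ← Finset.sum_sub_distrib]
    unfold qf
    refine Finset.sum_congr rfl fun k _ => ?_
    simp; ring
  have hφout : ∀ y, R ≤ ‖y‖ → φ y ≤ 0 := by
    intro y hy
    have h1 := hg y (hR0.trans hy)
    have h2 : qf u (-1) K 0 0 y ≤ -τ * R ^ 2 := by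
      rw [hqf]
      have h3 : K * (∑ k, pd k u y ^ 2) ≤ K * (δ ^ 2 * ‖y‖ ^ 2) := by gcongr
      have h4 : R ^ 2 ≤ ‖y‖ ^ 2 := by gcongr
      have : τ * R ^ 2 ≤ τ * ‖y‖ ^ 2 := by gcongr
      rw [hτ] at this ⊢
      linarith
    have : 1 / R ^ 2 * qf u (-1) K 0 0 y ≤ 1 / R ^ 2 * (-τ * R ^ 2) := by gcongr
    have h5 : 1 / R ^ 2 * (-τ * R ^ 2) = -τ := by field_simp
    simp only [hφ]; linarith
  have hφup : ∀ y, φ y ≤ τ + K * C1 := by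
    intro y
    have h1 : qf u (-1) K 0 0 y ≤ K * C1 := by
      rw [hqf]
      rcases le_total ‖y‖ R0 with hy | hy
      · have := (hC0 y hy).trans (le_max_left C0 0)
        have : K * (∑ k, pd k u y ^ 2) ≤ K * C1 := by gcongr
        nlinarith [sq_nonneg ‖y‖]
      · have h3 : K * (∑ k, pd k u y ^ 2) ≤ K * (δ ^ 2 * ‖y‖ ^ 2) := by gcongr; exact hg y hy
        have h4 : K * δ ^ 2 * ‖y‖ ^ 2 ≤ 1 * ‖y‖ ^ 2 := by gcongr
        have : 0 ≤ K * C1 := by positivity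
        linarith
    have h2 : 1 / R ^ 2 * qf u (-1) K 0 0 y ≤ 1 / R ^ 2 * (K * C1) := by gcongr
    have h3 : 1 / R ^ 2 * (K * C1) ≤ 1 * (K * C1) := by
      gcongr
      rw [div_le_one (by positivity)]
      exact one_le_pow₀ hR1
    simp only [hφ]; linarith
  have hφx : τ / 2 ≤ φ x := by
    have h1 : -‖x‖ ^ 2 ≤ qf u (-1) K 0 0 x := by
      rw [hqf]
      have : 0 ≤ K * ∑ k, pd k u x ^ 2 := mul_nonneg hK0.le (Finset.sum_nonneg fun k _ => sq_nonneg _)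
      linarith
    have h2 : ‖x‖ ^ 2 * (2 / τ) ≤ R ^ 2 := by
      have : (‖x‖ * (2 / τ + 1)) ^ 2 ≤ R ^ 2 := by gcongr
      have h4 : 0 < 2 / τ := by positivity
      have : ‖x‖ ^ 2 * (2 / τ) ≤ (‖x‖ * (2 / τ + 1)) ^ 2 := by
        rw [mul_pow]; gcongr; nlinarith
      linarith
    have h3 : ‖x‖ ^ 2 ≤ R ^ 2 * (τ / 2) := by
      have := mul_le_mul_of_nonneg_right h2 (show 0 ≤ τ / 2 by positivity)
      have e : ‖x‖ ^ 2 * (2 / τ) * (τ / 2) = ‖x‖ ^ 2 := by field_simp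
      linarith
    have h5 : 1 / R ^ 2 * (-(R ^ 2 * (τ / 2))) ≤ 1 / R ^ 2 * qf u (-1) K 0 0 x := by gcongr; linarith
    have h6 : 1 / R ^ 2 * (-(R ^ 2 * (τ / 2))) = - (τ / 2) := by field_simp
    simp only [hφ]; linarith
  -- the maximum point
  set F := fun y => φ y * Real.exp (m * bb u y) with hF
  have hFc : Continuous F := hφ2.continuous.mul (Real.continuous_exp.comp (continuous_const.mul (bb_smooth hu).continuous))
  obtain ⟨x0, hx0, hmax⟩ := (isCompact_closedBall (0 : EE n) R).exists_isMaxOn (Metric.nonempty_closedBall.2 hRp.le) hFc.continuousOn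
  have hFx : 0 < F x := by
    have := Real.exp_pos (m * bb u x)
    have : 0 < φ x := by linarith
    simp only [hF]; positivity
  have hxR : ‖x‖ < R := by
    by_contra hcon
    push Not at hcon
    have := hφout x hcon; linarith
  have hle : F x ≤ F x0 := hmax (by simpa using hxR.le)
  have hφ0 : 0 < φ x0 := by
    by_contra hcon
    push Not at hcon
    have : F x0 ≤ 0 := mul_nonpos_of_nonpos_of_nonneg hcon (Real.exp_pos _).le
    linarith
  have hx0R : ‖x0‖ < R := by
    by_contra hcon
    push Not at hcon
    have := hφout x0 hcon; linarith
  have hloc : IsLocalMax F x0 := hmax.isLocalMax (Metric.closedBall_mem_nhds_of_mem (by simpa using hx0R))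
  have hL := max_point h hm hJ hφ2 hloc hφ0
  obtain ⟨Q, l, S⟩ := exists_Spec' hu x0
  have hL2 : Lg u φ x0 = 1 / R ^ 2 * (2 * (-1) * trace (gi u x0) + 2 * K * trace (gi u x0 * (Hess u x0 * Hess u x0))) := by
    rw [Lg_add contDiff_const (contDiff_const.mul ((qf_smooth hu _ _ _ _).of_le two_le_top)), Lg_const,
      Lg_const_mul _ ((qf_smooth hu _ _ _ _).of_le two_le_top), h.Lg_qf, zero_add]
  rw [hL2, S.tr_gi, S.tr_giHH] at hL
  have hL3 := nonpos_of_mul_nonpos_right hL (by positivity)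
  have hsum : ∑ a, (1 + l a ^ 2)⁻¹ = (n:ℝ) - ∑ a, l a ^ 2 * (1 + l a ^ 2)⁻¹ := by
    rw [eq_sub_iff_add_eq, ← Finset.sum_add_distrib]
    rw [Finset.sum_congr rfl fun a _ => show (1 + l a ^ 2)⁻¹ + l a ^ 2 * (1 + l a ^ 2)⁻¹ = 1 by
      have : (1 + l a ^ 2) ≠ 0 := by positivity
      field_simp]
    simp
  have hσs : ∑ a, l a ^ 2 * (1 + l a ^ 2)⁻¹ ≤ σ := by
    rw [hσ, le_div_iff₀ (by linarith)]
    rw [hsum] at hL3; linarith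
  have hb0 := bb_bound_of hu hσ1 S hσs
  have h7 : F x0 ≤ (τ + K * C1) * Real.exp (m * B0) := by
    simp only [hF]
    have := hφup x0
    gcongr
  have h8 : τ / 2 * Real.exp (m * bb u x) ≤ F x := by
    simp only [hF]; gcongr
  have h9 := h8.trans (hle.trans h7)
  rw [hZ, le_div_iff₀ hτ0]
  linarith

lemma l_bound (hu : ContDiff ℝ (⊤ : ℕ∞) u) {B : ℝ} (hB : ∀ x, bb u x ≤ B) (x : EE n)
    (Q : Matrix (Fin n) (Fin n) ℝ) (l : Fin n → ℝ) (S : Spec u x Q l) (i : Fin n) :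
    l i ^ 2 ≤ Real.exp B ^ 2 := by
  have h1 : Vol u x ≤ Real.exp B := by rw [← exp_bb hu]; exact Real.exp_le_exp.2 (hB x)
  have h2 : Vol u x ^ 2 ≤ Real.exp B ^ 2 := by have := Vol_pos hu x; gcongr
  rw [S.Vol_sq] at h2
  have h3 : 1 + l i ^ 2 ≤ ∏ i, (1 + l i ^ 2) := by
    rw [← Finset.mul_prod_erase _ _ (Finset.mem_univ i)]
    have : (1:ℝ) ≤ ∏ i ∈ Finset.univ.erase i, (1 + l i ^ 2) := by
      refine Finset.prod_induction (fun i => 1 + l i ^ 2) (fun t => (1:ℝ) ≤ t) ?_ le_rfl ?_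
      · intro a b ha hb; nlinarith
      · intro a _; nlinarith [sq_nonneg (l a)]
    exact le_mul_of_one_le_right (by positivity) this
  linarith

end step1

section scaling
open Matrix
variable {n : ℕ} {u : EE n → ℝ}

lemma frame_entry {Q : Matrix (Fin n) (Fin n) ℝ} (h1 : Q * Qᵀ = 1) {α : Fin n → ℝ} {m : ℝ}
    (hα : ∀ a, |α a| ≤ m) (i j : Fin n) : |(Q * diagonal α * Qᵀ) i j| ≤ m := by
  have hr : ∀ i, ∑ a, Q i a ^ 2 = 1 := fun i => by
    have := congrFun (congrFun h1 i) i
    simpa [Matrix.mul_apply, sq] using this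
  have hm : 0 ≤ m ∨ IsEmpty (Fin n) := by
    rcases isEmpty_or_nonempty (Fin n) with h | ⟨⟨a⟩⟩
    · exact Or.inr h
    · exact Or.inl ((abs_nonneg _).trans (hα a))
  rcases hm with hm | hm
  swap
  · exact (hm.false i).elim
  rw [qcj_apply]
  calc |∑ a, α a * (Q i a * Q j a)| ≤ ∑ a, |α a * (Q i a * Q j a)| := Finset.abs_sum_le_sum_abs _ _
    _ ≤ ∑ a, m * ((Q i a ^ 2 + Q j a ^ 2) / 2) := by
        refine Finset.sum_le_sum fun a _ => ?_
        rw [abs_mul]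
        gcongr
        · exact hα a
        · rw [abs_mul]; nlinarith [sq_nonneg (|Q i a| - |Q j a|), sq_abs (Q i a), sq_abs (Q j a)]
    _ = m := by
        rw [← Finset.mul_sum, ← Finset.sum_div, Finset.sum_add_distrib, hr, hr]; ring

lemma gi_entry (hu : ContDiff ℝ (⊤ : ℕ∞) u) (x : EE n) (i j : Fin n) : |gi u x i j| ≤ 1 := by
  obtain ⟨Q, l, S⟩ := exists_Spec' hu x
  rw [show gi u x = _ from S.inv_eq]
  refine frame_entry S.h1 (fun a => ?_) i j
  rw [abs_of_pos (by positivity)]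
  exact inv_le_one_of_one_le₀ (by nlinarith [sq_nonneg (l a)])

lemma Hess_entry (hu : ContDiff ℝ (⊤ : ℕ∞) u) {B : ℝ} (hB : ∀ x, bb u x ≤ B) (x : EE n) (i j : Fin n) :
    |Hess u x i j| ≤ Real.exp B := by
  obtain ⟨Q, l, S⟩ := exists_Spec' hu x
  rw [S.h3]
  refine frame_entry S.h1 (fun a => ?_) i j
  exact abs_le_of_sq_le_sq (l_bound hu hB x Q l S a) (Real.exp_pos _).le

lemma frame_norm {Q : Matrix (Fin n) (Fin n) ℝ} (h1 : Q * Qᵀ = 1) (v : Fin n → ℝ) :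
    ∑ a, (∑ i, Q i a * v i) * (∑ i, Q i a * v i) = ∑ i, v i ^ 2 := by
  have := bil_frame Q (fun _ => 1) v v
  rw [qcj_one h1] at this
  simp only [one_mul] at this
  rw [← this]
  refine Finset.sum_congr rfl fun k _ => ?_
  rw [Finset.sum_eq_single k]
  · simp [sq]
  · intro b _ hb; simp [Matrix.one_apply_ne hb.symm]
  · simp

lemma Gam_le (hu : ContDiff ℝ (⊤ : ℕ∞) u) (f : EE n → ℝ) (x : EE n) :
    Gam u f f x ≤ ∑ i, pd i f x ^ 2 := by
  obtain ⟨Q, l, S⟩ := exists_Spec' hu x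
  rw [Gam_frame S, ← frame_norm S.h1]
  refine Finset.sum_le_sum fun a _ => ?_
  refine mul_le_of_le_one_left (mul_self_nonneg _) ?_
  exact inv_le_one_of_one_le₀ (by nlinarith [sq_nonneg (l a)])

lemma Gam_ge (hu : ContDiff ℝ (⊤ : ℕ∞) u) {B : ℝ} (hB : ∀ x, bb u x ≤ B) (f : EE n → ℝ) (x : EE n) :
    (1 + Real.exp B ^ 2)⁻¹ * ∑ i, pd i f x ^ 2 ≤ Gam u f f x := by
  obtain ⟨Q, l, S⟩ := exists_Spec' hu x
  rw [Gam_frame S, ← frame_norm S.h1, Finset.mul_sum]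
  refine Finset.sum_le_sum fun a _ => ?_
  refine mul_le_mul_of_nonneg_right ?_ (mul_self_nonneg _)
  have := l_bound hu hB x Q l S a
  gcongr

lemma Vol_ge_one (hu : ContDiff ℝ (⊤ : ℕ∞) u) (x : EE n) : 1 ≤ Vol u x := by
  obtain ⟨Q, l, S⟩ := exists_Spec' hu x
  have h2 := S.Vol_sq
  have : (1:ℝ) ≤ ∏ i, (1 + l i ^ 2) := by
    refine Finset.prod_induction (fun i => 1 + l i ^ 2) (fun t => (1:ℝ) ≤ t) ?_ le_rfl ?_
    · intro a b ha hb; nlinarith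
    · intro a _; nlinarith [sq_nonneg (l a)]
  have := Vol_pos hu x
  nlinarith

lemma bb_nonneg (hu : ContDiff ℝ (⊤ : ℕ∞) u) (x : EE n) : 0 ≤ bb u x := Real.log_nonneg (Vol_ge_one hu x)

lemma Vol_le (hu : ContDiff ℝ (⊤ : ℕ∞) u) {B : ℝ} (hB : ∀ x, bb u x ≤ B) (x : EE n) : Vol u x ≤ Real.exp B := by
  rw [← exp_bb hu]; exact Real.exp_le_exp.2 (hB x)

/-- normalized solutions with bounded Hessian -/
structure Good (B c : ℝ) (u : EE n → ℝ) : Prop where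
  eqn : Eqn u
  bd : ∀ x, bb u x ≤ B
  jac : ∀ x, c * ∑ k, ∑ i, ∑ j, T3 u k x i j ^ 2 ≤ Lg u (bb u) x

lemma pd_scale {f : EE n → ℝ} (q : EE n) (R : ℝ) (k : Fin n) (hf : Differentiable ℝ f) (y : EE n) :
    pd k (fun y => f (q + R • y)) y = R * pd k f (q + R • y) := by
  have h1 : HasFDerivAt (fun y : EE n => q + R • y) (R • ContinuousLinearMap.id ℝ (EE n)) y :=
    ((hasFDerivAt_id y).const_smul R).const_add q
  have := ((hf (q + R • y)).hasFDerivAt.comp y h1).fderiv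
  simp only [pd]
  rw [show (fun y => f (q + R • y)) = f ∘ (fun y => q + R • y) from rfl, this]
  simp

lemma scale_smooth {f : EE n → ℝ} {m : WithTop ℕ∞} (q : EE n) (R : ℝ) (hf : ContDiff ℝ m f) :
    ContDiff ℝ m (fun y => f (q + R • y)) :=
  hf.comp (contDiff_const.add (contDiff_id.const_smul R))

/-- rescaled and normalized function -/
noncomputable def resc (u : EE n → ℝ) (q : EE n) (R : ℝ) (y : EE n) : ℝ :=
  (R ^ 2)⁻¹ * (u (q + R • y) - ∑ k, R * pd k u q * y k)

variable {q : EE n} {R : ℝ}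

lemma resc_smooth (hu : ContDiff ℝ (⊤ : ℕ∞) u) : ContDiff ℝ (⊤ : ℕ∞) (resc u q R) :=
  contDiff_const.mul ((scale_smooth q R hu).sub
    (ContDiff.sum fun k _ => contDiff_const.mul (coord_smooth k)))

lemma resc_pd (hu : ContDiff ℝ (⊤ : ℕ∞) u) (hR : R ≠ 0) (i : Fin n) (y : EE n) :
    pd i (resc u q R) y = R⁻¹ * (pd i u (q + R • y) - pd i u q) := by
  have h1 : DifferentiableAt ℝ (fun y => u (q + R • y)) y := smooth_diff (scale_smooth q R hu) y
  have h2 : ∀ k, DifferentiableAt ℝ (fun y : EE n => R * pd k u q * y k) y := fun k =>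
    smooth_diff (contDiff_const.mul (coord_smooth k)) y
  have h3 : DifferentiableAt ℝ (fun y : EE n => ∑ k, R * pd k u q * y k) y :=
    DifferentiableAt.fun_sum fun k _ => h2 k
  unfold resc
  rw [pd_const_mul _ (h1.fun_sub h3), pd_sub h1 h3, pd_scale q R i (smooth_diff hu), pd_sum fun k _ => h2 k]
  rw [Finset.sum_congr rfl fun k _ => show pd i (fun y : EE n => R * pd k u q * y k) y =
    R * pd k u q * (if i = k then 1 else 0) by
      rw [pd_const_mul _ (smooth_diff (coord_smooth k) y), pd_coord]]
  simp
  field_simp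

lemma resc_Hess (hu : ContDiff ℝ (⊤ : ℕ∞) u) (hR : R ≠ 0) (y : EE n) :
    Hess (resc u q R) y = Hess u (q + R • y) := by
  ext i j
  rw [Hess_apply (resc_smooth hu), Hess_apply hu,
    show pd j (resc u q R) = fun y => R⁻¹ * (pd j u (q + R • y) - pd j u q) from
      funext fun y => resc_pd hu hR j y]
  have h1 : DifferentiableAt ℝ (fun y => pd j u (q + R • y)) y :=
    smooth_diff (scale_smooth q R (pd_smooth hu)) y
  rw [pd_const_mul _ (h1.fun_sub (by fun_prop)), pd_sub h1 (by fun_prop), pd_const,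
    pd_scale q R i (smooth_diff (pd_smooth hu))]
  field_simp
  ring

lemma resc_gMat (hu : ContDiff ℝ (⊤ : ℕ∞) u) (hR : R ≠ 0) (y : EE n) :
    gMat (resc u q R) y = gMat u (q + R • y) := by simp only [gMat, resc_Hess hu hR]

lemma resc_gi (hu : ContDiff ℝ (⊤ : ℕ∞) u) (hR : R ≠ 0) (y : EE n) :
    gi (resc u q R) y = gi u (q + R • y) := by simp only [gi, resc_gMat hu hR]

lemma resc_Vol (hu : ContDiff ℝ (⊤ : ℕ∞) u) (hR : R ≠ 0) :
    Vol (resc u q R) = fun y => Vol u (q + R • y) := by ext y; simp only [Vol, resc_gMat hu hR]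

lemma resc_bb (hu : ContDiff ℝ (⊤ : ℕ∞) u) (hR : R ≠ 0) :
    bb (resc u q R) = fun y => bb u (q + R • y) := by ext y; simp only [bb, resc_Vol hu hR]

lemma resc_T3 (hu : ContDiff ℝ (⊤ : ℕ∞) u) (hR : R ≠ 0) (k : Fin n) (y : EE n) :
    T3 (resc u q R) k y = R • T3 u k (q + R • y) := by
  ext i j
  rw [T3_eq (resc_smooth hu), Matrix.smul_apply, T3_eq hu]
  simp only [resc_Hess hu hR]
  rw [pd_scale q R k (f := fun y => Hess u y i j) (smooth_diff (Hess_smooth hu i j))]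
  rfl

lemma resc_Lg (hu : ContDiff ℝ (⊤ : ℕ∞) u) (hR : R ≠ 0) {f : EE n → ℝ} (hf : ContDiff ℝ 2 f) (y : EE n) :
    Lg (resc u q R) (fun y => f (q + R • y)) y = R ^ 2 * Lg u f (q + R • y) := by
  unfold Lg
  simp only [Finset.mul_sum]
  refine Finset.sum_congr rfl fun i _ => Finset.sum_congr rfl fun j _ => ?_
  have hd : DifferentiableAt ℝ (fun y => pd j f (q + R • y)) y :=
    (scale_smooth q R (C2.pd1 hf j)).differentiable (by norm_num) y
  rw [resc_gi hu hR, show pd j (fun y => f (q + R • y)) = fun y => R * pd j f (q + R • y) from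
    funext fun y => pd_scale q R j (C2.diff hf) y,
    pd_const_mul _ hd,
    pd_scale q R i (C2.pdd hf j)]
  ring

lemma Good.resc {B c : ℝ} (h : Good B c u) (q : EE n) {R : ℝ} (hR : R ≠ 0) : Good B c (resc u q R) := by
  have hu := h.eqn.hu
  refine ⟨⟨resc_smooth hu, fun x k => ?_, fun x k => ?_⟩, fun x => ?_, fun x => ?_⟩
  · rw [resc_gi hu hR, resc_T3 hu hR, Matrix.mul_smul, trace_smul, h.eqn.e1, smul_zero]
  · rw [resc_gi hu hR, resc_T3 hu hR, resc_Hess hu hR, resc_Vol hu hR, pd_scale q R k (smooth_diff (Vol_smooth hu)),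
      h.eqn.e2, Matrix.mul_smul, trace_smul, smul_eq_mul]
    ring
  · rw [resc_bb hu hR]; exact h.bd _
  · rw [resc_bb hu hR, resc_Lg hu hR ((bb_smooth hu).of_le two_le_top)]
    have := mul_le_mul_of_nonneg_left (h.jac (q + R • x)) (sq_nonneg R)
    refine le_of_eq_of_le ?_ this
    simp only [resc_T3 hu hR, Matrix.smul_apply, smul_eq_mul, mul_pow, ← Finset.mul_sum]
    ring

lemma resc_du0 (hu : ContDiff ℝ (⊤ : ℕ∞) u) (hR : R ≠ 0) (k : Fin n) : pd k (resc u q R) 0 = 0 := by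
  rw [resc_pd hu hR]; simp

end scaling

section ibp
open Matrix MeasureTheory
variable {n : ℕ} {u : EE n → ℝ}

lemma integ_of_compact {f : EE n → ℝ} (hf : Continuous f) {K : Set (EE n)} (hK : IsCompact K)
    (h0 : ∀ x, x ∉ K → f x = 0) : Integrable f :=
  hf.integrable_of_hasCompactSupport (HasCompactSupport.intro hK h0)

lemma pd_zero_out {f : EE n → ℝ} {x : EE n} (hx : x ∉ tsupport f) (i : Fin n) : pd i f x = 0 := by
  simp [pd, fderiv_of_notMem_tsupport ℝ hx]

lemma pd_tsupport {f : EE n → ℝ} (i : Fin n) : tsupport (pd i f) ⊆ tsupport f := by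
  refine closure_minimal (fun x hx => ?_) (isClosed_tsupport f)
  by_contra hcon
  exact hx (pd_zero_out hcon i)

lemma gi_cont (hu : ContDiff ℝ (⊤ : ℕ∞) u) (i j : Fin n) : Continuous fun x => gi u x i j := (gi_smooth hu i j).continuous
lemma Vol_cont (hu : ContDiff ℝ (⊤ : ℕ∞) u) : Continuous (Vol u) := (Vol_smooth hu).continuous

lemma Lg_cont (hu : ContDiff ℝ (⊤ : ℕ∞) u) {f : EE n → ℝ} (hf : ContDiff ℝ 2 f) : Continuous (Lg u f) := by
  unfold Lg
  exact continuous_finsetSum _ fun i _ => continuous_finsetSum _ fun j _ =>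
    (gi_cont hu i j).mul (C2.pdpdc hf i j)

lemma Gam_cont (hu : ContDiff ℝ (⊤ : ℕ∞) u) {f g : EE n → ℝ} (hf : ContDiff ℝ 1 f) (hg : ContDiff ℝ 1 g) :
    Continuous (Gam u f g) := by
  unfold Gam
  exact continuous_finsetSum _ fun i _ => continuous_finsetSum _ fun j _ =>
    ((gi_cont hu i j).mul (C1.pdc hf i)).mul (C1.pdc hg j)

lemma Gam_zero_left {f g : EE n → ℝ} {x : EE n} (hx : x ∉ tsupport f) : Gam u f g x = 0 := by
  unfold Gam
  exact Finset.sum_eq_zero fun i _ => Finset.sum_eq_zero fun j _ => by rw [pd_zero_out hx]; ring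
lemma Gam_zero_right {f g : EE n → ℝ} {x : EE n} (hx : x ∉ tsupport g) : Gam u f g x = 0 := by
  unfold Gam
  exact Finset.sum_eq_zero fun i _ => Finset.sum_eq_zero fun j _ => by rw [pd_zero_out hx]; ring
lemma Lg_zero {f : EE n → ℝ} {x : EE n} (hx : x ∉ tsupport f) : Lg u f x = 0 := by
  unfold Lg
  exact Finset.sum_eq_zero fun i _ => Finset.sum_eq_zero fun j _ => by
    rw [pd_zero_out (fun h => hx (pd_tsupport j h))]; ring

lemma Eqn.ibp (h : Eqn u) {a b : EE n → ℝ} (ha : ContDiff ℝ 1 a) (hb : ContDiff ℝ 2 b)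
    (hc : HasCompactSupport a ∨ HasCompactSupport b) :
    ∫ x, a x * Lg u b x * Vol u x = - ∫ x, Gam u a b x * Vol u x := by
  have hu := h.hu
  set X : Fin n → EE n → ℝ := fun i x => ∑ j, Vol u x * gi u x i j * pd j b x with hX
  have hVg : ∀ i j, ContDiff ℝ (⊤ : ℕ∞) (fun x => Vol u x * gi u x i j) := fun i j =>
    (Vol_smooth hu).mul (gi_smooth hu i j)
  have hXs : ∀ i, ContDiff ℝ 1 (X i) := fun i => ContDiff.sum fun j _ =>
    ((hVg i j).of_le one_le_top').mul (C2.pd1 hb j)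
  have hXd : ∀ i, Differentiable ℝ (X i) := fun i => (hXs i).differentiable (by norm_num)
  have had : Differentiable ℝ a := ha.differentiable (by norm_num)
  have hpX : ∀ i x, pd i (X i) x = ∑ j, (pd i (fun y => Vol u y * gi u y i j) x * pd j b x +
      Vol u x * gi u x i j * pd i (pd j b) x) := by
    intro i x
    simp only [hX]
    have d1 : ∀ j, DifferentiableAt ℝ (fun y => Vol u y * gi u y i j) x := fun j => smooth_diff (hVg i j) x
    rw [pd_sum fun j _ => (d1 j).fun_mul (C2.pdd hb j x)]
    exact Finset.sum_congr rfl fun j _ => pd_mul (d1 j) (C2.pdd hb j x)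
  have hdiv : ∀ x, ∑ i, pd i (X i) x = Lg u b x * Vol u x := by
    intro x
    simp only [hpX, Finset.sum_add_distrib]
    rw [Finset.sum_comm]
    simp only [← Finset.sum_mul, h.div, zero_mul, Finset.sum_const_zero, zero_add]
    unfold Lg
    simp only [Finset.sum_mul]
    exact Finset.sum_congr rfl fun i _ => Finset.sum_congr rfl fun j _ => by ring
  have hGX : ∀ x, ∑ i, pd i a x * X i x = Gam u a b x * Vol u x := by
    intro x
    unfold Gam
    simp only [hX, Finset.sum_mul, Finset.mul_sum]
    exact Finset.sum_congr rfl fun i _ => Finset.sum_congr rfl fun j _ => by ring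
  obtain ⟨K, hK, hout⟩ : ∃ K : Set (EE n), IsCompact K ∧ ∀ x, x ∉ K →
      (a x = 0 ∧ ∀ i, pd i a x = 0) ∨ (∀ i, X i x = 0 ∧ pd i (X i) x = 0) := by
    rcases hc with hc | hc
    · refine ⟨tsupport a, hc, fun x hx => Or.inl ⟨image_eq_zero_of_notMem_tsupport hx, pd_zero_out hx⟩⟩
    · refine ⟨tsupport b, hc, fun x hx => Or.inr fun i => ⟨?_, ?_⟩⟩
      · exact Finset.sum_eq_zero fun j _ => by rw [pd_zero_out hx]; ring
      · rw [hpX]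
        exact Finset.sum_eq_zero fun j _ => by
          rw [pd_zero_out hx, pd_zero_out (fun h => hx (pd_tsupport j h))]; ring
  have i1 : ∀ i, Integrable fun x => pd i a x * X i x := fun i =>
    integ_of_compact ((C1.pdc ha i).mul (hXs i).continuous) hK fun x hx => by
      rcases hout x hx with h | h
      · simp [h.2 i]
      · simp [(h i).1]
  have i2 : ∀ i, Integrable fun x => a x * pd i (X i) x := fun i =>
    integ_of_compact (ha.continuous.mul (C1.pdc (hXs i) i)) hK fun x hx => by
      rcases hout x hx with h | h
      · simp [h.1]
      · simp [(h i).2]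
  have i3 : ∀ i, Integrable fun x => a x * X i x := fun i =>
    integ_of_compact (ha.continuous.mul (hXs i).continuous) hK fun x hx => by
      rcases hout x hx with h | h
      · simp [h.1]
      · simp [(h i).1]
  have key : ∀ i, ∫ x, a x * pd i (X i) x = - ∫ x, pd i a x * X i x := fun i =>
    integral_mul_fderiv_eq_neg_fderiv_mul_of_integrable (i1 i) (i2 i) (i3 i) (fun x _ => had x) (fun x _ => hXd i x)
  calc ∫ x, a x * Lg u b x * Vol u x = ∫ x, ∑ i, a x * pd i (X i) x := by
        refine integral_congr_ae (Filter.Eventually.of_forall fun x => ?_)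
        simp only [← Finset.mul_sum, hdiv]; ring
    _ = ∑ i, ∫ x, a x * pd i (X i) x := integral_finsetSum _ fun i _ => i2 i
    _ = - ∑ i, ∫ x, pd i a x * X i x := by simp only [key, Finset.sum_neg_distrib]
    _ = - ∫ x, ∑ i, pd i a x * X i x := by rw [integral_finsetSum _ fun i _ => i1 i]
    _ = _ := by simp only [hGX]

lemma Eqn.ibp2 (h : Eqn u) {a b : EE n → ℝ} (ha : ContDiff ℝ 2 a) (hb : ContDiff ℝ 2 b)
    (hc : HasCompactSupport a) :
    ∫ x, a x * Lg u b x * Vol u x = ∫ x, b x * Lg u a x * Vol u x := by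
  rw [h.ibp (ha.of_le (by norm_num)) hb (Or.inl hc), h.ibp (hb.of_le (by norm_num)) ha (Or.inr hc)]
  simp only [Gam_symm h.hu]

end ibp

section cutoff

/-- positive part -/
noncomputable def mp (t : ℝ) : ℝ := max t 0

lemma mp_nonneg (t : ℝ) : 0 ≤ mp t := le_max_right _ _
lemma mp_cont : Continuous mp := continuous_id.max continuous_const
lemma mp_of_nonneg {t : ℝ} (h : 0 ≤ t) : mp t = t := max_eq_left h
lemma mp_of_nonpos {t : ℝ} (h : t ≤ 0) : mp t = 0 := max_eq_right h
lemma mp_mul (t : ℝ) : mp t * t = mp t ^ 2 := by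
  rcases le_total 0 t with h | h
  · rw [mp_of_nonneg h]; ring
  · rw [mp_of_nonpos h]; ring
lemma mp_mono {s t : ℝ} (h : s ≤ t) : mp s ≤ mp t := max_le_max_right 0 h
lemma mp_lip (s t : ℝ) : |mp s - mp t| ≤ |s - t| := abs_max_sub_max_le_abs s t 0

lemma mp_sq_deriv (t : ℝ) : HasDerivAt (fun t => mp t ^ 2) (2 * mp t) t := by
  rcases lt_trichotomy t 0 with h | h | h
  · rw [mp_of_nonpos h.le, mul_zero]
    refine (hasDerivAt_const t (0:ℝ)).congr_of_eventuallyEq ?_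
    filter_upwards [eventually_lt_nhds h] with s hs
    rw [mp_of_nonpos hs.le]; norm_num
  · subst h
    rw [mp_of_nonneg le_rfl, mul_zero, hasDerivAt_iff_tendsto_slope_zero]
    have : Filter.Tendsto mp (nhdsWithin 0 {0}ᶜ) (nhds 0) := by
      have := (mp_cont.tendsto 0).mono_left (nhdsWithin_le_nhds (s := {0}ᶜ))
      rwa [mp_of_nonneg le_rfl] at this
    refine this.congr' ?_
    filter_upwards [self_mem_nhdsWithin] with s hs
    have hs' : s ≠ 0 := hs
    rw [zero_add, mp_of_nonneg (le_refl (0:ℝ)), ← mp_mul, smul_eq_mul]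
    field_simp
    ring
  · rw [mp_of_nonneg h.le]
    have := (hasDerivAt_pow 2 t)
    simp only [Nat.cast_ofNat, Nat.add_one_sub_one, pow_one] at this
    refine this.congr_of_eventuallyEq ?_
    filter_upwards [eventually_gt_nhds h] with s hs
    rw [mp_of_nonneg hs.le]

lemma mp_cu_deriv (t : ℝ) : HasDerivAt (fun t => mp t ^ 3) (3 * mp t ^ 2) t := by
  have := (mp_sq_deriv t).mul (hasDerivAt_id t)
  refine (this.congr_deriv ?_).congr_of_eventuallyEq (Filter.Eventually.of_forall fun s => ?_)
  · simp only [id]; rw [mul_assoc, mp_mul]; ring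
  · simp only [Pi.mul_apply, id]; rw [sq, mul_assoc, mp_mul]; ring

/-- cutoff -/
noncomputable def zt (t : ℝ) : ℝ := mp (1 - t) ^ 2
/-- antiderivative of the cutoff -/
noncomputable def ZZ (t : ℝ) : ℝ := mp (1 - t) ^ 3 / 3

lemma zt_deriv (t : ℝ) : HasDerivAt zt (-(2 * mp (1 - t))) t := by
  have := (mp_sq_deriv (1 - t)).comp t ((hasDerivAt_id t).const_sub 1)
  refine this.congr_deriv (by ring)
lemma ZZ_deriv (t : ℝ) : HasDerivAt ZZ (-zt t) t := by
  have := ((mp_cu_deriv (1 - t)).comp t ((hasDerivAt_id t).const_sub 1)).div_const 3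
  refine this.congr_deriv (by unfold zt; ring)
lemma zt_cont : Continuous zt := (mp_cont.comp (continuous_const.sub continuous_id)).pow 2
lemma ZZ_cont : Continuous ZZ := ((mp_cont.comp (continuous_const.sub continuous_id)).pow 3).div_const 3
lemma zt_nonneg (t : ℝ) : 0 ≤ zt t := sq_nonneg _
lemma ZZ_nonneg (t : ℝ) : 0 ≤ ZZ t := div_nonneg (pow_nonneg (mp_nonneg _) 3) (by norm_num)
lemma zt_le_one {t : ℝ} (h : 0 ≤ t) : zt t ≤ 1 := by
  unfold zt
  have : mp (1 - t) ≤ 1 := max_le (by linarith) (by norm_num)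
  have := mp_nonneg (1 - t)
  nlinarith
lemma zt_zero {t : ℝ} (h : 1 ≤ t) : zt t = 0 := by
  unfold zt; rw [mp_of_nonpos (by linarith)]; norm_num
lemma ZZ_zero {t : ℝ} (h : 1 ≤ t) : ZZ t = 0 := by
  unfold ZZ; rw [mp_of_nonpos (by linarith)]; norm_num
lemma zt_lip {s t : ℝ} (hs : 0 ≤ s) (ht : 0 ≤ t) : |zt s - zt t| ≤ 2 * |s - t| := by
  unfold zt
  have h1 : mp (1 - s) ≤ 1 := max_le (by linarith) (by norm_num)
  have h2 : mp (1 - t) ≤ 1 := max_le (by linarith) (by norm_num)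
  have h3 := mp_nonneg (1 - s)
  have h4 := mp_nonneg (1 - t)
  rw [sq_sub_sq, abs_mul, abs_of_nonneg (by linarith)]
  have := mp_lip (1 - s) (1 - t)
  rw [show (1 - s) - (1 - t) = -(s - t) by ring, abs_neg] at this
  have h5 := abs_nonneg (mp (1 - s) - mp (1 - t))
  nlinarith
lemma zt_C1 : ContDiff ℝ 1 zt := by
  rw [contDiff_one_iff_deriv]
  refine ⟨fun t => (zt_deriv t).differentiableAt, ?_⟩
  rw [show deriv zt = fun t => -(2 * mp (1 - t)) from funext fun t => (zt_deriv t).deriv]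
  exact (continuous_const.mul (mp_cont.comp (continuous_const.sub continuous_id))).neg
lemma ZZ_C2 : ContDiff ℝ 2 ZZ := by
  rw [show (2 : WithTop ℕ∞) = 1 + 1 by norm_num, contDiff_succ_iff_deriv]
  refine ⟨fun t => (ZZ_deriv t).differentiableAt, by simp, ?_⟩
  rw [show deriv ZZ = fun t => -zt t from funext fun t => (ZZ_deriv t).deriv]
  exact zt_C1.neg
end cutoff

section r2
open Matrix MeasureTheory
variable {n : ℕ} {u : EE n → ℝ}

/-- squared distance of the gradient graph to the origin -/
noncomputable def r2 (u : EE n → ℝ) : EE n → ℝ := qf u 1 1 (fun _ => 0) (fun _ => 0)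

lemma r2_eq (x : EE n) : r2 u x = ∑ k, (x k ^ 2 + pd k u x ^ 2) := by
  simp [r2, qf]

lemma r2_smooth (hu : ContDiff ℝ (⊤ : ℕ∞) u) : ContDiff ℝ (⊤ : ℕ∞) (r2 u) := qf_smooth hu _ _ _ _

lemma r2_ge (x : EE n) : ‖x‖ ^ 2 ≤ r2 u x := by
  rw [r2_eq, EuclideanSpace.norm_sq_eq]
  refine Finset.sum_le_sum fun k _ => ?_
  simp; positivity

lemma r2_nonneg (x : EE n) : 0 ≤ r2 u x := (sq_nonneg _).trans (r2_ge x)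

lemma Eqn.Lg_r2 (h : Eqn u) (x : EE n) : Lg u (r2 u) x = 2 * n := by
  obtain ⟨Q, l, S⟩ := exists_Spec' h.hu x
  rw [r2, h.Lg_qf, S.tr_gi, S.tr_giHH, mul_one, ← mul_add, ← Finset.sum_add_distrib]
  rw [Finset.sum_congr rfl fun a _ => show (1 + l a ^ 2)⁻¹ + l a ^ 2 * (1 + l a ^ 2)⁻¹ = 1 by
    have : 1 + l a ^ 2 ≠ 0 := by positivity
    field_simp]
  simp

lemma Spec.QH {x : EE n} {Q : Matrix (Fin n) (Fin n) ℝ} {l : Fin n → ℝ} (S : Spec u x Q l) (v : Fin n → ℝ) (a : Fin n) :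
    ∑ i, Q i a * ∑ k, Hess u x i k * v k = l a * ∑ k, Q k a * v k := by
  have h : Qᵀ * Hess u x = diagonal l * Qᵀ := by
    rw [S.h3, ← Matrix.mul_assoc, ← Matrix.mul_assoc, S.h2, Matrix.one_mul]
  have h' : ∀ k, ∑ i, Q i a * Hess u x i k = l a * Q k a := fun k => by
    have := congrFun (congrFun h a) k
    rwa [Matrix.mul_apply, diagonal_mul, transpose_apply] at this
  simp only [Finset.mul_sum]
  rw [Finset.sum_comm]
  refine Finset.sum_congr rfl fun k _ => ?_
  rw [← mul_assoc, ← h' k, Finset.sum_mul]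
  exact Finset.sum_congr rfl fun i _ => by ring

/-- conical defect -/
noncomputable def wd (u : EE n → ℝ) (i : Fin n) (x : EE n) : ℝ := pd i u x - ∑ k, Hess u x i k * x k

/-- monotonicity defect -/
noncomputable def DD (u : EE n → ℝ) (x : EE n) : ℝ := 4 * r2 u x - Gam u (r2 u) (r2 u) x

lemma DD_frame (hu : ContDiff ℝ (⊤ : ℕ∞) u) {x : EE n} {Q : Matrix (Fin n) (Fin n) ℝ} {l : Fin n → ℝ} (S : Spec u x Q l) :
    DD u x = 4 * ∑ a, (1 + l a ^ 2)⁻¹ * ((∑ i, Q i a * wd u i x) * (∑ i, Q i a * wd u i x)) := by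
  have e1 : ∀ a, ∑ i, Q i a * wd u i x = (∑ i, Q i a * pd i u x) - l a * ∑ k, Q k a * x k := fun a => by
    rw [← S.QH]
    simp only [wd, mul_sub, Finset.sum_sub_distrib]
  have e2 : ∀ a, ∑ i, Q i a * pd i (r2 u) x = 2 * ((∑ k, Q k a * x k) + l a * ∑ i, Q i a * pd i u x) := fun a => by
    rw [← S.QH, ← Finset.sum_add_distrib, Finset.mul_sum]
    refine Finset.sum_congr rfl fun i _ => ?_
    rw [r2, pd_qf hu]; simp only [sub_zero]; ring
  have e3 : r2 u x = ∑ a, ((∑ k, Q k a * x k) * (∑ k, Q k a * x k) +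
      (∑ i, Q i a * pd i u x) * (∑ i, Q i a * pd i u x)) := by
    rw [Finset.sum_add_distrib, frame_norm S.h1 (fun k => x k), frame_norm S.h1 (fun k => pd k u x), r2_eq,
      Finset.sum_add_distrib]
  rw [DD, Gam_frame S, e3, Finset.mul_sum, Finset.mul_sum, ← Finset.sum_sub_distrib]
  refine Finset.sum_congr rfl fun a _ => ?_
  rw [e1, e2]
  have : 1 + l a ^ 2 ≠ 0 := by positivity
  field_simp
  ring

lemma DD_nonneg (hu : ContDiff ℝ (⊤ : ℕ∞) u) (x : EE n) : 0 ≤ DD u x := by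
  obtain ⟨Q, l, S⟩ := exists_Spec' hu x
  rw [DD_frame hu S]
  refine mul_nonneg (by norm_num) (Finset.sum_nonneg fun a _ => mul_nonneg (by positivity) (mul_self_nonneg _))

lemma DD_ge (hu : ContDiff ℝ (⊤ : ℕ∞) u) {B : ℝ} (hB : ∀ x, bb u x ≤ B) (x : EE n) :
    4 * ((1 + Real.exp B ^ 2)⁻¹ * ∑ i, wd u i x ^ 2) ≤ DD u x := by
  obtain ⟨Q, l, S⟩ := exists_Spec' hu x
  rw [DD_frame hu S, ← frame_norm S.h1 (fun i => wd u i x), Finset.mul_sum]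
  refine mul_le_mul_of_nonneg_left (Finset.sum_le_sum fun a _ => ?_) (by norm_num)
  refine mul_le_mul_of_nonneg_right ?_ (mul_self_nonneg _)
  have := l_bound hu hB x Q l S a
  gcongr

lemma DD_zero (hu : ContDiff ℝ (⊤ : ℕ∞) u) {x : EE n} (hx : DD u x = 0) (i : Fin n) : wd u i x = 0 := by
  obtain ⟨Q, l, S⟩ := exists_Spec' hu x
  rw [DD_frame hu S] at hx
  have h1 : ∀ a, (∑ i, Q i a * wd u i x) * (∑ i, Q i a * wd u i x) = 0 := by
    have h0 : ∑ a, (1 + l a ^ 2)⁻¹ * ((∑ i, Q i a * wd u i x) * (∑ i, Q i a * wd u i x)) = 0 := by linarith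
    rw [Finset.sum_eq_zero_iff_of_nonneg fun a _ => mul_nonneg (by positivity) (mul_self_nonneg _)] at h0
    intro a
    rcases mul_eq_zero.1 (h0 a (Finset.mem_univ a)) with h | h
    · exact absurd h (by positivity)
    · exact h
  have h2 := frame_norm S.h1 (fun i => wd u i x)
  simp only [h1, Finset.sum_const_zero] at h2
  have := (Finset.sum_eq_zero_iff_of_nonneg fun a _ => sq_nonneg _).1 h2.symm i (Finset.mem_univ i)
  simpa using this

lemma DD_cont (hu : ContDiff ℝ (⊤ : ℕ∞) u) : Continuous (DD u) :=
  (continuous_const.mul (r2_smooth hu).continuous).sub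
    (Gam_cont hu ((r2_smooth hu).of_le one_le_top') ((r2_smooth hu).of_le one_le_top'))

end r2

section mono
open Matrix MeasureTheory
variable {n : ℕ} {u : EE n → ℝ}

/-- weighted integral -/
noncomputable def KK (u f : EE n → ℝ) (τ : ℝ) : ℝ := ∫ x, f x * zt (τ ^ 2 * r2 u x) * Vol u x
/-- normalized weighted integral -/
noncomputable def FF (u f : EE n → ℝ) (τ : ℝ) : ℝ := τ ^ n * KK u f τ
/-- derivative integral -/
noncomputable def I2 (u f : EE n → ℝ) (τ : ℝ) : ℝ := ∫ x, f x * -(2 * mp (1 - τ ^ 2 * r2 u x)) * r2 u x * Vol u x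
/-- defect integral -/
noncomputable def I3 (u f : EE n → ℝ) (τ : ℝ) : ℝ := ∫ x, f x * (2 * mp (1 - τ ^ 2 * r2 u x)) * DD u x * Vol u x
/-- Laplacian integral -/
noncomputable def IL (u f : EE n → ℝ) (τ : ℝ) : ℝ := ∫ x, ZZ (τ ^ 2 * r2 u x) * Lg u f x * Vol u x

lemma out_ball {τ σ : ℝ} (hσ : 0 < σ) (hτ : σ ≤ τ) {x : EE n} (hx : x ∉ Metric.closedBall (0 : EE n) σ⁻¹) :
    1 ≤ τ ^ 2 * r2 u x := by
  have h1 : σ⁻¹ < ‖x‖ := by simpa using hx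
  have h2 := r2_ge (u := u) x
  have h3 : 1 < σ * ‖x‖ := by rwa [inv_lt_iff_one_lt_mul₀' hσ] at h1
  have h4 : σ * ‖x‖ ≤ τ * ‖x‖ := by gcongr
  have h5 : 1 ≤ (τ * ‖x‖) ^ 2 := by nlinarith
  calc 1 ≤ τ ^ 2 * ‖x‖ ^ 2 := by rwa [mul_pow] at h5
    _ ≤ _ := by gcongr

lemma mp_zero_of {t : ℝ} (h : 1 ≤ t) : mp (1 - t) = 0 := mp_of_nonpos (by linarith)

lemma r2_cont (hu : ContDiff ℝ (⊤ : ℕ∞) u) : Continuous (r2 u) := (r2_smooth hu).continuous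

lemma sr2_cont (hu : ContDiff ℝ (⊤ : ℕ∞) u) (τ : ℝ) : Continuous fun x => τ ^ 2 * r2 u x :=
  continuous_const.mul (r2_cont hu)

lemma mpr_cont (hu : ContDiff ℝ (⊤ : ℕ∞) u) (τ : ℝ) : Continuous fun x => mp (1 - τ ^ 2 * r2 u x) :=
  mp_cont.comp (continuous_const.sub (sr2_cont hu τ))

lemma KK_integ (hu : ContDiff ℝ (⊤ : ℕ∞) u) {f : EE n → ℝ} (hf : Continuous f) {τ : ℝ} (hτ : 0 < τ) :
    Integrable fun x => f x * zt (τ ^ 2 * r2 u x) * Vol u x :=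
  integ_of_compact ((hf.mul (zt_cont.comp (sr2_cont hu τ))).mul (Vol_cont hu))
    (isCompact_closedBall (0 : EE n) τ⁻¹) fun x hx => by
      rw [zt_zero (out_ball hτ le_rfl hx)]; ring

lemma I2_integ (hu : ContDiff ℝ (⊤ : ℕ∞) u) {f : EE n → ℝ} (hf : Continuous f) {τ : ℝ} (hτ : 0 < τ) :
    Integrable fun x => f x * -(2 * mp (1 - τ ^ 2 * r2 u x)) * r2 u x * Vol u x :=
  integ_of_compact (((hf.mul (continuous_const.mul (mpr_cont hu τ)).neg).mul (r2_cont hu)).mul (Vol_cont hu))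
    (isCompact_closedBall (0 : EE n) τ⁻¹) fun x hx => by
      rw [mp_zero_of (out_ball hτ le_rfl hx)]; ring

lemma I3_integ (hu : ContDiff ℝ (⊤ : ℕ∞) u) {f : EE n → ℝ} (hf : Continuous f) {τ : ℝ} (hτ : 0 < τ) :
    Integrable fun x => f x * (2 * mp (1 - τ ^ 2 * r2 u x)) * DD u x * Vol u x :=
  integ_of_compact (((hf.mul (continuous_const.mul (mpr_cont hu τ))).mul (DD_cont hu)).mul (Vol_cont hu))
    (isCompact_closedBall (0 : EE n) τ⁻¹) fun x hx => by
      rw [mp_zero_of (out_ball hτ le_rfl hx)]; ring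

lemma IL_integ (hu : ContDiff ℝ (⊤ : ℕ∞) u) {f : EE n → ℝ} (hf : ContDiff ℝ 2 f) {τ : ℝ} (hτ : 0 < τ) :
    Integrable fun x => ZZ (τ ^ 2 * r2 u x) * Lg u f x * Vol u x :=
  integ_of_compact (((ZZ_cont.comp (sr2_cont hu τ)).mul (Lg_cont hu hf)).mul (Vol_cont hu))
    (isCompact_closedBall (0 : EE n) τ⁻¹) fun x hx => by
      rw [ZZ_zero (out_ball hτ le_rfl hx)]; ring

lemma Eqn.mono_id (h : Eqn u) {f : EE n → ℝ} (hf : ContDiff ℝ 2 f) {τ : ℝ} (hτ : 0 < τ) :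
    IL u f τ = -(2 * n * τ ^ 2) * KK u f τ - 4 * τ ^ 4 * I2 u f τ - τ ^ 4 * I3 u f τ := by
  have hu := h.hu
  have hr : ContDiff ℝ 2 (fun x => τ ^ 2 * r2 u x) := contDiff_const.mul ((r2_smooth hu).of_le two_le_top)
  have hZ : ContDiff ℝ 2 (fun x => ZZ (τ ^ 2 * r2 u x)) := ZZ_C2.comp hr
  have hcs : HasCompactSupport (fun x => ZZ (τ ^ 2 * r2 u x)) :=
    HasCompactSupport.intro (isCompact_closedBall (0 : EE n) τ⁻¹) fun x hx => ZZ_zero (out_ball hτ le_rfl hx)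
  rw [IL, h.ibp2 hZ hf hcs]
  have hL : ∀ x, Lg u (fun x => ZZ (τ ^ 2 * r2 u x)) x =
      -(2 * n * τ ^ 2) * zt (τ ^ 2 * r2 u x) - 4 * τ ^ 4 * (-(2 * mp (1 - τ ^ 2 * r2 u x)) * r2 u x)
        - τ ^ 4 * ((2 * mp (1 - τ ^ 2 * r2 u x)) * DD u x) := by
    intro x
    have d1 : ∀ t, HasDerivAt (fun t => ZZ (τ ^ 2 * t)) (-zt (τ ^ 2 * t) * τ ^ 2) t := fun t => by
      have := (ZZ_deriv (τ ^ 2 * t)).comp t ((hasDerivAt_id t).const_mul (τ ^ 2))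
      rwa [mul_one] at this
    have d2 : ∀ t, HasDerivAt (fun t => -zt (τ ^ 2 * t) * τ ^ 2) (2 * mp (1 - τ ^ 2 * t) * τ ^ 4) t := fun t => by
      have := (((zt_deriv (τ ^ 2 * t)).comp t ((hasDerivAt_id t).const_mul (τ ^ 2))).neg).mul_const (τ ^ 2)
      exact this.congr_deriv (by ring)
    rw [Lg_comp ((r2_smooth hu).of_le two_le_top) (h := fun t => ZZ (τ ^ 2 * t)) (h' := fun t => -zt (τ ^ 2 * t) * τ ^ 2)
      (h'' := fun t => 2 * mp (1 - τ ^ 2 * t) * τ ^ 4) (fun y => d1 _) (fun y => d2 _) x,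
      h.Lg_r2, show Gam u (r2 u) (r2 u) x = 4 * r2 u x - DD u x by rw [DD]; ring]
    ring
  simp only [hL]
  rw [KK, I2, I3, ← integral_const_mul, ← integral_const_mul, ← integral_const_mul, ← integral_sub, ← integral_sub]
  · refine integral_congr_ae (Filter.Eventually.of_forall fun x => ?_)
    simp only []
    ring
  · exact ((KK_integ hu hf.continuous hτ).const_mul _).sub ((I2_integ hu hf.continuous hτ).const_mul _)
  · exact (I3_integ hu hf.continuous hτ).const_mul _
  · exact (KK_integ hu hf.continuous hτ).const_mul _
  · exact (I2_integ hu hf.continuous hτ).const_mul _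

lemma KK_deriv (hu : ContDiff ℝ (⊤ : ℕ∞) u) {f : EE n → ℝ} (hf : Continuous f) {τ : ℝ} (hτ : 0 < τ) :
    HasDerivAt (KK u f) (2 * τ * I2 u f τ) τ := by
  set K := Metric.closedBall (0 : EE n) (τ / 2)⁻¹ with hK
  have hKc : IsCompact K := isCompact_closedBall _ _
  set G : EE n → ℝ := fun x => |f x| * (2 * 1 * (2 * (2 * τ) * r2 u x)) * Vol u x with hG
  have hGc : Continuous G := (hf.abs.mul (continuous_const.mul (continuous_const.mul (r2_cont hu)))).mul (Vol_cont hu)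
  have hs : Metric.ball τ (τ / 2) ∈ nhds τ := Metric.ball_mem_nhds _ (by linarith)
  have hbd : ∀ σ ∈ Metric.ball τ (τ / 2), τ / 2 ≤ σ ∧ σ ≤ 2 * τ := fun σ hσ => by
    rw [Metric.mem_ball, Real.dist_eq, abs_lt] at hσ
    constructor <;> linarith [hσ.1, hσ.2]
  have hcont : ∀ σ, Continuous fun x => f x * zt (σ ^ 2 * r2 u x) * Vol u x := fun σ =>
    (hf.mul (zt_cont.comp (sr2_cont hu σ))).mul (Vol_cont hu)
  have key := hasDerivAt_integral_of_dominated_loc_of_deriv_le (μ := volume) (x₀ := τ)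
    (s := Metric.ball τ (τ / 2))
    (F := fun σ x => f x * zt (σ ^ 2 * r2 u x) * Vol u x)
    (F' := fun σ x => f x * (-(2 * mp (1 - σ ^ 2 * r2 u x)) * (2 * σ * r2 u x)) * Vol u x)
    (bound := K.indicator G) hs
    (Filter.Eventually.of_forall fun σ => (hcont σ).aestronglyMeasurable) (KK_integ hu hf hτ)
    ((hf.mul ((continuous_const.mul (mpr_cont hu τ)).neg.mul (continuous_const.mul (r2_cont hu)))).mul (Vol_cont hu)).aestronglyMeasurable
    ?_ ?_ ?_
  · refine key.2.congr_deriv ?_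
    rw [I2, ← integral_const_mul]
    refine integral_congr_ae (Filter.Eventually.of_forall fun x => ?_)
    simp only []
    ring
  · refine Filter.Eventually.of_forall fun x σ hσ => ?_
    obtain ⟨h1, h2⟩ := hbd σ hσ
    by_cases hx : x ∈ K
    · rw [Set.indicator_of_mem hx, Real.norm_eq_abs]
      have hm : mp (1 - σ ^ 2 * r2 u x) ≤ 1 := by
        have : 0 ≤ σ ^ 2 * r2 u x := mul_nonneg (sq_nonneg _) (r2_nonneg x)
        exact max_le (by linarith) (by norm_num)
      have hm0 := mp_nonneg (1 - σ ^ 2 * r2 u x)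
      have hr := r2_nonneg (u := u) x
      have hV := (Vol_pos hu x).le
      have hσ0 : 0 ≤ σ := by linarith
      simp only [hG]
      rw [abs_mul, abs_mul, abs_mul, abs_of_nonneg hV, abs_neg, abs_of_nonneg (by positivity : 0 ≤ 2 * mp (1 - σ ^ 2 * r2 u x)),
        abs_of_nonneg (by positivity : 0 ≤ 2 * σ * r2 u x)]
      gcongr
    · rw [mp_zero_of (out_ball (by linarith) h1 hx)]
      simp [Set.indicator_of_notMem hx]
  · exact (integrable_indicator_iff hKc.measurableSet).2 (hGc.continuousOn.integrableOn_compact hKc)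
  · refine Filter.Eventually.of_forall fun x σ hσ => ?_
    have h1 : HasDerivAt (fun σ : ℝ => σ ^ 2 * r2 u x) (2 * σ * r2 u x) σ := by
      have := (hasDerivAt_pow 2 σ).mul_const (r2 u x)
      simpa using this
    have h2 := (((zt_deriv (σ ^ 2 * r2 u x)).comp σ h1).const_mul (f x)).mul_const (Vol u x)
    exact h2

lemma Eqn.FF_deriv (h : Eqn u) (hn : 1 ≤ n) {f : EE n → ℝ} (hf : ContDiff ℝ 2 f) {τ : ℝ} (hτ : 0 < τ) :
    HasDerivAt (FF u f) (-(τ ^ (n - 1) * ((2 * τ ^ 2)⁻¹ * (IL u f τ + τ ^ 4 * I3 u f τ)))) τ := by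
  have := (hasDerivAt_pow n τ).mul (KK_deriv h.hu hf.continuous hτ)
  refine this.congr_deriv ?_
  rw [h.mono_id hf hτ]
  obtain ⟨m, rfl⟩ : ∃ m, n = m + 1 := ⟨n - 1, by omega⟩
  simp only [Nat.add_sub_cancel, pow_succ τ m]
  field_simp
  ring

lemma I3_nonneg (hu : ContDiff ℝ (⊤ : ℕ∞) u) {f : EE n → ℝ} (hf : ∀ x, 0 ≤ f x) (τ : ℝ) : 0 ≤ I3 u f τ :=
  integral_nonneg fun x => mul_nonneg (mul_nonneg (mul_nonneg (hf x) (mul_nonneg (by norm_num) (mp_nonneg _))) (DD_nonneg hu x))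
    (Vol_pos hu x).le

lemma IL_nonneg (hu : ContDiff ℝ (⊤ : ℕ∞) u) {f : EE n → ℝ} (hf : ∀ x, 0 ≤ Lg u f x) (τ : ℝ) : 0 ≤ IL u f τ :=
  integral_nonneg fun x => mul_nonneg (mul_nonneg (ZZ_nonneg _) (hf x)) (Vol_pos hu x).le

lemma Eqn.FF_anti (h : Eqn u) (hn : 1 ≤ n) {f : EE n → ℝ} (hf : ContDiff ℝ 2 f) (hf0 : ∀ x, 0 ≤ f x)
    (hL : ∀ x, 0 ≤ Lg u f x) : AntitoneOn (FF u f) (Set.Ioi 0) := by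
  refine antitoneOn_of_deriv_nonpos (convex_Ioi 0) ?_ ?_ ?_
  · exact fun τ hτ => (h.FF_deriv hn hf hτ).continuousAt.continuousWithinAt
  · rw [interior_Ioi]; exact fun τ hτ => (h.FF_deriv hn hf hτ).differentiableAt.differentiableWithinAt
  · rw [interior_Ioi]
    intro τ hτ
    have hτ' : 0 < τ := hτ
    rw [(h.FF_deriv hn hf hτ).deriv]
    have h1 := I3_nonneg h.hu hf0 τ
    have h2 := IL_nonneg h.hu hL τ
    exact neg_nonpos.2 (by positivity)

/-- the drop of the monotone quantity controls the Laplacian and the defect -/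
lemma Eqn.FF_drop (h : Eqn u) (hn : 1 ≤ n) {f : EE n → ℝ} (hf : ContDiff ℝ 2 f) (hf0 : ∀ x, 0 ≤ f x)
    (hL : ∀ x, 0 ≤ Lg u f x) :
    (1 / 2) ^ (n + 5) * (IL u f 1 + I3 u f 1) ≤ FF u f (1 / 2) - FF u f 1 := by
  have hu := h.hu
  obtain ⟨τ, hτ, e⟩ := exists_hasDerivAt_eq_slope (FF u f)
    (fun τ => -(τ ^ (n - 1) * ((2 * τ ^ 2)⁻¹ * (IL u f τ + τ ^ 4 * I3 u f τ)))) (show (1/2:ℝ) < 1 by norm_num)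
    (fun τ hτ => (h.FF_deriv hn hf (by linarith [hτ.1] : 0 < τ)).continuousAt.continuousWithinAt)
    (fun τ hτ => h.FF_deriv hn hf (by linarith [hτ.1] : 0 < τ))
  obtain ⟨t1, t2⟩ := hτ
  have t0 : 0 < τ := by linarith
  have ht2 : τ ^ 2 ≤ 1 := by nlinarith
  have a1 : IL u f 1 ≤ IL u f τ := by
    refine integral_mono (IL_integ hu hf one_pos) (IL_integ hu hf t0) fun x => ?_
    have hV := (Vol_pos hu x).le
    have := hL x
    have hr := r2_nonneg (u := u) x
    simp only []
    gcongr
    unfold ZZ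
    have : mp (1 - 1 ^ 2 * r2 u x) ≤ mp (1 - τ ^ 2 * r2 u x) := mp_mono (by nlinarith)
    have := mp_nonneg (1 - 1 ^ 2 * r2 u x)
    gcongr
  have a2 : I3 u f 1 ≤ I3 u f τ := by
    refine integral_mono (I3_integ hu hf.continuous one_pos) (I3_integ hu hf.continuous t0) fun x => ?_
    have hV := (Vol_pos hu x).le
    have := hf0 x
    have := DD_nonneg hu x
    have hr := r2_nonneg (u := u) x
    simp only []
    have : mp (1 - 1 ^ 2 * r2 u x) ≤ mp (1 - τ ^ 2 * r2 u x) := mp_mono (by nlinarith)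
    gcongr
  have b1 := IL_nonneg hu hL 1
  have b2 := I3_nonneg hu hf0 1
  have c1 : (1/2:ℝ) ^ (n - 1) ≤ τ ^ (n - 1) := by gcongr
  have c2 : (1/2:ℝ) ≤ (2 * τ ^ 2)⁻¹ := by
    rw [one_div]; gcongr; linarith
  have c3 : (1/2:ℝ) ^ 4 ≤ τ ^ 4 := by gcongr
  have c4 : (1/2:ℝ) ^ 4 * (IL u f 1 + I3 u f 1) ≤ IL u f τ + τ ^ 4 * I3 u f τ := by
    have : (1/2:ℝ) ^ 4 * I3 u f 1 ≤ τ ^ 4 * I3 u f τ := by gcongr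
    have : (1/2:ℝ) ^ 4 * IL u f 1 ≤ IL u f τ := by linarith
    linarith
  have c5 : (1/2:ℝ) ^ (n - 1) * ((1/2) * ((1/2:ℝ) ^ 4 * (IL u f 1 + I3 u f 1))) ≤
      τ ^ (n - 1) * ((2 * τ ^ 2)⁻¹ * (IL u f τ + τ ^ 4 * I3 u f τ)) := by gcongr
  have e' : FF u f (1 / 2) - FF u f 1 = (1 / 2) * (τ ^ (n - 1) * ((2 * τ ^ 2)⁻¹ * (IL u f τ + τ ^ 4 * I3 u f τ))) := by
    rw [eq_div_iff (by norm_num)] at e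
    linarith
  rw [e']
  obtain ⟨m, rfl⟩ : ∃ m, n = m + 1 := ⟨n - 1, by omega⟩
  simp only [Nat.add_sub_cancel] at c5 ⊢
  have e6 : (1/2:ℝ) ^ (m + 1 + 5) * (IL u f 1 + I3 u f 1) = (1/2) * ((1/2:ℝ) ^ m * ((1/2) * ((1/2:ℝ) ^ 4 * (IL u f 1 + I3 u f 1)))) := by
    ring
  rw [e6]
  gcongr

end mono

section poincare
open MeasureTheory
variable {n : ℕ}

lemma integ_prod_of_cont {X Y : Type*} [TopologicalSpace X] [TopologicalSpace Y]
    [MeasureSpace X] [MeasureSpace Y] [OpensMeasurableSpace X] [OpensMeasurableSpace Y]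
    [SecondCountableTopologyEither X Y]  [T2Space X] [T2Space Y]
    [OpensMeasurableSpace (X × Y)]
    [IsFiniteMeasureOnCompacts (volume : Measure X)] [IsFiniteMeasureOnCompacts (volume : Measure Y)]
    [SigmaFinite (volume : Measure X)] [SigmaFinite (volume : Measure Y)]
    {K : Set X} {L : Set Y} (hK : IsCompact K) (hL : IsCompact L) {F : X × Y → ℝ} (hF : Continuous F) :
    Integrable F ((volume.restrict K).prod (volume.restrict L)) := by
  rw [Measure.prod_restrict]
  exact hF.continuousOn.integrableOn_compact (hK.prod hL)

lemma contract_integral {ρ : ℝ} {G : EE n → ℝ} (hG : Continuous G) (hG0 : ∀ x, 0 ≤ G x)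
    {y : EE n} (hy : y ∈ Metric.closedBall (0 : EE n) ρ) {t : ℝ} (ht : t ∈ Set.Icc (0:ℝ) (1/2)) :
    ∫ x in Metric.closedBall (0 : EE n) ρ, G (x + t • (y - x)) ≤ 2 ^ n * ∫ x in Metric.closedBall (0 : EE n) ρ, G x := by
  set K := Metric.closedBall (0 : EE n) ρ with hK
  have hKc : IsCompact K := isCompact_closedBall _ _
  have hKm : MeasurableSet K := hKc.measurableSet
  obtain ⟨t0, t1⟩ := ht
  have h1t : (0:ℝ) < 1 - t := by linarith
  have e : ∀ x, x + t • (y - x) = t • y + (1 - t) • x := fun x => by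
    rw [smul_sub, sub_smul, one_smul]; abel
  have i0 : Integrable (K.indicator G) := (integrable_indicator_iff hKm).2 (hG.continuousOn.integrableOn_compact hKc)
  have i1 : Integrable (fun x => K.indicator G (t • y + (1 - t) • x)) :=
    (i0.comp_add_left (t • y)).comp_smul h1t.ne'
  calc ∫ x in K, G (x + t • (y - x)) = ∫ x, K.indicator (fun x => G (x + t • (y - x))) x := (integral_indicator hKm).symm
    _ ≤ ∫ x, K.indicator G (t • y + (1 - t) • x) := by
        refine integral_mono ?_ i1 fun x => ?_
        · refine (integrable_indicator_iff hKm).2 (ContinuousOn.integrableOn_compact hKc ?_)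
          exact (hG.comp (by fun_prop)).continuousOn
        · by_cases hx : x ∈ K
          · rw [Set.indicator_of_mem hx, e, Set.indicator_of_mem]
            exact convex_closedBall (0 : EE n) ρ hy hx t0 h1t.le (by ring)
          · rw [Set.indicator_of_notMem hx]
            exact Set.indicator_nonneg (fun x _ => hG0 x) _
    _ = ((1 - t) ^ n)⁻¹ * ∫ x, K.indicator G x := by
        have h1 := Measure.integral_comp_smul (volume : Measure (EE n)) (fun x => K.indicator G (t • y + x)) (1 - t)
        rw [integral_add_left_eq_self] at h1
        rw [h1, finrank_euclideanSpace_fin, abs_of_pos (by positivity), smul_eq_mul]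
    _ ≤ 2 ^ n * ∫ x, K.indicator G x := by
        refine mul_le_mul_of_nonneg_right ?_ (integral_nonneg fun x => Set.indicator_nonneg (fun x _ => hG0 x) _)
        rw [← inv_pow]
        refine pow_le_pow_left₀ (by positivity) ?_ n
        rw [inv_le_comm₀ h1t (by norm_num)]
        linarith
    _ = _ := by rw [integral_indicator hKm]

lemma half_poincare {ρ : ℝ} (hρ : 0 ≤ ρ) {f : EE n → ℝ} (hf : ContDiff ℝ 1 f)
    {y : EE n} (hy : y ∈ Metric.closedBall (0 : EE n) ρ) :
    ∫ x in Metric.closedBall (0 : EE n) ρ, |f x - f (x + (1/2:ℝ) • (y - x))| ≤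
      ρ * 2 ^ n * ∫ x in Metric.closedBall (0 : EE n) ρ, ∑ i, |pd i f x| := by
  set K := Metric.closedBall (0 : EE n) ρ with hK
  have hKc : IsCompact K := isCompact_closedBall _ _
  set G : EE n → ℝ := fun x => ∑ i, |pd i f x| with hG
  have hGc : Continuous G := continuous_finsetSum _ fun i _ => (C1.pdc hf i).abs
  have hG0 : ∀ x, 0 ≤ G x := fun x => Finset.sum_nonneg fun i _ => abs_nonneg _
  have hF : Continuous fun p : EE n × ℝ => 2 * ρ * G (p.1 + p.2 • (y - p.1)) :=
    continuous_const.mul (hGc.comp (by fun_prop))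
  have hIntg := integ_prod_of_cont hKc (isCompact_Icc (a := (0:ℝ)) (b := 1/2)) hF
  have pt : ∀ x ∈ K, |f x - f (x + (1/2:ℝ) • (y - x))| ≤ ∫ t in Set.Icc (0:ℝ) (1/2), 2 * ρ * G (x + t • (y - x)) := by
    intro x hx
    have hd := fun t => hasDerivAt_lineV (hf.differentiable (by norm_num)) x (y - x) t
    have hc : Continuous fun t : ℝ => ∑ i, (y - x) i * pd i f (x + t • (y - x)) :=
      continuous_finsetSum _ fun i _ => continuous_const.mul ((C1.pdc hf i).comp (by fun_prop))
    have h1 := intervalIntegral.integral_eq_sub_of_hasDerivAt (fun t _ => hd t) (hc.intervalIntegrable 0 (1/2))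
    simp only [zero_smul, add_zero] at h1
    rw [abs_sub_comm, ← h1, integral_Icc_eq_integral_Ioc, ← intervalIntegral.integral_of_le (by norm_num)]
    refine (intervalIntegral.abs_integral_le_integral_abs (by norm_num)).trans ?_
    refine intervalIntegral.integral_mono_on (by norm_num) (hc.abs.intervalIntegrable _ _)
      (Continuous.intervalIntegrable (hF.comp (by fun_prop : Continuous fun t : ℝ => (x, t))) _ _) fun t _ => ?_
    refine (Finset.abs_sum_le_sum_abs _ _).trans ?_
    rw [hG, Finset.mul_sum]
    refine Finset.sum_le_sum fun i _ => ?_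
    rw [abs_mul]
    refine mul_le_mul_of_nonneg_right ?_ (abs_nonneg _)
    have hx' : ‖x‖ ≤ ρ := by simpa [hK] using hx
    have hy' : ‖y‖ ≤ ρ := by simpa [hK] using hy
    calc |(y - x) i| ≤ ‖y - x‖ := by
          have := PiLp.norm_apply_le (y - x) i; rwa [Real.norm_eq_abs] at this
      _ ≤ ‖y‖ + ‖x‖ := norm_sub_le _ _
      _ ≤ 2 * ρ := by linarith
  calc ∫ x in K, |f x - f (x + (1/2:ℝ) • (y - x))| 
      ≤ ∫ x in K, ∫ t in Set.Icc (0:ℝ) (1/2), 2 * ρ * G (x + t • (y - x)) := by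
        refine setIntegral_mono_on ?_ hIntg.integral_prod_left hKc.measurableSet pt
        refine ContinuousOn.integrableOn_compact hKc (Continuous.continuousOn ?_)
        exact (hf.continuous.sub (hf.continuous.comp (by fun_prop))).abs
    _ = ∫ t in Set.Icc (0:ℝ) (1/2), ∫ x in K, 2 * ρ * G (x + t • (y - x)) := integral_integral_swap hIntg
    _ ≤ ∫ t in Set.Icc (0:ℝ) (1/2), 2 * ρ * (2 ^ n * ∫ x in K, G x) := by
        refine setIntegral_mono_on hIntg.integral_prod_right (integrableOn_const (by simp)) measurableSet_Icc fun t ht => ?_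
        rw [integral_const_mul]
        exact mul_le_mul_of_nonneg_left (contract_integral hGc hG0 hy ht) (by linarith)
    _ = _ := by
        rw [setIntegral_const]
        simp [Measure.real]
        ring

/-- L¹ Poincaré inequality on balls -/
lemma poincare {ρ : ℝ} (hρ : 0 ≤ ρ) {f : EE n → ℝ} (hf : ContDiff ℝ 1 f) :
    ∫ y in Metric.closedBall (0 : EE n) ρ, ∫ x in Metric.closedBall (0 : EE n) ρ, |f x - f y| ≤
      2 * (volume.real (Metric.closedBall (0 : EE n) ρ) * (ρ * 2 ^ n * ∫ x in Metric.closedBall (0 : EE n) ρ, ∑ i, |pd i f x|)) := by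
  set K := Metric.closedBall (0 : EE n) ρ with hK
  have hKc : IsCompact K := isCompact_closedBall _ _
  have hfc := hf.continuous
  have c0 : Continuous fun p : EE n × EE n => |f p.2 - f p.1| := by fun_prop
  have c1 : Continuous fun p : EE n × EE n => |f p.2 - f (p.2 + (1/2:ℝ) • (p.1 - p.2))| := by fun_prop
  have c2 : Continuous fun p : EE n × EE n => |f p.1 - f (p.1 + (1/2:ℝ) • (p.2 - p.1))| := by fun_prop
  have j0 := integ_prod_of_cont hKc hKc c0
  have j1 := integ_prod_of_cont hKc hKc c1
  have j2 := integ_prod_of_cont hKc hKc c2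
  have hh : ∫ y in K, ∫ x in K, |f x - f (x + (1/2:ℝ) • (y - x))| ≤
      volume.real K * (ρ * 2 ^ n * ∫ x in K, ∑ i, |pd i f x|) := by
    calc _ ≤ ∫ y in K, (ρ * 2 ^ n * ∫ x in K, ∑ i, |pd i f x|) :=
          setIntegral_mono_on j1.integral_prod_left
            (integrableOn_const hKc.measure_lt_top.ne) hKc.measurableSet fun y hy => half_poincare hρ hf hy
      _ = _ := by rw [setIntegral_const, smul_eq_mul]
  have e1 : ∫ p, |f p.2 - f p.1| ∂((volume.restrict K).prod (volume.restrict K)) =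
      ∫ y in K, ∫ x in K, |f x - f y| := integral_prod _ j0
  have e2 : ∫ p, |f p.2 - f (p.2 + (1/2:ℝ) • (p.1 - p.2))| ∂((volume.restrict K).prod (volume.restrict K)) =
      ∫ y in K, ∫ x in K, |f x - f (x + (1/2:ℝ) • (y - x))| := integral_prod _ j1
  have e3 : ∫ p, |f p.1 - f (p.1 + (1/2:ℝ) • (p.2 - p.1))| ∂((volume.restrict K).prod (volume.restrict K)) =
      ∫ y in K, ∫ x in K, |f x - f (x + (1/2:ℝ) • (y - x))| := by
    rw [integral_prod_symm _ j2]
  rw [← e1]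
  calc _ ≤ ∫ p, (|f p.2 - f (p.2 + (1/2:ℝ) • (p.1 - p.2))| + |f p.1 - f (p.1 + (1/2:ℝ) • (p.2 - p.1))|)
        ∂((volume.restrict K).prod (volume.restrict K)) := by
        refine integral_mono j0 (j1.add j2) fun p => ?_
        have : p.2 + (1/2:ℝ) • (p.1 - p.2) = p.1 + (1/2:ℝ) • (p.2 - p.1) := by
          module
        simp only [this, Pi.add_apply]
        rw [abs_sub_comm (f p.1)]
        exact abs_sub_le _ _ _
    _ ≤ _ := by
        rw [integral_add j1 j2, e2, e3]
        linarith

end poincare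

section cov
open Matrix MeasureTheory
variable {n : ℕ} {u : EE n → ℝ}

/-- the flat model quadratic form -/
noncomputable def qz (u : EE n → ℝ) (z x : EE n) : ℝ := ∑ k, (x k ^ 2 + (∑ j, Hess u z k j * x j) ^ 2)

/-- the model constant -/
noncomputable def C0 (n : ℕ) : ℝ := ∫ y : EE n, zt (‖y‖ ^ 2)

lemma qz_ge (z x : EE n) : ‖x‖ ^ 2 ≤ qz u z x := by
  rw [qz, EuclideanSpace.norm_sq_eq]
  refine Finset.sum_le_sum fun k _ => ?_
  simp; positivity

lemma qz_nonneg (z x : EE n) : 0 ≤ qz u z x := (sq_nonneg _).trans (qz_ge z x)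

lemma qz_cont (z : EE n) : Continuous (qz u z) := by
  unfold qz
  have h : ∀ k : Fin n, Continuous fun x : EE n => x k := fun k => (coord_smooth k).continuous
  exact continuous_finsetSum _ fun k _ => ((h k).pow 2).add
    ((continuous_finsetSum _ fun j _ => continuous_const.mul (h j)).pow 2)

lemma cov (hu : ContDiff ℝ (⊤ : ℕ∞) u) (z : EE n) {τ : ℝ} (hτ : 0 < τ) :
    τ ^ n * ∫ x, zt (τ ^ 2 * qz u z x) * Vol u z = C0 n := by
  obtain ⟨Q, l, S⟩ := exists_Spec' hu z
  set D : Fin n → ℝ := fun a => τ * Real.sqrt (1 + l a ^ 2) with hD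
  set T : Matrix (Fin n) (Fin n) ℝ := diagonal D * Qᵀ with hT
  set L := toEuclideanLin T with hL
  have hV : Vol u z = ∏ a, Real.sqrt (1 + l a ^ 2) := by
    rw [Vol, S.det_eq, Real.sqrt_prod _ fun i _ => by positivity]
  have hdQ : |Q.det| = 1 := by
    have := congrArg det S.h1
    rw [det_mul, det_transpose, det_one] at this
    rcases mul_self_eq_one_iff.1 this with h | h <;> rw [h] <;> norm_num
  have hVp := Vol_pos hu z
  have hdet : |LinearMap.det L| = τ ^ n * Vol u z := by
    rw [hL, toEuclideanLin_eq_toLin, LinearMap.det_toLin, hT, det_mul, det_transpose, det_diagonal, abs_mul, hdQ, mul_one,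
      hD, Finset.prod_mul_distrib, ← hV]
    simp only [Finset.prod_const, Finset.card_univ, Fintype.card_fin]
    exact abs_of_pos (by positivity)
  have hdet0 : LinearMap.det L ≠ 0 := by
    intro h; rw [h, abs_zero] at hdet
    have : 0 < τ ^ n * Vol u z := by positivity
    linarith
  have hn : ∀ x, ‖L x‖ ^ 2 = τ ^ 2 * qz u z x := by
    intro x
    have hLx : ∀ a, (L x) a = D a * ∑ i, Q i a * x i := fun a => by
      rw [hL, ofLp_toEuclideanLin_apply, hT, ← mulVec_mulVec, mulVec_diagonal]
      simp [mulVec, dotProduct]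
    rw [EuclideanSpace.norm_sq_eq, qz, Finset.sum_add_distrib, ← frame_norm S.h1 (fun k => x k),
      ← frame_norm S.h1 (fun k => ∑ j, Hess u z k j * x j), ← Finset.sum_add_distrib, Finset.mul_sum]
    refine Finset.sum_congr rfl fun a _ => ?_
    rw [S.QH, hLx, Real.norm_eq_abs, sq_abs, hD, mul_pow, mul_pow, Real.sq_sqrt (by positivity)]
    ring
  have hm := Measure.map_linearMap_addHaar_eq_smul_addHaar (volume : Measure (EE n)) hdet0
  have hLc : Continuous L := L.continuous_of_finiteDimensional
  have hzc : Continuous fun y : EE n => zt (‖y‖ ^ 2) := zt_cont.comp (by fun_prop)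
  have h1 : ∫ x, zt (τ ^ 2 * qz u z x) = (τ ^ n * Vol u z)⁻¹ * C0 n := by
    simp only [← hn]
    rw [← integral_map (φ := L) (f := fun y : EE n => zt (‖y‖ ^ 2)) hLc.aemeasurable hzc.aestronglyMeasurable, hm,
      integral_smul_measure, ENNReal.toReal_ofReal (abs_nonneg _), abs_inv, hdet, smul_eq_mul, C0]
  rw [integral_mul_const, h1]
  field_simp

/-! scaling at the origin -/
lemma resc_r2 (hu : ContDiff ℝ (⊤ : ℕ∞) u) (h0 : ∀ k, pd k u 0 = 0) {R : ℝ} (hR : R ≠ 0) (y : EE n) :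
    r2 (resc u 0 R) y = (R ^ 2)⁻¹ * r2 u (R • y) := by
  rw [r2_eq, r2_eq, Finset.mul_sum]
  refine Finset.sum_congr rfl fun k _ => ?_
  rw [resc_pd hu hR, h0, zero_add]
  simp
  field_simp

lemma FF_resc (hu : ContDiff ℝ (⊤ : ℕ∞) u) (h0 : ∀ k, pd k u 0 = 0) (f : EE n → ℝ) {R : ℝ} (hR : 0 < R) (τ : ℝ) :
    FF (resc u 0 R) (fun y => f (R • y)) τ = FF u f (τ / R) := by
  unfold FF KK
  have e : ∀ y, f (R • y) * zt (τ ^ 2 * r2 (resc u 0 R) y) * Vol (resc u 0 R) y =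
      (fun x => f x * zt ((τ / R) ^ 2 * r2 u x) * Vol u x) (R • y) := fun y => by
    rw [resc_r2 hu h0 hR.ne', resc_Vol hu hR.ne']
    simp only [zero_add, div_pow]
    rw [← mul_assoc]; rfl
  rw [integral_congr_ae (Filter.Eventually.of_forall e),
    Measure.integral_comp_smul volume (fun x => f x * zt ((τ / R) ^ 2 * r2 u x) * Vol u x), finrank_euclideanSpace_fin, abs_of_pos (by positivity), smul_eq_mul, ← mul_assoc, div_pow τ R n]
  rfl

lemma FF_le (hu : ContDiff ℝ (⊤ : ℕ∞) u) {B M : ℝ} (hB : ∀ x, bb u x ≤ B) {f : EE n → ℝ} (hf : Continuous f)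
    (hf0 : ∀ x, 0 ≤ f x) (hfM : ∀ x, f x ≤ M) :
    FF u f 1 ≤ volume.real (Metric.closedBall (0 : EE n) 1) * (M * Real.exp B) := by
  set K := Metric.closedBall (0 : EE n) 1 with hK
  have hKc : IsCompact K := isCompact_closedBall _ _
  have hz : ∀ x, x ∉ K → f x * zt (1 ^ 2 * r2 u x) * Vol u x = 0 := fun x hx => by
    rw [zt_zero (out_ball one_pos le_rfl (by simpa [hK] using hx))]; ring
  rw [FF, KK, one_pow, one_mul, ← setIntegral_eq_integral_of_forall_compl_eq_zero hz]
  calc _ ≤ ∫ x in K, M * Real.exp B := by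
        refine integral_mono ?_ (integrableOn_const hKc.measure_lt_top.ne) fun x => ?_
        · exact (KK_integ hu hf one_pos).integrableOn
        · have h1 := Vol_le hu hB x
          have h2 := zt_le_one (t := 1 ^ 2 * r2 u x) (by have := r2_nonneg (u := u) x; positivity)
          have h3 := zt_nonneg (1 ^ 2 * r2 u x)
          have := hf0 x
          have hV := (Vol_pos hu x).le
          have hM := (hf0 x).trans (hfM x)
          calc f x * zt (1 ^ 2 * r2 u x) * Vol u x ≤ M * 1 * Real.exp B := by
                gcongr
                exact hfM x
            _ = _ := by ring
    _ = _ := by rw [setIntegral_const, smul_eq_mul]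

/-- density at the origin -/
lemma FF_lim (hu : ContDiff ℝ (⊤ : ℕ∞) u) (h0 : ∀ k, pd k u 0 = 0) {B : ℝ} (hB : ∀ x, bb u x ≤ B) :
    Filter.Tendsto (fun k : ℕ => FF u (fun _ => 1) (2 ^ k)) Filter.atTop (nhds (C0 n)) := by
  set R : ℕ → ℝ := fun k => (1 / 2) ^ k with hR
  have hRp : ∀ k, 0 < R k := fun k => by positivity
  have hR0 : Filter.Tendsto R Filter.atTop (nhds 0) :=
    tendsto_pow_atTop_nhds_zero_of_lt_one (by norm_num) (by norm_num)
  have e : ∀ k : ℕ, FF u (fun _ => 1) (2 ^ k) =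
      ∫ y, zt (r2 (resc u 0 (R k)) y) * Vol u (R k • y) := fun k => by
    have := FF_resc hu h0 (fun _ => 1) (hRp k) 1
    rw [show (1:ℝ) / R k = 2 ^ k by simp [hR]] at this
    rw [← this, FF, KK]
    simp only [one_pow, one_mul, resc_Vol hu (hRp k).ne', zero_add]
  simp only [e]
  rw [← cov hu 0 one_pos]
  simp only [one_pow, one_mul]
  set K := Metric.closedBall (0 : EE n) 1 with hK
  have hKc : IsCompact K := isCompact_closedBall _ _
  refine tendsto_integral_of_dominated_convergence (K.indicator fun _ => Real.exp B) ?_ ?_ ?_ ?_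
  · intro k
    exact ((zt_cont.comp (r2_cont (resc_smooth hu))).mul ((Vol_cont hu).comp (by fun_prop))).aestronglyMeasurable
  · exact (integrable_indicator_iff hKc.measurableSet).2 (integrableOn_const hKc.measure_lt_top.ne)
  · intro k
    refine Filter.Eventually.of_forall fun y => ?_
    by_cases hy : y ∈ K
    · rw [Set.indicator_of_mem hy, Real.norm_eq_abs, abs_mul, abs_of_nonneg (zt_nonneg _), abs_of_pos (Vol_pos hu _)]
      calc _ ≤ 1 * Real.exp B := by
            have := (Vol_pos hu (R k • y)).le
            gcongr
            · exact zt_le_one (r2_nonneg _)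
            · exact Vol_le hu hB _
        _ = _ := one_mul _
    · have := out_ball (u := resc u 0 (R k)) one_pos le_rfl (x := y) (by simpa [hK] using hy)
      rw [one_pow, one_mul] at this
      rw [zt_zero this]; simp [Set.indicator_of_notMem hy]
  · refine Filter.Eventually.of_forall fun y => ?_
    have hV : Filter.Tendsto (fun k => Vol u (R k • y)) Filter.atTop (nhds (Vol u 0)) := by
      have : Filter.Tendsto (fun k => R k • y) Filter.atTop (nhds 0) := by
        simpa using hR0.smul_const y
      exact ((Vol_cont hu).tendsto 0).comp this
    refine Filter.Tendsto.mul ((zt_cont.tendsto _).comp ?_) hV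
    simp only [r2_eq, qz]
    refine tendsto_finsetSum _ fun i _ => Filter.Tendsto.const_add _ (Filter.Tendsto.pow ?_ 2)
    have hd := hasDerivAt_lineV (f := pd i u) (smooth_diff (pd_smooth hu)) 0 y 0
    rw [hasDerivAt_iff_tendsto_slope_zero] at hd
    have hR0' : Filter.Tendsto R Filter.atTop (nhdsWithin 0 {0}ᶜ) :=
      tendsto_nhdsWithin_iff.2 ⟨hR0, Filter.Eventually.of_forall fun k => (hRp k).ne'⟩
    have := hd.comp hR0'
    refine (this.congr fun k => ?_).trans (by
      rw [show (∑ j, Hess u 0 i j * y j) = ∑ j, y j * pd j (pd i u) (0 + (0:ℝ) • y) from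
        Finset.sum_congr rfl fun j _ => by
          rw [zero_smul, add_zero, ← Hess_apply hu, ← congrFun (congrFun (Hess_symm hu 0) i) j, transpose_apply]; ring])
    simp only [Function.comp]
    rw [resc_pd hu (hRp k).ne']
    simp

end cov

section dpart
open Matrix MeasureTheory
variable {n : ℕ} {u : EE n → ℝ}

lemma coord_le (x : EE n) (i : Fin n) : |x i| ≤ ‖x‖ := by
  have := PiLp.norm_apply_le x i; rwa [Real.norm_eq_abs] at this

lemma du_lip (hu : ContDiff ℝ (⊤ : ℕ∞) u) (h0 : ∀ k, pd k u 0 = 0) {B : ℝ} (hB : ∀ x, bb u x ≤ B) (i : Fin n) (x : EE n) :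
    |pd i u x| ≤ n * Real.exp B * ‖x‖ := by
  have hd := fun t : ℝ => hasDerivAt_lineV (f := pd i u) (smooth_diff (pd_smooth hu)) 0 x t
  have := norm_image_sub_le_of_norm_deriv_le_segment_01' (C := n * Real.exp B * ‖x‖)
    (fun t _ => (hd t).hasDerivWithinAt) (fun t _ => by
      rw [Real.norm_eq_abs]
      calc _ ≤ ∑ j, |x j * pd j (pd i u) (0 + t • x)| := Finset.abs_sum_le_sum_abs _ _
        _ ≤ ∑ j : Fin n, ‖x‖ * Real.exp B := Finset.sum_le_sum fun j _ => by
            rw [abs_mul, ← Hess_apply hu]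
            exact mul_le_mul (coord_le x j) (Hess_entry hu hB _ _ _) (abs_nonneg _) (norm_nonneg _)
        _ = _ := by simp; ring)
  simpa [h0] using this

/-- Lipschitz constant for r2 -/
noncomputable def LL (n : ℕ) (B : ℝ) : ℝ := n * (n * Real.exp B) ^ 2

/-- radius -/
noncomputable def rho (n : ℕ) (B : ℝ) : ℝ := (2 * (1 + LL n B))⁻¹

lemma LL_nonneg (n : ℕ) (B : ℝ) : 0 ≤ LL n B := by unfold LL; positivity
lemma rho_pos (n : ℕ) (B : ℝ) : 0 < rho n B := by unfold rho; have := LL_nonneg n B; positivity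
lemma rho_le (n : ℕ) (B : ℝ) : rho n B ≤ 1 := by
  unfold rho; have := LL_nonneg n B
  exact inv_le_one_of_one_le₀ (by linarith)

lemma r2_le (hu : ContDiff ℝ (⊤ : ℕ∞) u) (h0 : ∀ k, pd k u 0 = 0) {B : ℝ} (hB : ∀ x, bb u x ≤ B) (x : EE n) :
    r2 u x ≤ (1 + LL n B) * ‖x‖ ^ 2 := by
  rw [r2_eq, Finset.sum_add_distrib, add_mul, one_mul, EuclideanSpace.norm_sq_eq]
  simp only [Real.norm_eq_abs, sq_abs]
  gcongr
  calc _ ≤ ∑ k : Fin n, (n * Real.exp B * ‖x‖) ^ 2 := Finset.sum_le_sum fun k _ => by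
        rw [← sq_abs]
        have := du_lip hu h0 hB k x
        gcongr
    _ = _ := by
        simp only [Finset.sum_const, Finset.card_univ, Fintype.card_fin, nsmul_eq_mul, LL]
        rw [mul_pow _ ‖x‖, EuclideanSpace.norm_sq_eq]
        simp only [Real.norm_eq_abs, sq_abs]; ring

lemma r2_half (hu : ContDiff ℝ (⊤ : ℕ∞) u) (h0 : ∀ k, pd k u 0 = 0) {B : ℝ} (hB : ∀ x, bb u x ≤ B) {x : EE n}
    (hx : x ∈ Metric.closedBall (0 : EE n) (rho n B)) : r2 u x ≤ 1 / 2 := by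
  have h1 := r2_le hu h0 hB x
  have h2 : ‖x‖ ≤ rho n B := by simpa using hx
  have h3 := LL_nonneg n B
  have h4 := rho_le n B
  have h5 := rho_pos n B
  have h6 : (1 + LL n B) * rho n B = 1 / 2 := by unfold rho; field_simp
  calc r2 u x ≤ (1 + LL n B) * ‖x‖ ^ 2 := h1
    _ ≤ (1 + LL n B) * (rho n B * 1) := by
        rw [sq]
        gcongr
        linarith
    _ = 1 / 2 := by rw [mul_one, h6]

/-- third order energy density plus conical defect -/
noncomputable def En (u : EE n → ℝ) (x : EE n) : ℝ := (∑ k, ∑ i, ∑ j, T3 u k x i j ^ 2) + ∑ i, wd u i x ^ 2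
/-- first order version -/
noncomputable def En1 (u : EE n → ℝ) (x : EE n) : ℝ := (∑ k, ∑ i, ∑ j, |T3 u k x i j|) + ∑ i, |wd u i x|

lemma wd_cont (hu : ContDiff ℝ (⊤ : ℕ∞) u) (i : Fin n) : Continuous (wd u i) := by
  unfold wd
  exact (pd_smooth hu).continuous.sub (continuous_finsetSum _ fun k _ =>
    (Hess_smooth hu i k).continuous.mul (coord_smooth k).continuous)

lemma En_cont (hu : ContDiff ℝ (⊤ : ℕ∞) u) : Continuous (En u) := by
  unfold En
  exact (continuous_finsetSum _ fun k _ => continuous_finsetSum _ fun i _ => continuous_finsetSum _ fun j _ =>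
    (T3_smooth hu k i j).continuous.pow 2).add (continuous_finsetSum _ fun i _ => (wd_cont hu i).pow 2)
lemma A3_cont (hu : ContDiff ℝ (⊤ : ℕ∞) u) : Continuous fun x => ∑ k, ∑ i, ∑ j, |T3 u k x i j| :=
  continuous_finsetSum _ fun k _ => continuous_finsetSum _ fun i _ => continuous_finsetSum _ fun j _ =>
    (T3_smooth hu k i j).continuous.abs
lemma W1_cont (hu : ContDiff ℝ (⊤ : ℕ∞) u) : Continuous fun x => ∑ i, |wd u i x| :=
  continuous_finsetSum _ fun i _ => (wd_cont hu i).abs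
lemma En1_cont (hu : ContDiff ℝ (⊤ : ℕ∞) u) : Continuous (En1 u) := (A3_cont hu).add (W1_cont hu)

lemma En1_le (x : EE n) {t : ℝ} (ht : 0 < t) : En1 u x ≤ t * (n * n * n + n) + t⁻¹ * En u x := by
  have h : ∀ a : ℝ, |a| ≤ t + t⁻¹ * a ^ 2 := fun a => by
    rw [← sq_abs a, ← sub_nonneg]
    have : t + t⁻¹ * |a| ^ 2 - |a| = t⁻¹ * ((t - |a| / 2) ^ 2 + 3 / 4 * |a| ^ 2) := by
      field_simp; ring
    rw [this]; positivity
  have h1 : ∑ k, ∑ i, ∑ j, |T3 u k x i j| ≤ ∑ k : Fin n, ∑ i : Fin n, ∑ j : Fin n, (t + t⁻¹ * T3 u k x i j ^ 2) :=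
    Finset.sum_le_sum fun k _ => Finset.sum_le_sum fun i _ => Finset.sum_le_sum fun j _ => h _
  have h2 : ∑ i, |wd u i x| ≤ ∑ i : Fin n, (t + t⁻¹ * wd u i x ^ 2) := Finset.sum_le_sum fun i _ => h _
  simp only [Finset.sum_add_distrib, ← Finset.mul_sum, Finset.sum_const, Finset.card_univ, Fintype.card_fin, nsmul_eq_mul] at h1 h2
  unfold En1 En
  linarith

lemma f_props {B c : ℝ} (hc : 0 ≤ c) (h : Good B c u) : ContDiff ℝ 2 (fun x => 1 + bb u x) ∧ (∀ x, 0 ≤ 1 + bb u x) ∧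
    (∀ x, Lg u (fun x => 1 + bb u x) x = Lg u (bb u) x) ∧ ∀ x, 0 ≤ Lg u (fun x => 1 + bb u x) x := by
  have hb : ContDiff ℝ 2 (bb u) := (bb_smooth h.eqn.hu).of_le two_le_top
  have hL : ∀ x, Lg u (fun x => 1 + bb u x) x = Lg u (bb u) x := fun x => by
    rw [Lg_add contDiff_const hb, Lg_const, zero_add]
  refine ⟨contDiff_const.add hb, fun x => by linarith [bb_nonneg h.eqn.hu x], hL, fun x => ?_⟩
  rw [hL]
  refine le_trans (mul_nonneg hc ?_) (h.jac x)
  exact Finset.sum_nonneg fun k _ => Finset.sum_nonneg fun i _ => Finset.sum_nonneg fun j _ => sq_nonneg _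

/-- energy bound by the drop of the monotone quantity -/
lemma Good.drop {B c : ℝ} (hc : 0 < c) (hn : 1 ≤ n) (h : Good B c u) (h0 : ∀ k, pd k u 0 = 0) :
    min (c / 24) (4 * (1 + Real.exp B ^ 2)⁻¹) * (1 / 2) ^ (n + 5) *
        (∫ x in Metric.closedBall (0 : EE n) (rho n B), En u x) ≤
      FF u (fun x => 1 + bb u x) (1 / 2) - FF u (fun x => 1 + bb u x) 1 := by
  have hu := h.eqn.hu
  obtain ⟨f1, f2, f3, f4⟩ := f_props hc.le h
  have hd := h.eqn.FF_drop hn f1 f2 f4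
  refine le_trans ?_ hd
  set κ := min (c / 24) (4 * (1 + Real.exp B ^ 2)⁻¹) with hκ
  set K := Metric.closedBall (0 : EE n) (rho n B) with hK
  have hKc : IsCompact K := isCompact_closedBall _ _
  rw [mul_comm κ, mul_assoc]
  refine mul_le_mul_of_nonneg_left ?_ (by positivity)
  have iL := IL_integ hu f1 one_pos
  have i3 := I3_integ hu f1.continuous one_pos
  rw [IL, I3, ← integral_add iL i3, ← integral_const_mul]
  have n1 : ∀ x, 0 ≤ ZZ (1 ^ 2 * r2 u x) * Lg u (fun x => 1 + bb u x) x * Vol u x := fun x =>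
    mul_nonneg (mul_nonneg (ZZ_nonneg _) (f4 x)) (Vol_pos hu x).le
  have n2 : ∀ x, 0 ≤ (1 + bb u x) * (2 * mp (1 - 1 ^ 2 * r2 u x)) * DD u x * Vol u x := fun x =>
    mul_nonneg (mul_nonneg (mul_nonneg (f2 x) (mul_nonneg (by norm_num) (mp_nonneg _))) (DD_nonneg hu x)) (Vol_pos hu x).le
  refine le_trans ?_ (setIntegral_le_integral (s := K) (iL.add i3)
    (Filter.Eventually.of_forall fun x => add_nonneg (n1 x) (n2 x)))
  refine setIntegral_mono_on ((continuous_const.mul (En_cont hu)).continuousOn.integrableOn_compact hKc)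
    (iL.add i3).integrableOn hKc.measurableSet fun x hx => ?_
  have hr := r2_half hu h0 h.bd hx
  have hr0 := r2_nonneg (u := u) x
  have hV := Vol_ge_one hu x
  have hb := bb_nonneg hu x
  have hm : 1 / 2 ≤ mp (1 - 1 ^ 2 * r2 u x) := by
    rw [mp_of_nonneg (by linarith)]; linarith
  have hZ : 1 / 24 ≤ ZZ (1 ^ 2 * r2 u x) := by
    unfold ZZ
    have : (1/2:ℝ) ^ 3 ≤ mp (1 - 1 ^ 2 * r2 u x) ^ 3 := by gcongr
    linarith
  have hT : 0 ≤ ∑ k, ∑ i, ∑ j, T3 u k x i j ^ 2 :=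
    Finset.sum_nonneg fun k _ => Finset.sum_nonneg fun i _ => Finset.sum_nonneg fun j _ => sq_nonneg _
  have hW : 0 ≤ ∑ i, wd u i x ^ 2 := Finset.sum_nonneg fun i _ => sq_nonneg _
  have q1 : κ * (∑ k, ∑ i, ∑ j, T3 u k x i j ^ 2) ≤ ZZ (1 ^ 2 * r2 u x) * Lg u (fun x => 1 + bb u x) x * Vol u x := by
    have hj := h.jac x
    have h1 : κ ≤ c / 24 := min_le_left _ _
    have hL0 := f4 x
    calc κ * (∑ k, ∑ i, ∑ j, T3 u k x i j ^ 2) ≤ c / 24 * (∑ k, ∑ i, ∑ j, T3 u k x i j ^ 2) := by gcongr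
      _ = 1 / 24 * (c * (∑ k, ∑ i, ∑ j, T3 u k x i j ^ 2)) * 1 := by ring
      _ ≤ 1 / 24 * Lg u (fun x => 1 + bb u x) x * Vol u x := by
          rw [f3]; rw [f3] at hL0; gcongr
      _ ≤ _ := by gcongr
  have q2 : κ * (∑ i, wd u i x ^ 2) ≤ (1 + bb u x) * (2 * mp (1 - 1 ^ 2 * r2 u x)) * DD u x * Vol u x := by
    have h1 : κ ≤ 4 * (1 + Real.exp B ^ 2)⁻¹ := min_le_right _ _
    have hd0 := DD_nonneg hu x
    calc κ * (∑ i, wd u i x ^ 2) ≤ 4 * (1 + Real.exp B ^ 2)⁻¹ * (∑ i, wd u i x ^ 2) := by gcongr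
      _ ≤ DD u x := by have := DD_ge hu h.bd x; rwa [← mul_assoc] at this
      _ = 1 * (2 * (1 / 2)) * DD u x * 1 := by ring
      _ ≤ _ := by
          gcongr
          linarith
  simp only [En, mul_add]
  exact add_le_add q1 q2

end dpart

section dtwo
open Matrix MeasureTheory
variable {n : ℕ} {u : EE n → ℝ}

lemma pdV_le (h : Eqn u) {B : ℝ} (hB : ∀ x, bb u x ≤ B) (k : Fin n) (x : EE n) :
    |pd k (Vol u) x| ≤ Real.exp B * ∑ i, ∑ j, |T3 u k x i j| := by
  have hu := h.hu
  rw [h.e2, abs_mul, abs_of_pos (Vol_pos hu x)]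
  obtain ⟨Q, l, S⟩ := exists_Spec' hu x
  have hm : ∀ i j, |(Hess u x * gi u x) i j| ≤ 1 := by
    intro i j
    rw [show gi u x = _ from S.inv_eq, S.h3, qcj_mul S.h2]
    refine frame_entry S.h1 (fun a => ?_) i j
    rw [← div_eq_mul_inv, abs_div, abs_of_pos (show 0 < 1 + l a ^ 2 by positivity), div_le_one (by positivity)]
    nlinarith [sq_nonneg (|l a| - 1), sq_abs (l a)]
  gcongr
  · exact Vol_le hu hB x
  · rw [trace, Finset.sum_comm]
    refine (Finset.abs_sum_le_sum_abs _ _).trans (Finset.sum_le_sum fun i _ => ?_)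
    rw [diag_apply, mul_apply]
    refine (Finset.abs_sum_le_sum_abs _ _).trans (Finset.sum_le_sum fun j _ => ?_)
    rw [abs_mul]
    calc _ ≤ 1 * |T3 u k x j i| := by gcongr; exact hm i j
      _ = _ := one_mul _

/-- oscillation quantity -/
noncomputable def GG (u : EE n → ℝ) (z x : EE n) : ℝ :=
  |Vol u x - Vol u z| + (∑ i, |wd u i x|) + ∑ i, ∑ j, |Hess u x i j - Hess u z i j|

lemma r2_qz (hu : ContDiff ℝ (⊤ : ℕ∞) u) (h0 : ∀ k, pd k u 0 = 0) {B : ℝ} (hB : ∀ x, bb u x ≤ B) (z x : EE n)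
    (hx : ‖x‖ ≤ 1) :
    |r2 u x - qz u z x| ≤ 2 * n * Real.exp B * ((∑ i, |wd u i x|) + ∑ i, ∑ j, |Hess u x i j - Hess u z i j|) := by
  rw [r2_eq, qz, ← Finset.sum_sub_distrib, ← Finset.sum_add_distrib, Finset.mul_sum]
  refine (Finset.abs_sum_le_sum_abs _ _).trans (Finset.sum_le_sum fun k _ => ?_)
  set A := ∑ j, Hess u z k j * x j with hA
  have hc : ∀ j, |x j| ≤ 1 := fun j => (coord_le x j).trans hx
  have h1 : |pd k u x| ≤ n * Real.exp B := (du_lip hu h0 hB k x).trans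
    (mul_le_of_le_one_right (by positivity) hx)
  have h2 : |A| ≤ n * Real.exp B := by
    calc |A| ≤ ∑ j, |Hess u z k j * x j| := Finset.abs_sum_le_sum_abs _ _
      _ ≤ ∑ j : Fin n, Real.exp B * 1 := Finset.sum_le_sum fun j _ => by
          rw [abs_mul]
          exact mul_le_mul (Hess_entry hu hB _ _ _) (hc j) (abs_nonneg _) (Real.exp_pos _).le
      _ = _ := by simp
  have h3 : |pd k u x - A| ≤ |wd u k x| + ∑ j, |Hess u x k j - Hess u z k j| := by
    have : pd k u x - A = wd u k x + ∑ j, (Hess u x k j - Hess u z k j) * x j := by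
      rw [wd, hA]; simp only [sub_mul, Finset.sum_sub_distrib]; ring
    rw [this]
    refine (abs_add_le _ _).trans (add_le_add le_rfl ?_)
    refine (Finset.abs_sum_le_sum_abs _ _).trans (Finset.sum_le_sum fun j _ => ?_)
    rw [abs_mul]
    exact mul_le_of_le_one_right (abs_nonneg _) (hc j)
  have h4 : x k ^ 2 + pd k u x ^ 2 - (x k ^ 2 + A ^ 2) = (pd k u x + A) * (pd k u x - A) := by ring
  rw [h4, abs_mul]
  have h5 : |pd k u x + A| ≤ 2 * n * Real.exp B := (abs_add_le _ _).trans (by linarith)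
  exact mul_le_mul h5 h3 (abs_nonneg _) (by positivity)

/-- pointwise constant -/
noncomputable def CC (n : ℕ) (B : ℝ) : ℝ := 1 + Real.exp B * (2 * ((rho n B)⁻¹ ^ 2 * (2 * n * Real.exp B)))

lemma CC_pos (n : ℕ) (B : ℝ) : 0 < CC n B := by have := rho_pos n B; unfold CC; positivity

lemma pw_bound (hu : ContDiff ℝ (⊤ : ℕ∞) u) (h0 : ∀ k, pd k u 0 = 0) {B : ℝ} (hB : ∀ x, bb u x ≤ B) (z x : EE n)
    (hx : ‖x‖ ≤ 1) :
    |1 * zt ((rho n B)⁻¹ ^ 2 * r2 u x) * Vol u x - zt ((rho n B)⁻¹ ^ 2 * qz u z x) * Vol u z| ≤ CC n B * GG u z x := by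
  set τ := (rho n B)⁻¹
  have hτ : 0 < τ := inv_pos.2 (rho_pos n B)
  have a0 : 0 ≤ τ ^ 2 * r2 u x := mul_nonneg (by positivity) (r2_nonneg x)
  have a1 : 0 ≤ τ ^ 2 * qz u z x := mul_nonneg (by positivity) (qz_nonneg z x)
  have hl := zt_lip a0 a1
  rw [← mul_sub, abs_mul, abs_of_pos (show 0 < τ ^ 2 by positivity)] at hl
  have hq := r2_qz hu h0 hB z x hx
  set S := (∑ i, |wd u i x|) + ∑ i, ∑ j, |Hess u x i j - Hess u z i j| with hS
  have hS0 : 0 ≤ S := add_nonneg (Finset.sum_nonneg fun _ _ => abs_nonneg _)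
    (Finset.sum_nonneg fun _ _ => Finset.sum_nonneg fun _ _ => abs_nonneg _)
  have e : 1 * zt (τ ^ 2 * r2 u x) * Vol u x - zt (τ ^ 2 * qz u z x) * Vol u z =
      zt (τ ^ 2 * r2 u x) * (Vol u x - Vol u z) + Vol u z * (zt (τ ^ 2 * r2 u x) - zt (τ ^ 2 * qz u z x)) := by ring
  have hG : GG u z x = |Vol u x - Vol u z| + S := by rw [GG, hS]; ring
  rw [e, hG]
  refine (abs_add_le _ _).trans ?_
  rw [abs_mul, abs_mul, abs_of_nonneg (zt_nonneg _), abs_of_pos (Vol_pos hu z)]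
  have b1 : zt (τ ^ 2 * r2 u x) * |Vol u x - Vol u z| ≤ 1 * |Vol u x - Vol u z| := by
    gcongr; exact zt_le_one a0
  have b2 : Vol u z * |zt (τ ^ 2 * r2 u x) - zt (τ ^ 2 * qz u z x)| ≤
      Real.exp B * (2 * (τ ^ 2 * (2 * n * Real.exp B * S))) := by
    have := (Vol_pos hu z).le
    gcongr
    · exact Vol_le hu hB z
    · refine hl.trans ?_
      gcongr
  have b3 : 0 ≤ Real.exp B * (2 * (τ ^ 2 * (2 * n * Real.exp B))) * |Vol u x - Vol u z| := by positivity
  have b4 : CC n B = 1 + Real.exp B * (2 * (τ ^ 2 * (2 * n * Real.exp B))) := rfl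
  rw [b4]
  linarith

lemma GG_cont (hu : ContDiff ℝ (⊤ : ℕ∞) u) : Continuous fun p : EE n × EE n => GG u p.1 p.2 := by
  unfold GG
  have h1 := Vol_cont hu
  have h2 := W1_cont hu
  have h3 : ∀ i j, Continuous fun x => Hess u x i j := fun i j => (Hess_smooth hu i j).continuous
  exact (((h1.comp continuous_snd).sub (h1.comp continuous_fst)).abs.add (h2.comp continuous_snd)).add
    (continuous_finsetSum _ fun i _ => continuous_finsetSum _ fun j _ =>
      (((h3 i j).comp continuous_snd).sub ((h3 i j).comp continuous_fst)).abs)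

lemma FF_C0 (hu : ContDiff ℝ (⊤ : ℕ∞) u) (h0 : ∀ k, pd k u 0 = 0) {B : ℝ} (hB : ∀ x, bb u x ≤ B) (z : EE n) :
    |FF u (fun _ => 1) (rho n B)⁻¹ - C0 n| ≤
      (rho n B)⁻¹ ^ n * (CC n B * ∫ x in Metric.closedBall (0 : EE n) (rho n B), GG u z x) := by
  have hρ := rho_pos n B
  have hτ : 0 < (rho n B)⁻¹ := inv_pos.2 hρ
  rw [← cov hu z hτ, FF, KK, ← mul_sub, abs_mul, abs_of_pos (by positivity)]
  have hKc : IsCompact (Metric.closedBall (0 : EE n) (rho n B)) := isCompact_closedBall _ _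
  have hz1 : ∀ x, x ∉ Metric.closedBall (0 : EE n) (rho n B) → 1 * zt ((rho n B)⁻¹ ^ 2 * r2 u x) * Vol u x = 0 := fun x hx => by
    rw [zt_zero (out_ball hτ le_rfl (by rwa [inv_inv]))]; ring
  have hz2 : ∀ x, x ∉ Metric.closedBall (0 : EE n) (rho n B) → zt ((rho n B)⁻¹ ^ 2 * qz u z x) * Vol u z = 0 := fun x hx => by
    have h1 : rho n B < ‖x‖ := by simpa using hx
    have h2 : 1 ≤ (rho n B)⁻¹ ^ 2 * qz u z x := by
      have := qz_ge (u := u) z x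
      calc (1:ℝ) = (rho n B)⁻¹ ^ 2 * rho n B ^ 2 := by field_simp
        _ ≤ (rho n B)⁻¹ ^ 2 * ‖x‖ ^ 2 := by gcongr
        _ ≤ _ := by gcongr
    rw [zt_zero h2, zero_mul]
  rw [← setIntegral_eq_integral_of_forall_compl_eq_zero hz1, ← setIntegral_eq_integral_of_forall_compl_eq_zero hz2]
  have i1 : IntegrableOn (fun x => 1 * zt ((rho n B)⁻¹ ^ 2 * r2 u x) * Vol u x) (Metric.closedBall (0 : EE n) (rho n B)) :=
    (KK_integ hu (f := fun _ => 1) continuous_const hτ).integrableOn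
  have i2 : IntegrableOn (fun x => zt ((rho n B)⁻¹ ^ 2 * qz u z x) * Vol u z) (Metric.closedBall (0 : EE n) (rho n B)) :=
    (((zt_cont.comp (continuous_const.mul (qz_cont z))).mul continuous_const).continuousOn).integrableOn_compact hKc
  have i3 : IntegrableOn (fun x => CC n B * GG u z x) (Metric.closedBall (0 : EE n) (rho n B)) :=
    (continuous_const.mul ((GG_cont hu).comp (Continuous.prodMk_right z))).continuousOn.integrableOn_compact hKc
  rw [← integral_sub i1 i2, ← integral_const_mul]
  gcongr
  refine abs_integral_le_integral_abs.trans ?_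
  refine setIntegral_mono_on (i1.sub i2).abs i3 hKc.measurableSet fun x hx => ?_
  exact pw_bound hu h0 hB z x ((show ‖x‖ ≤ rho n B by simpa using hx).trans (rho_le n B))

/-- final constant -/
noncomputable def CD (n : ℕ) (B : ℝ) : ℝ :=
  (rho n B)⁻¹ ^ n * (CC n B * (2 * (rho n B * 2 ^ n * (Real.exp B + 1)) + 1))

lemma CD_pos (n : ℕ) (B : ℝ) : 0 < CD n B := by
  have := rho_pos n B; have := CC_pos n B; unfold CD; positivity

lemma FF_close (h : Eqn u) (h0 : ∀ k, pd k u 0 = 0) {B : ℝ} (hB : ∀ x, bb u x ≤ B) :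
    |FF u (fun _ => 1) (rho n B)⁻¹ - C0 n| ≤
      CD n B * ∫ x in Metric.closedBall (0 : EE n) (rho n B), En1 u x := by
  have hu := h.hu
  have hρ := rho_pos n B
  set K := Metric.closedBall (0 : EE n) (rho n B) with hK
  have hKc : IsCompact K := isCompact_closedBall _ _
  set v := volume.real K with hv
  have hvp : 0 < v := by
    rw [hv, Measure.real, ENNReal.toReal_pos_iff]
    exact ⟨(Metric.measure_closedBall_pos _ _ hρ), hKc.measure_lt_top⟩
  set T := ∫ x in K, ∑ k, ∑ i, ∑ j, |T3 u k x i j| with hT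
  set W := ∫ x in K, ∑ i, |wd u i x| with hW
  have hT0 : 0 ≤ T := integral_nonneg fun x => Finset.sum_nonneg fun _ _ => Finset.sum_nonneg fun _ _ =>
    Finset.sum_nonneg fun _ _ => abs_nonneg _
  have hW0 : 0 ≤ W := integral_nonneg fun x => Finset.sum_nonneg fun _ _ => abs_nonneg _
  have iT : IntegrableOn (fun x => ∑ k, ∑ i, ∑ j, |T3 u k x i j|) K := (A3_cont hu).continuousOn.integrableOn_compact hKc
  have iW : IntegrableOn (fun x => ∑ i, |wd u i x|) K := (W1_cont hu).continuousOn.integrableOn_compact hKc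
  have hE : ∫ x in K, En1 u x = T + W := integral_add iT iW
  have hVs : ContDiff ℝ 1 (Vol u) := (Vol_smooth hu).of_le one_le_top'
  have hHs : ∀ i j, ContDiff ℝ 1 (fun x => Hess u x i j) := fun i j => (Hess_smooth hu i j).of_le one_le_top'
  have pV : ∫ z in K, ∫ x in K, |Vol u x - Vol u z| ≤ 2 * (v * (rho n B * 2 ^ n * (Real.exp B * T))) := by
    refine (poincare hρ.le hVs).trans ?_
    gcongr
    rw [hT, ← integral_const_mul]
    refine setIntegral_mono_on ?_ (iT.const_mul _) hKc.measurableSet fun x _ => ?_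
    · exact (continuous_finsetSum _ fun i _ => (C1.pdc hVs i).abs).continuousOn.integrableOn_compact hKc
    · rw [Finset.mul_sum]
      exact Finset.sum_le_sum fun k _ => pdV_le h hB k x
  -- Poincare for H
  have pH : ∑ i, ∑ j, ∫ z in K, ∫ x in K, |Hess u x i j - Hess u z i j| ≤ 2 * (v * (rho n B * 2 ^ n * T)) := by
    have e1 : ∀ i j, ∫ z in K, ∫ x in K, |Hess u x i j - Hess u z i j| ≤
        2 * (v * (rho n B * 2 ^ n * ∫ x in K, ∑ k, |T3 u k x i j|)) := fun i j => by
      have := poincare hρ.le (hHs i j)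
      simp only [← T3_eq hu] at this
      exact this
    calc _ ≤ ∑ i, ∑ j, 2 * (v * (rho n B * 2 ^ n * ∫ x in K, ∑ k, |T3 u k x i j|)) :=
          Finset.sum_le_sum fun i _ => Finset.sum_le_sum fun j _ => e1 i j
      _ = 2 * (v * (rho n B * 2 ^ n * ∑ i, ∑ j, ∫ x in K, ∑ k, |T3 u k x i j|)) := by
          simp only [← Finset.mul_sum]
      _ = _ := by
          have ic : ∀ i j, IntegrableOn (fun x => ∑ k, |T3 u k x i j|) K := fun i j =>
            (continuous_finsetSum _ fun k _ => (T3_smooth hu k i j).continuous.abs).continuousOn.integrableOn_compact hKc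
          have : ∑ i, ∑ j, ∫ x in K, ∑ k, |T3 u k x i j| = T := by
            rw [hT]
            have e2 : ∀ i, ∑ j, ∫ x in K, ∑ k, |T3 u k x i j| = ∫ x in K, ∑ j, ∑ k, |T3 u k x i j| := fun i =>
              (integral_finsetSum _ fun j _ => ic i j).symm
            rw [Finset.sum_congr rfl fun i _ => e2 i, ← integral_finsetSum _ fun i _ => integrable_finsetSum _ fun j _ => ic i j]
            congr 1; ext x
            rw [Finset.sum_comm' (t' := Finset.univ) (s' := fun _ => Finset.univ) (by simp)]
            rw [Finset.sum_congr rfl fun i _ => Finset.sum_comm]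
            rw [Finset.sum_comm]
            rw [Finset.sum_congr rfl fun i _ => Finset.sum_comm]
          rw [this]
  -- integrate GG
  have c1 : Continuous fun p : EE n × EE n => |Vol u p.2 - Vol u p.1| :=
    (((Vol_cont hu).comp continuous_snd).sub ((Vol_cont hu).comp continuous_fst)).abs
  have c2 : Continuous fun p : EE n × EE n => ∑ i, |wd u i p.2| := (W1_cont hu).comp continuous_snd
  have c3 : ∀ i j, Continuous fun p : EE n × EE n => |Hess u p.2 i j - Hess u p.1 i j| := fun i j =>
    (((Hess_smooth hu i j).continuous.comp continuous_snd).sub ((Hess_smooth hu i j).continuous.comp continuous_fst)).abs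
  have j1 := integ_prod_of_cont hKc hKc c1
  have j2 := integ_prod_of_cont hKc hKc c2
  have j3 := fun i j => integ_prod_of_cont hKc hKc (c3 i j)
  have jG := integ_prod_of_cont hKc hKc (GG_cont hu)
  have j3' : Integrable (fun p : EE n × EE n => ∑ i, ∑ j, |Hess u p.2 i j - Hess u p.1 i j|)
      ((volume.restrict K).prod (volume.restrict K)) :=
    integrable_finsetSum _ fun i _ => integrable_finsetSum _ fun j _ => j3 i j
  have hGG : ∫ z in K, ∫ x in K, GG u z x ≤
      v * ((2 * (rho n B * 2 ^ n * (Real.exp B + 1)) + 1) * (T + W)) := by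
    have e0 : ∫ z in K, ∫ x in K, GG u z x = (∫ z in K, ∫ x in K, |Vol u x - Vol u z|) + v * W +
        ∑ i, ∑ j, ∫ z in K, ∫ x in K, |Hess u x i j - Hess u z i j| := by
      have q0 := integral_prod _ jG
      have q1 := integral_prod _ j1
      have q2 := integral_prod _ j2
      have q3 := fun i j => integral_prod _ (j3 i j)
      simp only at q0 q1 q2 q3
      rw [← q0, ← q1, Finset.sum_congr rfl fun i _ => Finset.sum_congr rfl fun j _ => (q3 i j).symm]
      have q4 : v * W = ∫ z in K, ∫ x in K, ∑ i, |wd u i x| := by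
        rw [setIntegral_const, smul_eq_mul]
      rw [q4, ← q2]
      simp only [GG]
      have j12 : Integrable (fun p : EE n × EE n => |Vol u p.2 - Vol u p.1| + ∑ i, |wd u i p.2|)
          ((volume.restrict K).prod (volume.restrict K)) := j1.add j2
      rw [integral_add j12 j3', integral_add j1 j2, integral_finsetSum _ fun i _ => integrable_finsetSum _ fun j _ => j3 i j]
      congr 1
      exact Finset.sum_congr rfl fun i _ => integral_finsetSum _ fun j _ => j3 i j
    rw [e0]
    have p1 : 0 ≤ v * (2 * (rho n B * 2 ^ n * (Real.exp B + 1)) * W + T) := by positivity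
    linarith
  -- average
  have hav : v * |FF u (fun _ => 1) (rho n B)⁻¹ - C0 n| ≤
      ∫ z in K, (rho n B)⁻¹ ^ n * (CC n B * ∫ x in K, GG u z x) := by
    rw [← smul_eq_mul, hv, ← setIntegral_const]
    exact setIntegral_mono_on (integrableOn_const hKc.measure_lt_top.ne)
      ((jG.integral_prod_left.const_mul _).const_mul _) hKc.measurableSet fun z _ => FF_C0 hu h0 hB z
  rw [integral_const_mul, integral_const_mul] at hav
  have hCC := CC_pos n B
  rw [hE]
  refine le_of_mul_le_mul_left (hav.trans ?_) hvp
  calc _ ≤ (rho n B)⁻¹ ^ n * (CC n B * (v * ((2 * (rho n B * 2 ^ n * (Real.exp B + 1)) + 1) * (T + W)))) := by gcongr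
    _ = _ := by rw [CD]; ring

end dtwo

section limit
open Matrix MeasureTheory Filter Topology
variable {n : ℕ} {u : EE n → ℝ}

lemma close_drop {B c : ℝ} (hc : 0 < c) (hn : 1 ≤ n) : ∃ M N : ℝ, 0 ≤ M ∧ 0 ≤ N ∧ ∀ u : EE n → ℝ, Good B c u →
    (∀ k, pd k u 0 = 0) → ∀ t : ℝ, 0 < t →
    |FF u (fun _ => 1) (rho n B)⁻¹ - C0 n| ≤
      M * t + N * t⁻¹ * (FF u (fun x => 1 + bb u x) (1 / 2) - FF u (fun x => 1 + bb u x) 1) := by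
  set K := Metric.closedBall (0 : EE n) (rho n B) with hK
  have hKc : IsCompact K := isCompact_closedBall _ _
  set κ := min (c / 24) (4 * (1 + Real.exp B ^ 2)⁻¹) * (1 / 2) ^ (n + 5) with hκ
  have hκp : 0 < κ := by
    rw [hκ]
    exact mul_pos (lt_min (by positivity) (by positivity)) (by positivity)
  have hCD := CD_pos n B
  refine ⟨CD n B * (volume.real K * (n * n * n + n)), CD n B * κ⁻¹, by positivity, by positivity, ?_⟩
  intro u h h0 t ht
  have hu := h.eqn.hu
  have h1 := FF_close h.eqn h0 h.bd
  have h2 := h.drop hc hn h0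
  rw [← hκ, ← hK] at h2
  have iE : IntegrableOn (En u) K := (En_cont hu).continuousOn.integrableOn_compact hKc
  have iE1 : IntegrableOn (En1 u) K := (En1_cont hu).continuousOn.integrableOn_compact hKc
  have h3 : ∫ x in K, En1 u x ≤ volume.real K * (t * (n * n * n + n)) + t⁻¹ * ∫ x in K, En u x := by
    calc _ ≤ ∫ x in K, (t * (n * n * n + n) + t⁻¹ * En u x) :=
          setIntegral_mono_on iE1 ((integrableOn_const hKc.measure_lt_top.ne).add (iE.const_mul _)) hKc.measurableSet
            fun x _ => En1_le x ht
      _ = _ := by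
          have ic : IntegrableOn (fun _ : EE n => t * ((n:ℝ) * n * n + n)) K := integrableOn_const hKc.measure_lt_top.ne
          rw [integral_add ic (iE.const_mul _), setIntegral_const, smul_eq_mul,
            integral_const_mul]
  set d := FF u (fun x => 1 + bb u x) (1 / 2) - FF u (fun x => 1 + bb u x) 1 with hd
  have h4 : ∫ x in K, En u x ≤ κ⁻¹ * d := by
    rw [← div_eq_inv_mul, le_div_iff₀' hκp]; exact h2
  have h5 : t⁻¹ * ∫ x in K, En u x ≤ t⁻¹ * (κ⁻¹ * d) := by gcongr
  calc _ ≤ CD n B * ∫ x in K, En1 u x := h1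
    _ ≤ CD n B * (volume.real K * (t * (n * n * n + n)) + t⁻¹ * (κ⁻¹ * d)) := by gcongr; linarith
    _ = _ := by ring

lemma FF_blow {B c : ℝ} (hc : 0 < c) (hn : 1 ≤ n) (h : Good B c u) (h0 : ∀ k, pd k u 0 = 0) :
    Tendsto (fun k : ℕ => FF u (fun _ => 1) ((rho n B)⁻¹ / 2 ^ k)) atTop (𝓝 (C0 n)) := by
  have hu := h.eqn.hu
  obtain ⟨M, N, hM, hN, H⟩ := close_drop (B := B) hc hn
  set f : EE n → ℝ := fun x => 1 + bb u x with hf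
  obtain ⟨f1, f2, f3, f4⟩ := f_props hc.le h
  have hR : ∀ k : ℕ, (0:ℝ) < 2 ^ k := fun k => by positivity
  have hfr : ∀ k : ℕ, (fun y => 1 + bb (resc u 0 (2 ^ k)) y) = fun y => f ((2:ℝ) ^ k • y) := fun k => by
    ext y; rw [resc_bb hu (hR k).ne']; simp [hf]
  set a : ℕ → ℝ := fun k => FF u f (1 / 2 ^ k) with ha
  have hmono : Monotone a := by
    refine monotone_nat_of_le_succ fun k => ?_
    refine h.eqn.FF_anti hn f1 f2 f4 (show (0:ℝ) < 1 / 2 ^ (k+1) by positivity) (show (0:ℝ) < 1 / 2 ^ k by positivity) ?_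
    gcongr
    · norm_num
    · omega
  have hbd : ∀ k, a k ≤ volume.real (Metric.closedBall (0 : EE n) 1) * ((1 + B) * Real.exp B) := fun k => by
    have g := h.resc 0 (hR k).ne'
    have := FF_le (u := resc u 0 (2 ^ k)) g.eqn.hu g.bd (f := fun y => f ((2:ℝ) ^ k • y)) (M := 1 + B)
      (f1.continuous.comp (by fun_prop)) (fun y => f2 _) (fun y => by have := h.bd ((2:ℝ) ^ k • y); simp only [hf]; linarith)
    rwa [FF_resc hu h0 f (hR k)] at this
  have hlim : Tendsto a atTop (𝓝 (⨆ k, a k)) :=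
    tendsto_atTop_ciSup hmono ⟨_, by rintro _ ⟨k, rfl⟩; exact hbd k⟩
  have hd : Tendsto (fun k => a (k + 1) - a k) atTop (𝓝 0) := by
    have := ((tendsto_add_atTop_iff_nat 1).2 hlim).sub hlim
    rwa [sub_self] at this
  have key : ∀ k (t : ℝ), 0 < t → |FF u (fun _ => 1) ((rho n B)⁻¹ / 2 ^ k) - C0 n| ≤ M * t + N * t⁻¹ * (a (k + 1) - a k) := by
    intro k t ht
    have g := h.resc 0 (hR k).ne'
    have := H _ g (fun j => resc_du0 hu (hR k).ne' j) t ht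
    rw [hfr k, FF_resc hu h0 f (hR k), FF_resc hu h0 f (hR k), FF_resc hu h0 (fun _ => 1) (hR k)] at this
    have e : (1 / 2 : ℝ) / 2 ^ k = 1 / 2 ^ (k + 1) := by rw [pow_succ]; field_simp
    rwa [e] at this
  rw [Metric.tendsto_atTop']
  intro e he
  set t := e / (2 * (M + 1)) with ht
  have htp : 0 < t := by positivity
  have hMt : M * t < e := by
    rw [ht, ← mul_div_assoc, div_lt_iff₀ (by positivity)]; nlinarith
  have hl : Tendsto (fun k => M * t + N * t⁻¹ * (a (k + 1) - a k)) atTop (𝓝 (M * t + N * t⁻¹ * 0)) :=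
    tendsto_const_nhds.add (tendsto_const_nhds.mul hd)
  rw [mul_zero, add_zero] at hl
  obtain ⟨k0, hk0⟩ := eventually_atTop.1 (hl.eventually_lt_const hMt)
  exact ⟨k0, fun k hk => by rw [Real.dist_eq]; exact (key k t htp).trans_lt (hk0 k hk.le)⟩

lemma FF_eq {B c : ℝ} (hc : 0 < c) (hn : 1 ≤ n) (h : Good B c u) (h0 : ∀ k, pd k u 0 = 0) {τ : ℝ} (hτ : 0 < τ) :
    FF u (fun _ => 1) τ = C0 n := by
  have hu := h.eqn.hu
  have anti := h.eqn.FF_anti hn (f := fun _ => 1) contDiff_const (fun _ => zero_le_one) (fun x => by rw [Lg_const])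
  have hρ := inv_pos.2 (rho_pos n B)
  apply le_antisymm
  · refine ge_of_tendsto (FF_blow hc hn h h0) ?_
    have hz : Tendsto (fun k : ℕ => (rho n B)⁻¹ / 2 ^ k) atTop (𝓝 0) := by
      have := (tendsto_pow_atTop_nhds_zero_of_lt_one (r := (1/2:ℝ)) (by norm_num) (by norm_num)).const_mul (rho n B)⁻¹
      rw [mul_zero] at this
      refine this.congr fun k => ?_
      rw [one_div, inv_pow, div_eq_mul_inv]
    filter_upwards [hz.eventually_lt_const hτ] with k hk
    exact anti (show 0 < (rho n B)⁻¹ / 2 ^ k by positivity) hτ hk.le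
  · refine le_of_tendsto (FF_lim hu h0 h.bd) ?_
    filter_upwards [(tendsto_pow_atTop_atTop_of_one_lt (show (1:ℝ) < 2 by norm_num)).eventually_ge_atTop τ] with k hk
    exact anti hτ (show (0:ℝ) < 2 ^ k by positivity) hk

lemma wd_zero {B c : ℝ} (hc : 0 < c) (hn : 1 ≤ n) (h : Good B c u) (h0 : ∀ k, pd k u 0 = 0) (i : Fin n) (x : EE n) :
    wd u i x = 0 := by
  have hu := h.eqn.hu
  refine DD_zero hu ?_ i
  set τ : ℝ := (1 + r2 u x)⁻¹ with hτd
  have hr := r2_nonneg (u := u) x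
  have hτ : 0 < τ := by positivity
  have hd := h.eqn.FF_deriv hn (f := fun _ => 1) contDiff_const hτ
  have hd2 : HasDerivAt (FF u (fun _ => 1)) 0 τ := by
    refine (hasDerivAt_const τ (C0 n)).congr_of_eventuallyEq ?_
    filter_upwards [lt_mem_nhds hτ] with σ hσ using FF_eq hc hn h h0 hσ
  have e := hd.unique hd2
  have hIL : IL u (fun _ => 1) τ = 0 := by simp [IL, Lg_const]
  rw [hIL, zero_add] at e
  have hI3 : I3 u (fun _ => 1) τ = 0 := by
    rw [neg_eq_zero] at e
    have h1 : τ ^ (n - 1) ≠ 0 := by positivity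
    have h2 : (2 * τ ^ 2)⁻¹ ≠ 0 := by positivity
    have h3 : τ ^ 4 ≠ 0 := by positivity
    simpa [h1, h2, h3, hτ.ne'] using e
  have nn : ∀ y, 0 ≤ 1 * (2 * mp (1 - τ ^ 2 * r2 u y)) * DD u y * Vol u y := fun y =>
    mul_nonneg (mul_nonneg (mul_nonneg zero_le_one (mul_nonneg (by norm_num) (mp_nonneg _))) (DD_nonneg hu y)) (Vol_pos hu y).le
  have cc : Continuous fun y => 1 * (2 * mp (1 - τ ^ 2 * r2 u y)) * DD u y * Vol u y :=
    ((continuous_const.mul (continuous_const.mul (mpr_cont hu τ))).mul (DD_cont hu)).mul (Vol_cont hu)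
  have ii := I3_integ hu (f := fun _ => 1) continuous_const hτ
  have hae := (integral_eq_zero_iff_of_nonneg nn ii).1 hI3
  have hfun := (Continuous.ae_eq_iff_eq volume cc continuous_const).1 hae
  have hx : 1 * (2 * mp (1 - τ ^ 2 * r2 u x)) * DD u x * Vol u x = (0:ℝ) := congrFun hfun x
  have hpos : 0 < mp (1 - τ ^ 2 * r2 u x) := by
    have : τ ^ 2 * r2 u x < 1 := by
      rw [hτd, inv_pow, inv_mul_lt_iff₀ (by positivity)]; nlinarith
    rw [mp_of_nonneg (by linarith)]; linarith
  have hV := Vol_pos hu x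
  simpa [hpos.ne', hV.ne'] using hx

lemma Good.quad {B c : ℝ} (hc : 0 < c) (hn : 1 ≤ n) (h : Good B c u) (i : Fin n) (x : EE n) :
    pd i u x = pd i u 0 + ∑ k, Hess u 0 i k * x k := by
  have hu := h.eqn.hu
  have h1 := wd_zero hc hn (h.resc x one_ne_zero) (fun k => resc_du0 hu one_ne_zero k) i (-x)
  rw [wd, resc_pd hu one_ne_zero, resc_Hess hu one_ne_zero] at h1
  simp at h1
  linarith

end limit

lemma quad_of_grad {n : ℕ} {u : EE n → ℝ} (hu : ContDiff ℝ (⊤ : ℕ∞) u)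
    (hq : ∀ (i : Fin n) (x : EE n), pd i u x = pd i u 0 + ∑ k, Hess u 0 i k * x k) (x : EE n) :
    u x = (1 / 2) * ∑ i, ∑ j, Hess u 0 i j * x i * x j + ∑ i, pd i u 0 * x i + u 0 := by
  set S := ∑ i, ∑ j, Hess u 0 i j * x i * x j with hS
  set b := ∑ i, pd i u 0 * x i with hb
  have hd : ∀ t : ℝ, HasDerivAt (fun t : ℝ => u (0 + t • x) - (t ^ 2 * (S / 2) + t * b)) 0 t := fun t => by
    have h1 := hasDerivAt_lineV (f := u) (smooth_diff hu) 0 x t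
    have h2 : HasDerivAt (fun t : ℝ => t ^ 2 * (S / 2) + t * b) (2 * t * (S / 2) + 1 * b) t := by
      have := ((hasDerivAt_pow 2 t).mul_const (S / 2)).fun_add ((hasDerivAt_id t).mul_const b)
      simpa using this
    refine (h1.sub h2).congr_deriv ?_
    have : ∑ i, x i * pd i u (0 + t • x) = b + t * S := by
      rw [hb, hS, Finset.mul_sum, ← Finset.sum_add_distrib]
      refine Finset.sum_congr rfl fun i _ => ?_
      rw [hq, mul_add, Finset.mul_sum, Finset.mul_sum, mul_comm (x i)]
      congr 1
      refine Finset.sum_congr rfl fun j _ => ?_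
      simp; ring
    rw [this]; ring
  have := is_const_of_deriv_eq_zero (fun t => (hd t).differentiableAt) (fun t => (hd t).deriv) 1 0
  simp at this
  linarith

/-- Liouville theorem for special Lagrangian equations with the `ε`-convexity
constraint and restricted linear growth of the gradient (Theorem 1.1). -/
theorem stmt_0 {n : ℕ} (hn : 2 ≤ n) (u : EuclideanSpace ℝ (Fin n) → ℝ) (c : ℝ)
    (hu : ContDiff ℝ (⊤ : ℕ∞) u)
    (hsym : ∀ x, (Hess u x).IsHermitian)
    (hsol : ∀ x, ∑ i, Real.arctan ((hsym x).eigenvalues i) = c)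
    (ε : ℝ) (hε : 0 < ε)
    (hcond : ∀ x, ∀ i j : Fin n,
      0 ≤ 3 + (1 - ε) * ((hsym x).eigenvalues i) ^ 2 +
        2 * (hsym x).eigenvalues i * (hsym x).eigenvalues j)
    (δ : ℝ) (hδ : δ < 1 / Real.sqrt ((n : ℝ) - 1))
    (hgrad : ∃ R : ℝ, ∀ x : EuclideanSpace ℝ (Fin n), R ≤ ‖x‖ → ‖gradient u x‖ ≤ δ * ‖x‖) :
    ∃ (A : Matrix (Fin n) (Fin n) ℝ) (b : Fin n → ℝ) (c₀ : ℝ), A.IsSymm ∧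
      ∀ x : EuclideanSpace ℝ (Fin n),
        u x = (1 / 2) * ∑ i, ∑ j, A i j * x i * x j + ∑ i, b i * x i + c₀ := by
  have hE : Eqn u := ⟨hu, fun x k => (first_order hu hsym hsol x k).1, fun x k => (first_order hu hsym hsol x k).2⟩
  have hC : CondAt ε u := fun x => by
    obtain ⟨Q, S⟩ := exists_Spec hsym x
    exact ⟨Q, _, S, hcond x⟩
  have hn' : (2:ℝ) ≤ n := by exact_mod_cast hn
  have hn1 : (0:ℝ) < (n:ℝ) - 1 := by linarith
  set d := max δ 0 with hd
  have hd0 : 0 ≤ d := le_max_right _ _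
  have hd1 : d < 1 / Real.sqrt ((n : ℝ) - 1) := max_lt hδ (by positivity)
  have hd2 : d ^ 2 * ((n:ℝ) - 1) < 1 := by
    have h1 : d ^ 2 < (1 / Real.sqrt ((n : ℝ) - 1)) ^ 2 := by gcongr
    rw [div_pow, Real.sq_sqrt hn1.le, one_pow, lt_div_iff₀ hn1] at h1
    exact h1
  obtain ⟨R0, hR0⟩ := hgrad
  obtain ⟨B, hB⟩ : ∃ B, ∀ x, bb u x ≤ B := by
    refine hess_step hE (m := ε / (3 * n)) (by positivity) (jac_ineq1 hE hε (by omega) hC)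
      (K := ((n:ℝ) - 1) + (1 - d ^ 2 * ((n:ℝ) - 1)) / 2) (δ := d) (R0 := R0) (by linarith) (by omega) ?_ ?_
    · have : d ^ 2 ≤ 1 := by nlinarith [sq_nonneg d]
      nlinarith
    · intro x hx
      rw [← norm_gradient_sq, ← mul_pow]
      have h1 : ‖gradient u x‖ ≤ d * ‖x‖ := (hR0 x hx).trans (by gcongr; exact le_max_left _ _)
      gcongr
  have hG : Good B (min 1 (ε / Real.exp B ^ 2) / 3 * (1 / (1 + Real.exp B ^ 2)) ^ 3) u :=
    ⟨hE, hB, jac_ineq2 hE hε (by positivity) hC (l_bound hu hB)⟩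
  have hc0 : 0 < min 1 (ε / Real.exp B ^ 2) / 3 * (1 / (1 + Real.exp B ^ 2)) ^ 3 := by
    have : 0 < min 1 (ε / Real.exp B ^ 2) := lt_min one_pos (by positivity)
    positivity
  refine ⟨Hess u 0, fun i => pd i u 0, u 0, ?_, quad_of_grad hu (hG.quad hc0 (by omega))⟩
  have := hsym 0
  rwa [Matrix.IsHermitian, Matrix.conjTranspose_eq_transpose_of_trivial] at this
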